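/- arXiv:1802.01932 — 9 statements merged into one kernel-verified Lean document; each statement's English description precedes it below -/
import Mathlib

section
/- Critical perturbed Moser–Trudinger inequality: C_{g,4π}(Ω) is finite, i.e. there exists a constant K < ∞ such that ∫_Ω (1 + g(u(x)))·exp(u(x)²) dx ≤ K for every smooth compactly supported u : Ω → ℝ with ∫_Ω |∇u(x)|² dx ≤ 4π. -/
open MeasureTheory Filter

namespace MoserTrudinger

/-- The unit vector of argument `θ` in the complex plane. -/
noncomputable def unitVec (θ : ℝ) : ℂ := Real.cos θ + Real.sin θ * Complex.I

@[fun_prop]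
lemma continuous_unitVec : Continuous unitVec := by
  unfold unitVec; fun_prop

lemma unitVec_ne_zero (θ : ℝ) : unitVec θ ≠ 0 := by
  intro h
  have h1 := congrArg Complex.re h
  have h2 := congrArg Complex.im h
  simp [unitVec, -Complex.ofReal_cos, -Complex.ofReal_sin] at h1 h2
  have := Real.sin_sq_add_cos_sq θ
  simp [h1, h2] at this

lemma clm_unitVec (L : ℂ →L[ℝ] ℝ) (θ : ℝ) :
    L (unitVec θ) = L 1 * Real.cos θ + L Complex.I * Real.sin θ := by
  have : unitVec θ = Real.cos θ • (1 : ℂ) + Real.sin θ • Complex.I := by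
    simp [unitVec]
  rw [this, map_add, map_smul, map_smul]
  simp [mul_comm]

lemma sq_add_sq_le_norm_sq (L : ℂ →L[ℝ] ℝ) : L 1 ^ 2 + L Complex.I ^ 2 ≤ ‖L‖ ^ 2 := by
  set a := L 1
  set b := L Complex.I
  have h := L.le_opNorm (a • (1 : ℂ) + b • Complex.I)
  have h1 : L (a • (1 : ℂ) + b • Complex.I) = a ^ 2 + b ^ 2 := by
    rw [map_add, map_smul, map_smul]; simp [a, b, sq]
  have h2 : ‖a • (1 : ℂ) + b • Complex.I‖ ^ 2 = a ^ 2 + b ^ 2 := by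
    rw [Complex.sq_norm, Complex.normSq_apply]; simp; ring
  rw [h1, Real.norm_of_nonneg (by positivity)] at h
  set n := ‖a • (1 : ℂ) + b • Complex.I‖
  have hn : 0 ≤ n := norm_nonneg _
  rw [← h2] at h ⊢
  rcases hn.eq_or_lt with h0 | h0
  · rw [← h0, zero_pow two_ne_zero]; exact sq_nonneg _
  · have : n ≤ ‖L‖ := by
      by_contra! hc; nlinarith
    gcongr

lemma lintegral_Ioi_ofReal_sub_mul_le (p : ℝ) {q : ℝ} (hq : 0 < q) :
    ∫⁻ r in Set.Ioi (0 : ℝ), ENNReal.ofReal (p - q * r) ≤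
      ENNReal.ofReal (max p 0 ^ 2 / (2 * q)) := by
  rcases le_or_gt p 0 with hp | hp
  · rw [setLIntegral_congr_fun (g := fun _ => 0) measurableSet_Ioi]
    · simp
    · intro r hr
      have : 0 < r := hr
      exact ENNReal.ofReal_of_nonpos (by nlinarith)
  · have hpq : 0 ≤ p / q := by positivity
    rw [← Set.Ioc_union_Ioi_eq_Ioi hpq]
    refine (lintegral_union_le _ _ _).trans ?_
    have h2 : ∫⁻ r in Set.Ioi (p / q), ENNReal.ofReal (p - q * r) = 0 := by
      rw [setLIntegral_congr_fun (g := fun _ => 0) measurableSet_Ioi]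
      · simp
      · intro r hr
        have h : p / q < r := hr
        rw [div_lt_iff₀ hq] at h
        exact ENNReal.ofReal_of_nonpos (by nlinarith)
    rw [h2, add_zero, ← ofReal_integral_eq_lintegral_ofReal,
      ← intervalIntegral.integral_of_le hpq]
    · apply le_of_eq
      congr 1
      rw [intervalIntegral.integral_sub (by simp) (by
        apply Continuous.intervalIntegrable; fun_prop), intervalIntegral.integral_const_mul]
      simp [hp.le]
      field_simp
      ring
    · apply Continuous.integrableOn_Ioc; fun_prop
    · filter_upwards [ae_restrict_mem measurableSet_Ioc] with r hr
      have h := hr.2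
      rw [le_div_iff₀ hq] at h
      simp; linarith

lemma integral_sq_max_neg_clm_unitVec_le (L : ℂ →L[ℝ] ℝ) :
    ∫ θ in (-Real.pi)..Real.pi, max (-L (unitVec θ)) 0 ^ 2 ≤ Real.pi * ‖L‖ ^ 2 / 2 := by
  have hc1 : Continuous fun θ => max (-L (unitVec θ)) 0 ^ 2 := by fun_prop
  have hc2 : Continuous fun θ => max (L (unitVec θ)) 0 ^ 2 := by fun_prop
  have hshift : ∫ θ in (-Real.pi)..0, max (-L (unitVec θ)) 0 ^ 2 =
      ∫ θ in (0 : ℝ)..Real.pi, max (L (unitVec θ)) 0 ^ 2 := by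
    have := intervalIntegral.integral_comp_sub_right (a := 0) (b := Real.pi)
      (fun θ => max (-L (unitVec θ)) 0 ^ 2) Real.pi
    simp only [zero_sub, sub_self] at this
    rw [← this]
    congr 1
    ext θ
    simp only [clm_unitVec, Real.cos_sub_pi, Real.sin_sub_pi]
    ring_nf
  rw [← intervalIntegral.integral_add_adjacent_intervals (b := 0)
    (hc1.intervalIntegrable _ _) (hc1.intervalIntegrable _ _), hshift,
    ← intervalIntegral.integral_add (hc2.intervalIntegrable _ _) (hc1.intervalIntegrable _ _)]
  have hpt : ∀ θ : ℝ, max (L (unitVec θ)) 0 ^ 2 + max (-L (unitVec θ)) 0 ^ 2 =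
      L 1 ^ 2 * Real.cos θ ^ 2 + (2 * L 1 * L Complex.I) * (Real.sin θ * Real.cos θ) +
        L Complex.I ^ 2 * Real.sin θ ^ 2 := by
    intro θ
    have : max (L (unitVec θ)) 0 ^ 2 + max (-L (unitVec θ)) 0 ^ 2 = L (unitVec θ) ^ 2 := by
      rcases le_total (L (unitVec θ)) 0 with h | h
      · rw [max_eq_right h, max_eq_left (by linarith)]; ring
      · rw [max_eq_left h, max_eq_right (by linarith)]; ring
    rw [this, clm_unitVec]; ring
  simp_rw [hpt]
  rw [intervalIntegral.integral_add (by apply Continuous.intervalIntegrable; fun_prop)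
    (by apply Continuous.intervalIntegrable; fun_prop),
    intervalIntegral.integral_add (by apply Continuous.intervalIntegrable; fun_prop)
    (by apply Continuous.intervalIntegrable; fun_prop), intervalIntegral.integral_const_mul,
    intervalIntegral.integral_const_mul, intervalIntegral.integral_const_mul,
    integral_cos_sq, integral_sin_sq, integral_sin_mul_cos₁]
  simp
  have := sq_add_sq_le_norm_sq L
  nlinarith [Real.pi_pos]

lemma lintegral_polar_clm_le (L : ℂ →L[ℝ] ℝ) {c : ℝ} (hc : 0 < c) :
    ∫⁻ p in polarCoord.target, ENNReal.ofReal (-L (unitVec p.2) - c * ‖L‖ * p.1) ≤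
      ENNReal.ofReal (Real.pi / (4 * c)) * ENNReal.ofReal ‖L‖ := by
  rcases eq_or_ne L 0 with rfl | hL
  · simp
  have hq : 0 < c * ‖L‖ := by positivity
  have htarget : polarCoord.target = Set.Ioi (0 : ℝ) ×ˢ Set.Ioo (-Real.pi) Real.pi := rfl
  rw [htarget, Measure.volume_eq_prod, ← Measure.prod_restrict, lintegral_prod_symm]
  · calc _ ≤ ∫⁻ θ in Set.Ioo (-Real.pi) Real.pi,
          ENNReal.ofReal (max (-L (unitVec θ)) 0 ^ 2 / (2 * (c * ‖L‖))) :=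
        lintegral_mono fun θ => lintegral_Ioi_ofReal_sub_mul_le _ hq
      _ = ENNReal.ofReal (∫ θ in (-Real.pi)..Real.pi,
          max (-L (unitVec θ)) 0 ^ 2 / (2 * (c * ‖L‖))) := by
        rw [intervalIntegral.integral_of_le (by linarith [Real.pi_pos]),
          ← setLIntegral_congr Ioo_ae_eq_Ioc.symm, ofReal_integral_eq_lintegral_ofReal]
        · apply Continuous.integrableOn_Ioc; fun_prop
        · exact Eventually.of_forall fun θ => by positivity
      _ ≤ _ := by
        rw [← ENNReal.ofReal_mul (by positivity)]
        apply ENNReal.ofReal_le_ofReal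
        rw [intervalIntegral.integral_div]
        have := integral_sq_max_neg_clm_unitVec_le L
        have hLn : 0 < ‖L‖ := by positivity
        rw [div_le_iff₀ (by positivity)]
        refine this.trans (le_of_eq ?_)
        field_simp
        norm_num
  · apply Measurable.aemeasurable
    apply Measurable.ennreal_ofReal
    apply Continuous.measurable
    fun_prop

lemma lintegral_polar_add (f : ℂ → ENNReal) (x : ℂ) :
    ∫⁻ p in polarCoord.target, ENNReal.ofReal p.1 * f (x + p.1 • unitVec p.2) = ∫⁻ y, f y := by
  have h := Complex.lintegral_comp_polarCoord_symm fun z => f (x + z)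
  simp only [Complex.polarCoord_symm_apply, smul_eq_mul] at h
  rw [lintegral_add_left_eq_self f x] at h
  rw [← h]
  simp only [unitVec, Complex.real_smul]

variable {v : ℂ → ℝ}

lemma integral_ray (hv : ContDiff ℝ 1 v) (hs : HasCompactSupport v) (x : ℂ) (θ : ℝ) :
    Integrable (fun r : ℝ => -fderiv ℝ v (x + r • unitVec θ) (unitVec θ)) ∧
    ∫ r in Set.Ioi (0 : ℝ), -fderiv ℝ v (x + r • unitVec θ) (unitVec θ) = v x := by
  have hd : ∀ r : ℝ, HasDerivAt (fun r : ℝ => v (x + r • unitVec θ))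
      (fderiv ℝ v (x + r • unitVec θ) (unitVec θ)) r := by
    intro r
    have h1 : HasDerivAt (fun r : ℝ => x + r • unitVec θ) (unitVec θ) r := by
      simpa using ((hasDerivAt_id r).smul_const (unitVec θ)).const_add x
    exact ((hv.differentiable one_ne_zero _).hasFDerivAt).comp_hasDerivAt r h1
  have hemb : Topology.IsClosedEmbedding fun r : ℝ => x + r • unitVec θ :=
    (Homeomorph.addLeft x).isClosedEmbedding.comp
      (isClosedEmbedding_smul_left (unitVec_ne_zero θ))
  have hw : ContDiff ℝ 1 fun r : ℝ => v (x + r • unitVec θ) := by fun_prop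
  have hws : HasCompactSupport fun r : ℝ => v (x + r • unitVec θ) :=
    hs.comp_isClosedEmbedding hemb
  have hderiv : deriv (fun r : ℝ => v (x + r • unitVec θ)) =
      fun r => fderiv ℝ v (x + r • unitVec θ) (unitVec θ) := funext fun r => (hd r).deriv
  have hInt : Integrable (deriv fun r : ℝ => v (x + r • unitVec θ)) := (hw.continuous_deriv le_rfl).integrable_of_hasCompactSupport hws.deriv
  have h := hws.integral_Ioi_deriv_eq hw 0
  rw [hderiv] at hInt h
  refine ⟨hInt.neg, ?_⟩
  rw [integral_neg, h]
  simp

lemma ofReal_integral_le_lintegral_ofReal {α : Type*} [MeasurableSpace α] {μ : Measure α}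
    {f : α → ℝ} (hf : Integrable f μ) :
    ENNReal.ofReal (∫ a, f a ∂μ) ≤ ∫⁻ a, ENNReal.ofReal (f a) ∂μ := by
  rw [integral_eq_lintegral_pos_part_sub_lintegral_neg_part hf]
  exact (ENNReal.ofReal_le_ofReal (sub_le_self _ ENNReal.toReal_nonneg)).trans
    ENNReal.ofReal_toReal_le

lemma ofReal_le_lintegral_polar (hv : ContDiff ℝ 1 v) (hs : HasCompactSupport v) (x : ℂ) :
    ENNReal.ofReal (2 * Real.pi) * ENNReal.ofReal (v x) ≤ ∫⁻ p in polarCoord.target,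
      ENNReal.ofReal (-fderiv ℝ v (x + p.1 • unitVec p.2) (unitVec p.2)) := by
  have htarget : polarCoord.target = Set.Ioi (0 : ℝ) ×ˢ Set.Ioo (-Real.pi) Real.pi := rfl
  have hcf := hv.continuous_fderiv one_ne_zero
  rw [htarget, Measure.volume_eq_prod, ← Measure.prod_restrict, lintegral_prod_symm]
  · calc _ = ∫⁻ θ in Set.Ioo (-Real.pi) Real.pi, ENNReal.ofReal (v x) := by
          rw [setLIntegral_const, Real.volume_Ioo, mul_comm]; ring_nf
      _ ≤ _ := by
        refine lintegral_mono fun θ => ?_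
        obtain ⟨h1, h2⟩ := integral_ray hv hs x θ
        rw [← h2]
        exact ofReal_integral_le_lintegral_ofReal h1.integrableOn
  · apply Measurable.aemeasurable
    apply Measurable.ennreal_ofReal
    apply Continuous.measurable
    fun_prop

lemma lintegral_le_of_pos (hv : ContDiff ℝ 1 v) (hs : HasCompactSupport v) (A : Set ℂ)
    {c : ℝ} (hc : 0 < c) :
    ENNReal.ofReal (2 * Real.pi) * ∫⁻ x in A, ENNReal.ofReal (v x) ≤
      (ENNReal.ofReal c * volume A + ENNReal.ofReal (Real.pi / (4 * c))) *
        ∫⁻ y, ENNReal.ofReal ‖fderiv ℝ v y‖ := by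
  have hcf := hv.continuous_fderiv one_ne_zero
  set I := ∫⁻ y, ENNReal.ofReal ‖fderiv ℝ v y‖
  have hpt : ∀ x : ℂ, ENNReal.ofReal (2 * Real.pi) * ENNReal.ofReal (v x) ≤
      ENNReal.ofReal c * I + ∫⁻ p in polarCoord.target, ENNReal.ofReal
        (-fderiv ℝ v (x + p.1 • unitVec p.2) (unitVec p.2) -
          c * ‖fderiv ℝ v (x + p.1 • unitVec p.2)‖ * p.1) := by
    intro x
    refine (ofReal_le_lintegral_polar hv hs x).trans ?_
    have hI : I = _ := (lintegral_polar_add (fun y => ENNReal.ofReal ‖fderiv ℝ v y‖) x).symm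
    rw [hI, ← lintegral_const_mul, ← lintegral_add_left]
    · refine setLIntegral_mono' (measurableSet_Ioi.prod measurableSet_Ioo) fun p hp => ?_
      have hp1 : 0 < p.1 := hp.1
      rw [← ENNReal.ofReal_mul hp1.le, ← ENNReal.ofReal_mul hc.le]
      refine le_trans (ENNReal.ofReal_le_ofReal ?_) ENNReal.ofReal_add_le
      apply le_of_eq
      ring
    · fun_prop
    · fun_prop
  rw [← lintegral_const_mul _ (by have := hv.continuous.measurable; fun_prop)]
  refine (lintegral_mono hpt).trans ?_
  rw [lintegral_add_left (by fun_prop), setLIntegral_const, add_mul]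
  apply add_le_add
  · apply le_of_eq; ring
  refine (setLIntegral_le_lintegral _ _).trans ?_
  rw [lintegral_lintegral_swap]
  · have htr : ∀ p : ℝ × ℝ, ∫⁻ x : ℂ, ENNReal.ofReal
        (-fderiv ℝ v (x + p.1 • unitVec p.2) (unitVec p.2) -
          c * ‖fderiv ℝ v (x + p.1 • unitVec p.2)‖ * p.1) =
        ∫⁻ y : ℂ, ENNReal.ofReal
        (-fderiv ℝ v y (unitVec p.2) - c * ‖fderiv ℝ v y‖ * p.1) := fun p =>
      lintegral_add_right_eq_self (fun y => ENNReal.ofReal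
        (-fderiv ℝ v y (unitVec p.2) - c * ‖fderiv ℝ v y‖ * p.1)) _
    simp_rw [htr]
    rw [lintegral_lintegral_swap]
    · rw [← lintegral_const_mul _ (by fun_prop)]
      exact lintegral_mono fun y => lintegral_polar_clm_le _ hc
    · apply Measurable.aemeasurable
      apply Measurable.ennreal_ofReal
      apply Continuous.measurable
      fun_prop
  · apply Measurable.aemeasurable
    apply Measurable.ennreal_ofReal
    apply Continuous.measurable
    fun_prop

lemma sq_setIntegral_le {α : Type*} [MeasurableSpace α] {μ : Measure α} {B : Set α}
    (hB : μ B ≠ ⊤) {f : α → ℝ} (hf : IntegrableOn f B μ)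
    (hf2 : IntegrableOn (fun x => f x ^ 2) B μ) :
    (∫ x in B, f x ∂μ) ^ 2 ≤ (∫ x in B, f x ^ 2 ∂μ) * μ.real B := by
  have hq : ∀ l : ℝ, 0 ≤ μ.real B * (l * l) + (-2 * ∫ x in B, f x ∂μ) * l +
      ∫ x in B, f x ^ 2 ∂μ := by
    intro l
    have h0 : 0 ≤ ∫ x in B, (f x - l) ^ 2 ∂μ := integral_nonneg fun x => sq_nonneg _
    have hl : IntegrableOn (fun _ => l * l) B μ := integrableOn_const hB
    have h1 : ∫ x in B, (f x - l) ^ 2 ∂μ =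
        ∫ x in B, ((f x ^ 2 + (-2 * l) * f x) + l * l) ∂μ := by
      congr 1; ext x; ring
    rw [h1, integral_add (by exact hf2.add (hf.const_mul _)) hl, integral_add hf2 (hf.const_mul _),
      integral_const_mul, setIntegral_const] at h0
    simp only [smul_eq_mul] at h0
    linarith
  have := discrim_le_zero hq
  unfold discrim at this
  nlinarith

lemma exists_contDiff_transition {s t η : ℝ} (hη : 0 < η) (hst : s + 2 * η < t) :
    ∃ φ p : ℝ → ℝ, ContDiff ℝ 1 φ ∧ (∀ τ, HasDerivAt φ (p τ) τ) ∧ (∀ τ, 0 ≤ p τ) ∧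
      (∀ τ, p τ ≤ 1) ∧ (∀ τ, p τ ≠ 0 → s < τ ∧ τ < t) ∧ (∀ τ ≤ s, φ τ = 0) ∧
      (∀ τ, 0 ≤ φ τ) ∧ ∀ τ, t ≤ τ → t - s - 2 * η ≤ φ τ := by
  set p : ℝ → ℝ := fun τ => max 0 (min 1 (min (τ - s) (t - τ) / η)) with hp
  have hpc : Continuous p := by fun_prop
  have hp0 : ∀ τ, 0 ≤ p τ := fun τ => le_max_left _ _
  have hp1 : ∀ τ, p τ ≤ 1 := fun τ => max_le zero_le_one (min_le_left _ _)
  have hsupp : ∀ τ, p τ ≠ 0 → s < τ ∧ τ < t := by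
    intro τ h
    by_contra hc
    apply h
    have : min (τ - s) (t - τ) ≤ 0 := by
      by_contra! h'
      rw [lt_min_iff] at h'
      exact hc ⟨by linarith, by linarith⟩
    simp only [hp]
    exact max_eq_left ((min_le_right _ _).trans (div_nonpos_of_nonpos_of_nonneg this hη.le))
  have hone : ∀ τ, s + η ≤ τ → τ ≤ t - η → p τ = 1 := by
    intro τ h1 h2
    have : 1 ≤ min (τ - s) (t - τ) / η := by
      rw [le_div_iff₀ hη, one_mul, le_min_iff]; constructor <;> linarith
    simp [hp, min_eq_left this]
  have hd : ∀ τ, HasDerivAt (fun τ => ∫ x in s..τ, p x) (p τ) τ := fun τ =>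
    intervalIntegral.integral_hasDerivAt_right (hpc.intervalIntegrable _ _)
      (hpc.stronglyMeasurableAtFilter _ _) hpc.continuousAt
  have hz : ∀ τ ≤ s, ∫ x in s..τ, p x = 0 := by
    intro τ hτ
    rw [intervalIntegral.integral_symm, neg_eq_zero]
    apply intervalIntegral.integral_zero_ae
    refine Eventually.of_forall fun x hx => ?_
    rw [Set.uIoc_of_le hτ] at hx
    by_contra h
    exact absurd (hsupp x h).1 (not_lt.2 hx.2)
  refine ⟨fun τ => ∫ x in s..τ, p x, p, ?_, hd, hp0, hp1, hsupp, hz, ?_, ?_⟩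
  · rw [contDiff_one_iff_deriv]
    refine ⟨fun τ => (hd τ).differentiableAt, ?_⟩
    rwa [show deriv (fun τ => ∫ x in s..τ, p x) = p from funext fun τ => (hd τ).deriv]
  · intro τ
    rcases le_total τ s with h | h
    · exact (hz τ h).ge
    · exact intervalIntegral.integral_nonneg h fun x _ => hp0 x
  · intro τ hτ
    have h1 : ∫ x in (s + η)..(t - η), p x = t - s - 2 * η := by
      rw [intervalIntegral.integral_congr (g := fun _ => (1 : ℝ))]
      · simp; ring
      · intro x hx
        rw [Set.uIcc_of_le (by linarith)] at hx
        exact hone x hx.1 hx.2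
    rw [← h1]
    exact intervalIntegral.integral_mono_interval (by linarith) (by linarith) (by linarith)
      (Eventually.of_forall hp0) (hpc.intervalIntegrable _ _)

variable {u : ℂ → ℝ}

lemma measure_superlevel_ne_top (hs : HasCompactSupport u) {s : ℝ} (h0 : 0 ≤ s) :
    volume {x | s < u x} ≠ ⊤ := by
  refine ((measure_mono ?_).trans_lt hs.isCompact.measure_lt_top).ne
  intro x hx
  apply subset_tsupport
  have hx : s < u x := hx
  exact (h0.trans_lt hx).ne'

lemma integrable_norm_fderiv (hu : ContDiff ℝ 1 u) (hs : HasCompactSupport u) :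
    Integrable fun x => ‖fderiv ℝ u x‖ :=
  (hu.continuous_fderiv one_ne_zero).norm.integrable_of_hasCompactSupport
    (hs.fderiv (𝕜 := ℝ)).norm

lemma integrable_sq_norm_fderiv (hu : ContDiff ℝ 1 u) (hs : HasCompactSupport u) :
    Integrable fun x => ‖fderiv ℝ u x‖ ^ 2 := by
  have hc : Continuous fun x => ‖fderiv ℝ u x‖ := (hu.continuous_fderiv one_ne_zero).norm
  have h : HasCompactSupport fun x => ‖fderiv ℝ u x‖ := (hs.fderiv (𝕜 := ℝ)).norm
  have h2 : HasCompactSupport fun x => ‖fderiv ℝ u x‖ * ‖fderiv ℝ u x‖ := h.mul_left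
  simp only [sq]
  exact (hc.mul hc).integrable_of_hasCompactSupport h2

/-- Dirichlet energy of `u` between the levels `s` and `t`. -/
noncomputable def energyBetween (u : ℂ → ℝ) (s t : ℝ) : ℝ :=
  ∫ x in {x | s < u x ∧ u x < t}, ‖fderiv ℝ u x‖ ^ 2

lemma level_inequality_of_pos (hu : ContDiff ℝ 1 u) (hs : HasCompactSupport u) {s t η c : ℝ}
    (h0 : 0 ≤ s) (hη : 0 < η) (hst : s + 2 * η < t) (hc : 0 < c) :
    2 * Real.pi * ((t - s - 2 * η) * volume.real {x | t ≤ u x}) ≤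
      (c * volume.real {x | s < u x} + Real.pi / (4 * c)) *
        ∫ x in {x | s < u x ∧ u x < t}, ‖fderiv ℝ u x‖ := by
  obtain ⟨φ, p, hφ, hd, hp0, hp1, hsupp, hz, hφ0, hφt⟩ := exists_contDiff_transition hη hst
  set A := {x | s < u x}
  set B := {x | s < u x ∧ u x < t} with hB
  have hBm : MeasurableSet B :=
    (measurableSet_lt measurable_const hu.continuous.measurable).inter
      (measurableSet_lt hu.continuous.measurable measurable_const)
  have hA := measure_superlevel_ne_top hs h0
  have hvs : HasCompactSupport fun x => φ (u x) := hs.comp_left (g := φ) (hz 0 h0)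
  have hv : ContDiff ℝ 1 fun x => φ (u x) := hφ.comp hu
  have hfd : ∀ x, ‖fderiv ℝ (fun x => φ (u x)) x‖ = p (u x) * ‖fderiv ℝ u x‖ := by
    intro x
    have := ((hd (u x)).comp_hasFDerivAt x
      (hu.differentiable one_ne_zero x).hasFDerivAt).fderiv
    rw [show (fun x => φ (u x)) = φ ∘ u from rfl, this, norm_smul,
      Real.norm_of_nonneg (hp0 _)]
  have hInt := integrable_norm_fderiv hu hs
  have hJ : ∫⁻ y, ENNReal.ofReal ‖fderiv ℝ (fun x => φ (u x)) y‖ ≤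
      ENNReal.ofReal (∫ x in B, ‖fderiv ℝ u x‖) := by
    rw [ofReal_integral_eq_lintegral_ofReal hInt.integrableOn
      (Eventually.of_forall fun x => norm_nonneg _), ← lintegral_indicator hBm]
    refine lintegral_mono fun x => ?_
    rw [hfd]
    by_cases hx : p (u x) = 0
    · simp [hx]
    · rw [Set.indicator_of_mem (show x ∈ B from hsupp _ hx)]
      exact ENNReal.ofReal_le_ofReal (mul_le_of_le_one_left (norm_nonneg _) (hp1 _))
  have hlow : ENNReal.ofReal (t - s - 2 * η) * volume {x | t ≤ u x} ≤
      ∫⁻ x in A, ENNReal.ofReal (φ (u x)) := by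
    rw [← setLIntegral_const]
    have hsub : {x | t ≤ u x} ⊆ A := fun x (hx : t ≤ u x) =>
      show s < u x by linarith
    refine le_trans ?_ (lintegral_mono_set hsub)
    exact setLIntegral_mono' (measurableSet_le measurable_const hu.continuous.measurable)
      fun x hx => ENNReal.ofReal_le_ofReal (hφt _ hx)
  have hmain := lintegral_le_of_pos hv hvs A hc
  have hfin : volume {x | t ≤ u x} ≠ ⊤ :=
    ne_top_of_le_ne_top hA (measure_mono fun x (hx : t ≤ u x) => show s < u x by linarith)
  have key := (mul_le_mul_right hlow (ENNReal.ofReal (2 * Real.pi))).trans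
    (hmain.trans (mul_le_mul_right hJ _))
  rw [← ENNReal.ofReal_toReal hfin, ← ENNReal.ofReal_toReal hA] at key
  have hJ0 : 0 ≤ ∫ x in B, ‖fderiv ℝ u x‖ := integral_nonneg fun x => norm_nonneg _
  rw [← ENNReal.ofReal_mul hc.le, ← ENNReal.ofReal_mul (by linarith),
    ← ENNReal.ofReal_mul (by positivity), ← ENNReal.ofReal_add (by positivity) (by positivity),
    ← ENNReal.ofReal_mul (by positivity), ENNReal.ofReal_le_ofReal_iff (by positivity)] at key
  exact key

lemma level_inequality (hu : ContDiff ℝ 1 u) (hs : HasCompactSupport u) {s t : ℝ}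
    (h0 : 0 ≤ s) (hst : s < t) :
    4 * Real.pi * (t - s) ^ 2 * volume.real {x | t ≤ u x} ^ 2 ≤
      volume.real {x | s < u x} * energyBetween u s t *
        (volume.real {x | s < u x} - volume.real {x | t ≤ u x}) := by
  unfold energyBetween
  set A := {x | s < u x}
  set N := {x | t ≤ u x}
  set B := {x | s < u x ∧ u x < t}
  have hA : volume A ≠ ⊤ := measure_superlevel_ne_top hs h0
  have hNA : N ⊆ A := fun x (hx : t ≤ u x) => show s < u x by linarith
  have hNm : MeasurableSet N := measurableSet_le measurable_const hu.continuous.measurable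
  have hBeq : B = A \ N := by
    ext x; simp [A, B, N]
  have hBvol : volume.real B = volume.real A - volume.real N := by
    rw [hBeq, measureReal_sdiff hNA hNm hA]
  have hBfin : volume B ≠ ⊤ :=
    ne_top_of_le_ne_top hA (measure_mono (hBeq ▸ Set.sdiff_subset))
  have hInt := integrable_norm_fderiv hu hs
  have hInt2 := integrable_sq_norm_fderiv hu hs
  have hCS := sq_setIntegral_le hBfin hInt.integrableOn hInt2.integrableOn
  rw [hBvol] at hCS
  set J := ∫ x in B, ‖fderiv ℝ u x‖ with hJ
  have hJ0 : 0 ≤ J := integral_nonneg fun x => norm_nonneg _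
  set m := volume.real A
  set n := volume.real N
  have hn : 0 ≤ n := measureReal_nonneg
  have hnm : n ≤ m := measureReal_mono hNA hA
  have hm : 0 ≤ m := hn.trans hnm
  rcases hm.eq_or_lt with hm0 | hm0
  · have : n = 0 := by linarith
    rw [this, ← hm0]; simp
  have hπ := Real.pi_pos
  have hlim : ∀ c : ℝ, 0 < c →
      2 * Real.pi * ((t - s) * n) ≤ (c * m + Real.pi / (4 * c)) * J := by
    intro c hc
    have h1 : Tendsto (fun η : ℝ => 2 * Real.pi * ((t - s - 2 * η) * n))
        (nhdsWithin 0 (Set.Ioi 0)) (nhds (2 * Real.pi * ((t - s - 2 * 0) * n))) := by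
      apply Tendsto.mono_left _ nhdsWithin_le_nhds
      apply Continuous.tendsto
      fun_prop
    rw [mul_zero, sub_zero] at h1
    refine le_of_tendsto h1 ?_
    filter_upwards [Ioo_mem_nhdsGT (show (0 : ℝ) < (t - s) / 2 by linarith)] with η hη
    exact level_inequality_of_pos hu hs h0 hη.1 (by linarith [hη.2]) hc
  set x := Real.sqrt Real.pi with hx
  set y := Real.sqrt m with hy
  have hx0 : 0 < x := Real.sqrt_pos.2 hπ
  have hy0 : 0 < y := Real.sqrt_pos.2 hm0
  have hx2 : x ^ 2 = Real.pi := Real.sq_sqrt hπ.le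
  have hy2 : y ^ 2 = m := Real.sq_sqrt hm
  have h2 := hlim (x / (2 * y)) (by positivity)
  have h3 : x / (2 * y) * m + Real.pi / (4 * (x / (2 * y))) = x * y := by
    rw [← hx2, ← hy2]; field_simp; norm_num
  rw [h3] at h2
  have h4 : (2 * Real.pi * ((t - s) * n)) ^ 2 ≤ (x * y * J) ^ 2 :=
    pow_le_pow_left₀ (by have : 0 < t - s := by linarith
                         positivity) h2 2
  have h5 : (x * y * J) ^ 2 = Real.pi * (m * J ^ 2) := by rw [← hx2, ← hy2]; ring
  rw [h5] at h4
  have h6 : Real.pi * (4 * Real.pi * (t - s) ^ 2 * n ^ 2) ≤ Real.pi * (m * J ^ 2) := by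
    linarith
  have h7 := le_of_mul_le_mul_left h6 hπ
  refine h7.trans ?_
  rw [mul_assoc]
  gcongr

lemma energyBetween_nonneg (u : ℂ → ℝ) (s t : ℝ) : 0 ≤ energyBetween u s t :=
  integral_nonneg fun _ => sq_nonneg _

lemma energyBetween_self (u : ℂ → ℝ) (s : ℝ) : energyBetween u s s = 0 := by
  have : {x | s < u x ∧ u x < s} = ∅ := by
    ext x; simp only [Set.mem_ofPred_eq, Set.mem_empty_iff_false, iff_false]
    intro h; exact lt_asymm h.1 h.2
  simp [energyBetween, this]

lemma energyBetween_add_le (hu : ContDiff ℝ 1 u) (hs : HasCompactSupport u) {a c b : ℝ}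
    (hac : a ≤ c) (hcb : c ≤ b) :
    energyBetween u a c + energyBetween u c b ≤ energyBetween u a b := by
  unfold energyBetween
  have hInt := integrable_sq_norm_fderiv hu hs
  have hm : MeasurableSet {x | c < u x ∧ u x < b} :=
    (measurableSet_lt measurable_const hu.continuous.measurable).inter
      (measurableSet_lt hu.continuous.measurable measurable_const)
  rw [← setIntegral_union _ hm hInt.integrableOn hInt.integrableOn]
  · refine setIntegral_mono_set hInt.integrableOn
      (Eventually.of_forall fun x => sq_nonneg _) (LE.le.eventuallyLE ?_)
    rintro x (⟨h1, h2⟩ | ⟨h1, h2⟩)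
    · exact ⟨h1, h2.trans_le hcb⟩
    · exact ⟨hac.trans_lt h1, h2⟩
  · rw [Set.disjoint_left]
    rintro x ⟨_, h2⟩ ⟨h1, _⟩
    exact lt_asymm h1 h2

lemma measureReal_lt_le_measureReal_le (hs : HasCompactSupport u) {s : ℝ} (h0 : 0 < s) :
    volume.real {x | s < u x} ≤ volume.real {x | s ≤ u x} :=
  measureReal_mono (fun x (hx : s < u x) => hx.le)
    (ne_top_of_le_ne_top (measure_superlevel_ne_top hs le_rfl)
      (measure_mono fun x (hx : s ≤ u x) => h0.trans_le hx))

lemma measureReal_le_le_measureReal_lt (hs : HasCompactSupport u) {s t : ℝ} (h0 : 0 ≤ s)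
    (hst : s < t) : volume.real {x | t ≤ u x} ≤ volume.real {x | s < u x} :=
  measureReal_mono (fun x (hx : t ≤ u x) => hst.trans_le hx) (measure_superlevel_ne_top hs h0)

lemma measureReal_superlevel_antitone (hs : HasCompactSupport u) {s t : ℝ} (h0 : 0 < s)
    (hst : s ≤ t) : volume.real {x | t ≤ u x} ≤ volume.real {x | s ≤ u x} :=
  measureReal_mono (fun x (hx : t ≤ u x) => hst.trans hx)
    (ne_top_of_le_ne_top (measure_superlevel_ne_top hs le_rfl)
      (measure_mono fun x (hx : s ≤ u x) => h0.trans_le hx))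

lemma exists_level_right (hs : HasCompactSupport u) {c b δ : ℝ} (h0 : 0 ≤ c) (hcb : c < b)
    (hpos : 0 < volume.real {x | c < u x}) (hδ : 0 < δ) :
    ∃ y, c < y ∧ y ≤ b ∧
      volume.real {x | c < u x} ≤ (1 + δ) * volume.real {x | y ≤ u x} := by
  have hfin := measure_superlevel_ne_top hs h0
  have hU : {x | c < u x} = ⋃ n : ℕ, {x | c + 1 / ((n : ℝ) + 1) ≤ u x} := by
    ext x
    simp only [Set.mem_ofPred_eq, Set.mem_iUnion]
    constructor
    · intro h
      obtain ⟨n, hn⟩ := exists_nat_one_div_lt (sub_pos.2 h)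
      exact ⟨n, by linarith⟩
    · rintro ⟨n, hn⟩
      have : (0 : ℝ) < 1 / ((n : ℝ) + 1) := by positivity
      linarith
  have hmono : Monotone fun n : ℕ => {x | c + 1 / ((n : ℝ) + 1) ≤ u x} := by
    intro n m hnm x hx
    have hx : c + 1 / ((n : ℝ) + 1) ≤ u x := hx
    have := Nat.one_div_le_one_div (α := ℝ) hnm
    show c + 1 / ((m : ℝ) + 1) ≤ u x
    linarith
  have ht := tendsto_measure_iUnion_atTop (μ := volume) hmono
  rw [← hU] at ht
  have ht' := (ENNReal.tendsto_toReal hfin).comp ht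
  have hlt : volume.real {x | c < u x} / (1 + δ) < volume.real {x | c < u x} :=
    div_lt_self hpos (by linarith)
  have h1 := (ht'.eventually (lt_mem_nhds hlt))
  have h2 : ∀ᶠ n : ℕ in atTop, 1 / ((n : ℝ) + 1) < b - c :=
    tendsto_one_div_add_atTop_nhds_zero_nat.eventually (gt_mem_nhds (sub_pos.2 hcb))
  obtain ⟨n, hn1, hn2⟩ := (h1.and h2).exists
  refine ⟨c + 1 / ((n : ℝ) + 1), ?_, by linarith, ?_⟩
  · have : (0 : ℝ) < 1 / ((n : ℝ) + 1) := by positivity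
    linarith
  · rw [div_lt_iff₀ (by linarith)] at hn1
    rw [mul_comm]
    exact hn1.le

lemma log_inequality_of_close (hu : ContDiff ℝ 1 u) (hs : HasCompactSupport u) {s t δ : ℝ}
    (h0 : 0 ≤ s) (hst : s < t) (hpos : 0 < volume.real {x | t ≤ u x})
    (hclose : volume.real {x | s < u x} ≤ (1 + δ) * volume.real {x | t ≤ u x}) :
    4 * Real.pi * (t - s) ^ 2 ≤ (1 + δ) ^ 2 * (energyBetween u s t *
      Real.log (volume.real {x | s < u x} / volume.real {x | t ≤ u x})) := by
  have hlev := level_inequality hu hs h0 hst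
  have hnm := measureReal_le_le_measureReal_lt hs h0 hst
  have hE := energyBetween_nonneg u s t
  set m := volume.real {x | s < u x}
  set n := volume.real {x | t ≤ u x}
  set E := energyBetween u s t
  have hm : 0 < m := hpos.trans_le hnm
  have hl := Real.one_sub_inv_le_log_of_pos (div_pos hm hpos)
  set l := Real.log (m / n)
  have hl' : m - n ≤ m * l := by
    rw [inv_div] at hl
    calc m - n = m * (1 - n / m) := by field_simp
      _ ≤ m * l := by gcongr
  have hl0 : 0 ≤ l := Real.log_nonneg ((one_le_div hpos).2 hnm)
  have h1 : 4 * Real.pi * (t - s) ^ 2 * n ^ 2 ≤ ((1 + δ) ^ 2 * (E * l)) * n ^ 2 := by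
    calc 4 * Real.pi * (t - s) ^ 2 * n ^ 2 ≤ m * E * (m - n) := hlev
      _ ≤ m * E * (m * l) := by gcongr
      _ = m ^ 2 * (E * l) := by ring
      _ ≤ ((1 + δ) * n) ^ 2 * (E * l) := by gcongr
      _ = _ := by ring
  exact le_of_mul_le_mul_right h1 (by positivity)

lemma sq_add_le_of_sq_le {k C x₁ x₂ e₁ e₂ e l₁ l₂ l : ℝ} (hk : 0 ≤ k) (hC : 0 ≤ C)
    (hx₁ : 0 ≤ x₁) (hx₂ : 0 ≤ x₂) (he₁ : 0 ≤ e₁) (he₂ : 0 ≤ e₂) (hl₁ : 0 ≤ l₁) (hl₂ : 0 ≤ l₂)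
    (he : e₁ + e₂ ≤ e) (hl : l₁ + l₂ ≤ l) (h₁ : k * x₁ ^ 2 ≤ C * (e₁ * l₁))
    (h₂ : k * x₂ ^ 2 ≤ C * (e₂ * l₂)) : k * (x₁ + x₂) ^ 2 ≤ C * (e * l) := by
  have hprod : (2 * (k * (x₁ * x₂))) ^ 2 ≤ (C * (e₁ * l₂ + e₂ * l₁)) ^ 2 := by
    have h := mul_le_mul h₁ h₂ (by positivity) (by positivity)
    nlinarith [mul_nonneg (sq_nonneg C) (sq_nonneg (e₁ * l₂ - e₂ * l₁))]
  have hcross : 2 * (k * (x₁ * x₂)) ≤ C * (e₁ * l₂ + e₂ * l₁) :=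
    (pow_le_pow_iff_left₀ (by positivity) (by positivity) two_ne_zero).1 hprod
  calc k * (x₁ + x₂) ^ 2 ≤ C * ((e₁ + e₂) * (l₁ + l₂)) := by linarith
    _ ≤ C * (e * l) := by gcongr; linarith

lemma log_inequality_of_pos (hu : ContDiff ℝ 1 u) (hs : HasCompactSupport u) {a b δ : ℝ}
    (h0 : 0 ≤ a) (hab : a < b) (hδ : 0 < δ) (hpos : 0 < volume.real {x | b ≤ u x}) :
    4 * Real.pi * (b - a) ^ 2 ≤ (1 + δ) ^ 2 * (energyBetween u a b *
      Real.log (volume.real {x | a < u x} / volume.real {x | b ≤ u x})) := by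
  set Q : ℝ → Prop := fun x => 4 * Real.pi * (x - a) ^ 2 ≤ (1 + δ) ^ 2 * (energyBetween u a x *
      Real.log (volume.real {y | a < u y} / volume.real {y | x ≤ u y})) with hQ
  set S := {x | x ∈ Set.Icc a b ∧ Q x} with hS
  have hposx : ∀ x, 0 < x → x ≤ b → 0 < volume.real {y | x ≤ u y} := fun x hx hxb =>
    hpos.trans_le (measureReal_superlevel_antitone hs hx hxb)
  have hlog : ∀ x, a < x → x ≤ b →
      0 ≤ Real.log (volume.real {y | a < u y} / volume.real {y | x ≤ u y}) := fun x hx hxb =>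
    Real.log_nonneg ((one_le_div (hposx x (h0.trans_lt hx) hxb)).2
      (measureReal_le_le_measureReal_lt hs h0 hx))
  have hQa : Q a := by simp [hQ, energyBetween_self]
  have haS : a ∈ S := ⟨⟨le_rfl, hab.le⟩, hQa⟩
  have hbdd : BddAbove S := ⟨b, fun x hx => hx.1.2⟩
  set c := sSup S with hc
  have hac : a ≤ c := le_csSup hbdd haS
  have hcb : c ≤ b := csSup_le ⟨a, haS⟩ fun x hx => hx.1.2
  have hposa : 0 < volume.real {y | a < u y} :=
    hpos.trans_le (measureReal_le_le_measureReal_lt hs h0 hab)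
  have hQc : Q c := by
    rcases hac.eq_or_lt with h | hac'
    · rwa [← h]
    have ht : Tendsto (fun y => 4 * Real.pi * (y - a) ^ 2) (nhdsWithin c (Set.Iio c))
        (nhds (4 * Real.pi * (c - a) ^ 2)) := by
      apply Tendsto.mono_left _ nhdsWithin_le_nhds
      apply Continuous.tendsto (f := fun y => 4 * Real.pi * (y - a) ^ 2)
      fun_prop
    refine le_of_tendsto ht ?_
    filter_upwards [Ioo_mem_nhdsLT hac'] with y hy
    obtain ⟨x, hxS, hyx⟩ := exists_lt_of_lt_csSup ⟨a, haS⟩ hy.2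
    have hxc : x ≤ c := le_csSup hbdd hxS
    have hax : a < x := hy.1.trans hyx
    have hx0 : 0 < x := h0.trans_lt hax
    have hE : energyBetween u a x ≤ energyBetween u a c :=
      (le_add_of_nonneg_right (energyBetween_nonneg u x c)).trans
        (energyBetween_add_le hu hs hax.le hxc)
    have hL : Real.log (volume.real {y | a < u y} / volume.real {y | x ≤ u y}) ≤
        Real.log (volume.real {y | a < u y} / volume.real {y | c ≤ u y}) := by
      have h1 := hposx x hx0 hxS.1.2
      have h2 := hposx c (h0.trans_lt hac') hcb
      have h3 := measureReal_superlevel_antitone hs hx0 hxc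
      gcongr
    have h1 := hlog x hax hxS.1.2
    have h2 : 0 ≤ y - a := by linarith [hy.1]
    have h3 := energyBetween_nonneg u a c
    calc 4 * Real.pi * (y - a) ^ 2 ≤ 4 * Real.pi * (x - a) ^ 2 := by gcongr
      _ ≤ _ := hxS.2
      _ ≤ _ := by gcongr
  rcases hcb.eq_or_lt with h | hcb'
  · rw [← h]; exact hQc
  exfalso
  have hposc : 0 < volume.real {x | c < u x} :=
    hpos.trans_le (measureReal_le_le_measureReal_lt hs (h0.trans hac) hcb')
  obtain ⟨y, hcy, hyb, hclose⟩ := exists_level_right hs (h0.trans hac) hcb' hposc hδ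
  have hy0 : 0 < y := (h0.trans hac).trans_lt hcy
  have hposy := hposx y hy0 hyb
  have hstep := log_inequality_of_close hu hs (h0.trans hac) hcy hposy hclose
  have hQy : Q y := by
    rcases hac.eq_or_lt with h | hac'
    · rw [← h] at hstep; exact hstep
    have hc0 : 0 < c := h0.trans_lt hac'
    have hνc := hposx c hc0 hcb
    have hμν := measureReal_lt_le_measureReal_le hs hc0
    have := sq_add_le_of_sq_le (k := 4 * Real.pi) (C := (1 + δ) ^ 2) (by positivity)
      (by positivity) (sub_nonneg.2 hac) (sub_nonneg.2 hcy.le) (energyBetween_nonneg u a c)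
      (energyBetween_nonneg u c y) (hlog c hac' hcb)
      (Real.log_nonneg ((one_le_div hposy).2
        (measureReal_le_le_measureReal_lt hs (h0.trans hac) hcy)))
      (energyBetween_add_le hu hs hac hcy.le)
      (l := Real.log (volume.real {x | a < u x} / volume.real {x | y ≤ u x})) ?_ hQc hstep
    · simpa [hQ] using this
    · rw [Real.log_div hposa.ne' hνc.ne', Real.log_div hposc.ne' hposy.ne',
        Real.log_div hposa.ne' hposy.ne']
      have := Real.log_le_log hposc hμν
      linarith
  have : y ≤ c := le_csSup hbdd ⟨⟨hac.trans hcy.le, hyb⟩, hQy⟩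
  linarith

lemma log_inequality (hu : ContDiff ℝ 1 u) (hs : HasCompactSupport u) {a b : ℝ}
    (h0 : 0 ≤ a) (hab : a < b) (hpos : 0 < volume.real {x | b ≤ u x}) :
    4 * Real.pi * (b - a) ^ 2 ≤ energyBetween u a b *
      Real.log (volume.real {x | a < u x} / volume.real {x | b ≤ u x}) := by
  set R := energyBetween u a b *
      Real.log (volume.real {x | a < u x} / volume.real {x | b ≤ u x})
  have ht : Tendsto (fun δ : ℝ => (1 + δ) ^ 2 * R) (nhdsWithin 0 (Set.Ioi 0))
      (nhds ((1 + 0) ^ 2 * R)) := by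
    apply Tendsto.mono_left _ nhdsWithin_le_nhds
    apply Continuous.tendsto (f := fun δ : ℝ => (1 + δ) ^ 2 * R)
    fun_prop
  rw [add_zero, one_pow, one_mul] at ht
  refine ge_of_tendsto ht ?_
  filter_upwards [self_mem_nhdsWithin] with δ hδ
  exact log_inequality_of_pos hu hs h0 hab hδ hpos

lemma sq_sub_sq_le_of_energy {a b l e₁ e₂ T₁ T₂ : ℝ} (ha : 0 < a) (hab : a < b) (hl : 0 ≤ l)
    (hla : l ≤ a ^ 2) (he₁ : 0 ≤ e₁) (he₂ : 0 ≤ e₂) (he : e₁ + e₂ ≤ 1)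
    (h₁ : a ^ 2 ≤ e₁ * T₁) (h₂ : (b - a) ^ 2 ≤ e₂ * (T₂ - T₁)) (hT₁ : T₁ ≤ a ^ 2 + l)
    (hT₂ : T₂ ≤ b ^ 2 + l) : b ^ 2 - a ^ 2 ≤ 15 * l := by
  have ha2 : 0 < a ^ 2 := by positivity
  have hT : a ^ 2 ≤ T₁ := by
    have : 0 < T₁ := by
      by_contra! h
      nlinarith
    nlinarith
  have hb2 : a ^ 2 < b ^ 2 := by nlinarith
  have h3 : e₂ * (a ^ 2 + l) ≤ l := by nlinarith
  have h4 : (b - a) ^ 2 * (a ^ 2 + l) ≤ l * (b ^ 2 - a ^ 2 + l) := by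
    calc (b - a) ^ 2 * (a ^ 2 + l) ≤ (e₂ * (b ^ 2 - a ^ 2 + l)) * (a ^ 2 + l) := by
          gcongr
          exact h₂.trans (by gcongr; linarith)
      _ = (e₂ * (a ^ 2 + l)) * (b ^ 2 - a ^ 2 + l) := by ring
      _ ≤ _ := by gcongr
  set d := b - a
  have hb : b = a + d := by ring
  have hd : 0 < d := sub_pos.2 hab
  rw [hb] at h4 ⊢
  have h5 : (d * a) ^ 2 ≤ 2 * (d * a) * l + l ^ 2 := by nlinarith
  have hda : 0 < d * a := by positivity
  have h6 : d * a ≤ 3 * l := by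
    by_contra! h
    nlinarith
  have h7 : d ^ 2 ≤ 9 * l := by
    have : d ^ 2 * a ^ 2 ≤ 9 * l * a ^ 2 := by
      calc d ^ 2 * a ^ 2 = (d * a) ^ 2 := by ring
        _ ≤ (3 * l) ^ 2 := by gcongr
        _ = 9 * l * l := by ring
        _ ≤ _ := by gcongr
    exact le_of_mul_le_mul_right this ha2
  nlinarith

/-- The distribution function of `u ^ 2` on `{u > 0}`, normalized by the Gaussian weight. -/
noncomputable def weightedDistribution (u : ℂ → ℝ) (q : ℝ) : ℝ :=
  Real.exp q * (volume.real {x | √q ≤ u x} / volume.real {x | 0 < u x})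

lemma energyBetween_le (hu : ContDiff ℝ 1 u) (hs : HasCompactSupport u)
    (hE : ∫ x, ‖fderiv ℝ u x‖ ^ 2 ≤ 4 * Real.pi) (s t : ℝ) :
    energyBetween u s t ≤ 4 * Real.pi :=
  (setIntegral_le_integral (integrable_sq_norm_fderiv hu hs)
    (Eventually.of_forall fun _ => sq_nonneg _)).trans hE

lemma le_log_of_pos (hu : ContDiff ℝ 1 u) (hs : HasCompactSupport u)
    (hE : ∫ x, ‖fderiv ℝ u x‖ ^ 2 ≤ 4 * Real.pi) {q : ℝ} (hq : 0 < q)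
    (hpos : 0 < volume.real {x | √q ≤ u x}) :
    q ≤ Real.log (volume.real {x | 0 < u x} / volume.real {x | √q ≤ u x}) := by
  have hq' := Real.sqrt_pos.2 hq
  have h := log_inequality hu hs le_rfl hq' hpos
  rw [sub_zero, Real.sq_sqrt hq.le] at h
  have hl : 0 ≤ Real.log (volume.real {x | 0 < u x} / volume.real {x | √q ≤ u x}) :=
    Real.log_nonneg ((one_le_div hpos).2 (measureReal_le_le_measureReal_lt hs le_rfl hq'))
  have h2 := h.trans (mul_le_mul_of_nonneg_right (energyBetween_le hu hs hE _ _) hl)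
  exact le_of_mul_le_mul_left h2 (by positivity)

lemma weightedDistribution_le_one (hu : ContDiff ℝ 1 u) (hs : HasCompactSupport u)
    (hE : ∫ x, ‖fderiv ℝ u x‖ ^ 2 ≤ 4 * Real.pi) {q : ℝ} (hq : 0 < q) :
    weightedDistribution u q ≤ 1 := by
  unfold weightedDistribution
  rcases (measureReal_nonneg (μ := volume) (s := {x | √q ≤ u x})).eq_or_lt with h | hpos
  · rw [← h]; simp
  have hm := hpos.trans_le
    (measureReal_le_le_measureReal_lt hs le_rfl (Real.sqrt_pos.2 hq))
  have h := Real.exp_le_exp.2 (le_log_of_pos hu hs hE hq hpos)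
  rw [Real.exp_log (div_pos hm hpos)] at h
  calc _ ≤ (volume.real {x | 0 < u x} / volume.real {x | √q ≤ u x}) *
        (volume.real {x | √q ≤ u x} / volume.real {x | 0 < u x}) := by gcongr
    _ = 1 := by field_simp

lemma sub_le_of_le_weightedDistribution (hu : ContDiff ℝ 1 u) (hs : HasCompactSupport u)
    (hE : ∫ x, ‖fderiv ℝ u x‖ ^ 2 ≤ 4 * Real.pi) {l q₁ q₂ : ℝ} (hl : 0 ≤ l) (hlq : l < q₁)
    (hq : q₁ < q₂) (h₁ : Real.exp (-l) ≤ weightedDistribution u q₁)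
    (h₂ : Real.exp (-l) ≤ weightedDistribution u q₂) : q₂ - q₁ ≤ 15 * l := by
  have key : ∀ q, 0 < q → Real.exp (-l) ≤ weightedDistribution u q →
      0 < volume.real {x | √q ≤ u x} ∧
      Real.log (volume.real {x | 0 < u x} / volume.real {x | √q ≤ u x}) ≤ q + l := by
    intro q hq h
    unfold weightedDistribution at h
    have hpos : 0 < volume.real {x | √q ≤ u x} := by
      refine lt_of_le_of_ne measureReal_nonneg fun h0 => ?_
      rw [← h0] at h
      simp at h
      exact absurd h (not_le.2 (Real.exp_pos _))
    have hm := hpos.trans_le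
      (measureReal_le_le_measureReal_lt hs le_rfl (Real.sqrt_pos.2 hq))
    refine ⟨hpos, ?_⟩
    have h' := Real.log_le_log (Real.exp_pos _) h
    rw [Real.log_mul (Real.exp_pos _).ne' (div_pos hpos hm).ne', Real.log_exp, Real.log_exp,
      Real.log_div hpos.ne' hm.ne'] at h'
    rw [Real.log_div hm.ne' hpos.ne']
    linarith
  have hq1 : 0 < q₁ := hl.trans_lt hlq
  have hq2 := hq1.trans hq
  obtain ⟨hp1, hT1⟩ := key q₁ hq1 h₁
  obtain ⟨hp2, hT2⟩ := key q₂ hq2 h₂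
  have ha : 0 < √q₁ := Real.sqrt_pos.2 hq1
  have hab : √q₁ < √q₂ := Real.sqrt_lt_sqrt hq1.le hq
  have hm := hp1.trans_le (measureReal_le_le_measureReal_lt hs le_rfl ha)
  have hμa := hp2.trans_le (measureReal_le_le_measureReal_lt hs ha.le hab)
  have hi1 := log_inequality hu hs le_rfl ha hp1
  have hi2 := log_inequality hu hs ha.le hab hp2
  have hadd := energyBetween_add_le hu hs ha.le hab.le
  have htot := energyBetween_le hu hs hE 0 (√q₂)
  have hE1 := energyBetween_nonneg u 0 (√q₁)
  have hE2 := energyBetween_nonneg u (√q₁) (√q₂)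
  have hs1 := Real.sq_sqrt hq1.le
  have hs2 := Real.sq_sqrt hq2.le
  have hπ : 0 < 4 * Real.pi := by positivity
  have := sq_sub_sq_le_of_energy (a := √q₁) (b := √q₂) (l := l)
    (e₁ := energyBetween u 0 (√q₁) / (4 * Real.pi))
    (e₂ := energyBetween u (√q₁) (√q₂) / (4 * Real.pi)) ha hab hl (by rw [hs1]; exact hlq.le)
    (by positivity) (by positivity) (by rw [← add_div, div_le_one hπ]; linarith)
    (T₁ := Real.log (volume.real {x | 0 < u x} / volume.real {x | √q₁ ≤ u x}))
    (T₂ := Real.log (volume.real {x | 0 < u x} / volume.real {x | √q₂ ≤ u x}))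
    ?_ ?_ (by rwa [hs1]) (by rwa [hs2])
  · rwa [hs1, hs2] at this
  · rw [div_mul_eq_mul_div, le_div_iff₀ hπ]
    rw [sub_zero] at hi1
    linarith
  · rw [div_mul_eq_mul_div, le_div_iff₀ hπ, mul_comm]
    refine hi2.trans (mul_le_mul_of_nonneg_left ?_ hE2)
    rw [Real.log_div hm.ne' hp1.ne', Real.log_div hm.ne' hp2.ne', Real.log_div hμa.ne' hp2.ne']
    have := Real.log_le_log hμa (measureReal_lt_le_measureReal_le hs ha)
    linarith

lemma volume_weightedDistribution_ge_le (hu : ContDiff ℝ 1 u) (hs : HasCompactSupport u)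
    (hE : ∫ x, ‖fderiv ℝ u x‖ ^ 2 ≤ 4 * Real.pi) {l : ℝ} (hl : 0 ≤ l) :
    volume ({q | Real.exp (-l) ≤ weightedDistribution u q} ∩ Set.Ioi 0) ≤
      ENNReal.ofReal (16 * l) := by
  have hsub : {q | Real.exp (-l) ≤ weightedDistribution u q} ∩ Set.Ioi 0 ⊆
      Set.Ioc 0 l ∪ {q | l < q ∧ Real.exp (-l) ≤ weightedDistribution u q} := by
    rintro q ⟨hq, hq0⟩
    rcases le_or_gt q l with h | h
    · exact Or.inl ⟨hq0, h⟩
    · exact Or.inr ⟨h, hq⟩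
  refine (measure_mono hsub).trans ((measure_union_le _ _).trans ?_)
  rw [show 16 * l = l + 15 * l by ring, ENNReal.ofReal_add hl (by positivity)]
  gcongr
  · simp
  · refine (Real.volume_le_diam _).trans (Metric.ediam_le ?_)
    rintro q₁ ⟨hl1, h1⟩ q₂ ⟨hl2, h2⟩
    rw [edist_dist, Real.dist_eq]
    apply ENNReal.ofReal_le_ofReal
    rcases lt_trichotomy q₁ q₂ with h | h | h
    · rw [abs_sub_comm, abs_of_pos (sub_pos.2 h)]
      exact sub_le_of_le_weightedDistribution hu hs hE hl hl1 h h1 h2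
    · rw [h]; simp [hl]
    · rw [abs_of_pos (sub_pos.2 h)]
      exact sub_le_of_le_weightedDistribution hu hs hE hl hl2 h h2 h1

lemma lintegral_Ioc_ofReal_neg_log :
    ∫⁻ τ in Set.Ioc (0 : ℝ) 1, ENNReal.ofReal (16 * -Real.log τ) = 16 := by
  rw [← ofReal_integral_eq_lintegral_ofReal, ← intervalIntegral.integral_of_le zero_le_one,
    intervalIntegral.integral_const_mul, intervalIntegral.integral_neg, integral_log]
  · norm_num
  · rw [← IntegrableOn, ← intervalIntegrable_iff_integrableOn_Ioc_of_le zero_le_one]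
    exact intervalIntegral.intervalIntegrable_log'.neg.const_mul _
  · filter_upwards [ae_restrict_mem measurableSet_Ioc] with τ hτ
    have := Real.log_nonpos hτ.1.le hτ.2
    show (0 : ℝ) ≤ _
    linarith

lemma aemeasurable_weightedDistribution (hs : HasCompactSupport u) :
    AEMeasurable (weightedDistribution u) (volume.restrict (Set.Ioi 0)) := by
  have hanti : AntitoneOn (fun q : ℝ => volume.real {x | √q ≤ u x}) (Set.Ioi 0) :=
    fun q₁ h₁ q₂ _ h => measureReal_superlevel_antitone hs (Real.sqrt_pos.2 h₁)
      (Real.sqrt_le_sqrt h)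
  have h := aemeasurable_restrict_of_antitoneOn (μ := volume) measurableSet_Ioi hanti
  exact Real.measurable_exp.aemeasurable.mul (h.div_const _)

lemma weightedDistribution_nonneg (u : ℂ → ℝ) (q : ℝ) : 0 ≤ weightedDistribution u q := by
  unfold weightedDistribution
  positivity

lemma lintegral_weightedDistribution_le (hu : ContDiff ℝ 1 u) (hs : HasCompactSupport u)
    (hE : ∫ x, ‖fderiv ℝ u x‖ ^ 2 ≤ 4 * Real.pi) :
    ∫⁻ q in Set.Ioi 0, ENNReal.ofReal (weightedDistribution u q) ≤ 16 := by
  rw [lintegral_eq_lintegral_meas_le _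
    (Eventually.of_forall (weightedDistribution_nonneg u))
    (aemeasurable_weightedDistribution hs), ← Set.Ioc_union_Ioi_eq_Ioi zero_le_one]
  refine (lintegral_union_le _ _ _).trans ?_
  have h2 : ∫⁻ τ in Set.Ioi (1 : ℝ), (volume.restrict (Set.Ioc 0 1 ∪ Set.Ioi 1))
      {q | τ ≤ weightedDistribution u q} = 0 := by
    rw [setLIntegral_congr_fun (g := fun _ => 0) measurableSet_Ioi]
    · simp
    · intro τ hτ
      show (volume.restrict _) _ = 0
      rw [Set.Ioc_union_Ioi_eq_Ioi zero_le_one, Measure.restrict_apply' measurableSet_Ioi]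
      convert measure_empty (μ := volume)
      ext q
      simp only [Set.mem_inter_iff, Set.mem_ofPred_eq, Set.mem_empty_iff_false, iff_false]
      rintro ⟨h, hq⟩
      have := weightedDistribution_le_one hu hs hE hq
      have hτ : 1 < τ := hτ
      linarith
  rw [h2, add_zero, ← lintegral_Ioc_ofReal_neg_log]
  refine setLIntegral_mono' measurableSet_Ioc fun τ hτ => ?_
  rw [Set.Ioc_union_Ioi_eq_Ioi zero_le_one, Measure.restrict_apply' measurableSet_Ioi]
  have := volume_weightedDistribution_ge_le hu hs hE
    (neg_nonneg.2 (Real.log_nonpos hτ.1.le hτ.2))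
  rwa [neg_neg, Real.exp_log hτ.1] at this

lemma lintegral_exp_sq_sub_one_le (hu : ContDiff ℝ 1 u) (hs : HasCompactSupport u)
    (hE : ∫ x, ‖fderiv ℝ u x‖ ^ 2 ≤ 4 * Real.pi) :
    ∫⁻ x in {x | 0 < u x}, ENNReal.ofReal (Real.exp (u x ^ 2) - 1) ≤
      16 * volume {x | 0 < u x} := by
  have hfin := measure_superlevel_ne_top hs le_rfl
  have hm : MeasurableSet {x | 0 < u x} :=
    measurableSet_lt measurable_const hu.continuous.measurable
  rcases eq_or_ne (volume {x | 0 < u x}) 0 with h0 | h0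
  · rw [Measure.restrict_eq_zero.2 h0]; simp
  have hm0 : 0 < volume.real {x | 0 < u x} := ENNReal.toReal_pos h0 hfin
  have hlc := lintegral_comp_eq_lintegral_meas_le_mul (f := fun x => u x ^ 2) (g := Real.exp)
    (volume.restrict {x | 0 < u x}) (Eventually.of_forall fun x => sq_nonneg _)
    (hu.continuous.measurable.pow_const 2).aemeasurable
    (fun t _ => Real.continuous_exp.intervalIntegrable _ _)
    (Eventually.of_forall fun t => (Real.exp_pos t).le)
  simp only [integral_exp, Real.exp_zero] at hlc
  rw [hlc]
  have hpt : ∀ q ∈ Set.Ioi (0 : ℝ), (volume.restrict {x | 0 < u x}) {x | q ≤ u x ^ 2} *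
      ENNReal.ofReal (Real.exp q) =
      volume {x | 0 < u x} * ENNReal.ofReal (weightedDistribution u q) := by
    intro q hq
    have hq : 0 < q := hq
    have hset : {x | q ≤ u x ^ 2} ∩ {x | 0 < u x} = {x | √q ≤ u x} := by
      ext x
      simp only [Set.mem_inter_iff, Set.mem_ofPred_eq]
      constructor
      · rintro ⟨h1, h2⟩
        exact (Real.sqrt_le_left h2.le).2 h1
      · intro h
        have h2 := (Real.sqrt_pos.2 hq).trans_le h
        exact ⟨(Real.sqrt_le_left h2.le).1 h, h2⟩
    have hfin2 : volume {x | √q ≤ u x} ≠ ⊤ := ne_top_of_le_ne_top hfin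
      (measure_mono fun x (hx : √q ≤ u x) => (Real.sqrt_pos.2 hq).trans_le hx)
    rw [Measure.restrict_apply' hm, hset, ← ENNReal.ofReal_toReal hfin2,
      ← ENNReal.ofReal_toReal hfin, ← ENNReal.ofReal_mul (by positivity),
      ← ENNReal.ofReal_mul (by positivity)]
    congr 1
    unfold weightedDistribution
    simp only [Measure.real] at hm0 ⊢
    field_simp
  rw [setLIntegral_congr_fun measurableSet_Ioi hpt, lintegral_const_mul' _ _ hfin, mul_comm]
  gcongr
  exact lintegral_weightedDistribution_le hu hs hE

lemma setLIntegral_exp_sq_le (hu : ContDiff ℝ 1 u) (hs : HasCompactSupport u)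
    (hE : ∫ x, ‖fderiv ℝ u x‖ ^ 2 ≤ 4 * Real.pi) {Ω : Set ℂ} (hΩ : tsupport u ⊆ Ω) :
    ∫⁻ x in Ω, ENNReal.ofReal (Real.exp (u x ^ 2)) ≤ 33 * volume Ω := by
  have hneg : ContDiff ℝ 1 fun x => -u x := hu.neg
  have hsneg : HasCompactSupport fun x => -u x := hs.neg
  have hEneg : ∫ x, ‖fderiv ℝ (fun x => -u x) x‖ ^ 2 ≤ 4 * Real.pi := by
    simpa only [fderiv_fun_neg, norm_neg] using hE
  have h1 := lintegral_exp_sq_sub_one_le hu hs hE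
  have h2 := lintegral_exp_sq_sub_one_le hneg hsneg hEneg
  simp only [neg_sq] at h2
  have hv1 : volume {x | 0 < u x} ≤ volume Ω :=
    measure_mono fun x (hx : 0 < u x) => hΩ (subset_tsupport u hx.ne')
  have hv2 : volume {x | 0 < -u x} ≤ volume Ω :=
    measure_mono fun x (hx : 0 < -u x) => hΩ (subset_tsupport u (neg_pos.1 hx).ne)
  have hcu := hu.continuous.measurable
  have hm1 : MeasurableSet {x | 0 < u x} := measurableSet_lt measurable_const hcu
  have hm2 : MeasurableSet {x | 0 < -u x} := measurableSet_lt measurable_const hcu.neg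
  set f : ℂ → ENNReal := fun x => ENNReal.ofReal (Real.exp (u x ^ 2) - 1) with hf
  have hfm : Measurable f := by fun_prop
  have hpt : ∀ x, ENNReal.ofReal (Real.exp (u x ^ 2)) ≤
      1 + (Set.indicator {x | 0 < u x} f x + Set.indicator {x | 0 < -u x} f x) := by
    intro x
    have hx : ENNReal.ofReal (Real.exp (u x ^ 2)) = 1 + f x := by
      rw [hf, ← ENNReal.ofReal_one, ← ENNReal.ofReal_add zero_le_one]
      · ring_nf
      · linarith [Real.one_le_exp (sq_nonneg (u x))]
    rw [hx]
    gcongr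
    rcases lt_trichotomy (u x) 0 with h | h | h
    · rw [Set.indicator_of_mem (s := {x | 0 < -u x}) (by simpa using h)]
      exact le_add_self
    · simp [hf, h]
    · rw [Set.indicator_of_mem (s := {x | 0 < u x}) (by simpa using h)]
      exact le_self_add
  calc ∫⁻ x in Ω, ENNReal.ofReal (Real.exp (u x ^ 2))
      ≤ ∫⁻ x in Ω, 1 + (Set.indicator {x | 0 < u x} f x + Set.indicator {x | 0 < -u x} f x) :=
        lintegral_mono hpt
    _ = volume Ω + ∫⁻ x in Ω,
        (Set.indicator {x | 0 < u x} f x + Set.indicator {x | 0 < -u x} f x) := by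
        rw [lintegral_add_left measurable_const]; simp
    _ ≤ volume Ω + ∫⁻ x,
        (Set.indicator {x | 0 < u x} f x + Set.indicator {x | 0 < -u x} f x) := by
        gcongr
        exact Measure.restrict_le_self
    _ = volume Ω + ((∫⁻ x in {x | 0 < u x}, f x) + ∫⁻ x in {x | 0 < -u x}, f x) := by
        rw [lintegral_add_left (hfm.indicator hm1), lintegral_indicator hm1,
          lintegral_indicator hm2]
    _ ≤ volume Ω + (16 * volume Ω + 16 * volume Ω) := by
        gcongr
        · exact h1.trans (by gcongr)
        · exact h2.trans (by gcongr)
    _ = 33 * volume Ω := by ring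

/-- The Moser–Trudinger inequality with the sharp exponent on open subsets of the plane. -/
theorem setLIntegral_exp_sq_le_euclidean {u : EuclideanSpace ℝ (Fin 2) → ℝ}
    {Ω : Set (EuclideanSpace ℝ (Fin 2))} (hΩo : IsOpen Ω) (hu : ContDiff ℝ 1 u)
    (hs : HasCompactSupport u) (hΩ : tsupport u ⊆ Ω)
    (hE : ∫ x in Ω, ‖gradient u x‖ ^ 2 ≤ 4 * Real.pi) :
    ∫⁻ x in Ω, ENNReal.ofReal (Real.exp (u x ^ 2)) ≤ 33 * volume Ω := by
  set e : ℂ ≃ₗᵢ[ℝ] EuclideanSpace ℝ (Fin 2) := Complex.orthonormalBasisOneI.repr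
  have hmp : MeasurePreserving e volume volume := e.measurePreserving
  have hemb : MeasurableEmbedding e := e.toHomeomorph.measurableEmbedding
  have hgrad : ∀ x, ‖gradient u x‖ = ‖fderiv ℝ u x‖ := fun x => by
    simp [gradient]
  simp only [hgrad] at hE
  have hfd : ∀ z, ‖fderiv ℝ (fun z => u (e z)) z‖ = ‖fderiv ℝ u (e z)‖ := by
    intro z
    have h := ((hu.differentiable one_ne_zero (e z)).hasFDerivAt.comp z
      e.toContinuousLinearEquiv.hasFDerivAt).fderiv
    rw [show (fun z => u (e z)) = u ∘ e from rfl, h]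
    exact ContinuousLinearMap.opNorm_comp_linearIsometryEquiv _ e
  have hEw : ∫ z, ‖fderiv ℝ (fun z => u (e z)) z‖ ^ 2 ≤ 4 * Real.pi := by
    simp only [hfd]
    rw [hmp.integral_comp hemb (fun x => ‖fderiv ℝ u x‖ ^ 2),
      ← setIntegral_eq_integral_of_forall_compl_eq_zero (s := Ω)]
    · exact hE
    · intro x hx
      have : fderiv ℝ u x = 0 :=
        image_eq_zero_of_notMem_tsupport fun h => hx (hΩ (tsupport_fderiv_subset ℝ h))
      simp [this]
  have hw : ContDiff ℝ 1 fun z => u (e z) := hu.comp e.contDiff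
  have hws : HasCompactSupport fun z => u (e z) :=
    hs.comp_isClosedEmbedding e.toHomeomorph.isClosedEmbedding
  have hsupp : tsupport (fun z => u (e z)) ⊆ e ⁻¹' Ω :=
    (tsupport_comp_subset_preimage u e.continuous).trans (Set.preimage_mono hΩ)
  have h := setLIntegral_exp_sq_le hw hws hEw hsupp
  rwa [hmp.setLIntegral_comp_preimage_emb hemb
      (fun x => ENNReal.ofReal (Real.exp (u x ^ 2))),
    hmp.measure_preimage hΩo.measurableSet.nullMeasurableSet] at h

lemma exists_bound_of_even_of_tendsto {g : ℝ → ℝ} (hg : Continuous g)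
    (heven : ∀ t, g (-t) = g t) (h0 : Tendsto g atTop (nhds 0)) :
    ∃ G : ℝ, ∀ t, g t ≤ G := by
  obtain ⟨R, hR⟩ := eventually_atTop.1 (h0.eventually (gt_mem_nhds zero_lt_one))
  obtain ⟨M, hM⟩ := (isCompact_Icc (a := 0) (b := R)).bddAbove_image hg.continuousOn
  have hnn : ∀ t, 0 ≤ t → g t ≤ max 1 M := by
    intro t ht
    rcases le_total t R with h | h
    · exact (hM ⟨t, ⟨ht, h⟩, rfl⟩).trans (le_max_right _ _)
    · exact (hR t h).le.trans (le_max_left _ _)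
  refine ⟨max 1 M, fun t => ?_⟩
  rcases le_total 0 t with h | h
  · exact hnn t h
  · rw [← heven]; exact hnn _ (by linarith)

end MoserTrudinger

/-- Critical perturbed Moser–Trudinger inequality: `C_{g,4π}(Ω)` is finite. -/
theorem perturbed_moser_trudinger_critical_finite
    (g : ℝ → ℝ) (hg1 : ContDiff ℝ 1 g) (hgeven : ∀ t, g (-t) = g t)
    (hgpos : ∀ t, g t > -1) (hg0 : Tendsto g atTop (nhds 0))
    (Ω : Set (EuclideanSpace ℝ (Fin 2))) (hΩo : IsOpen Ω)
    (hΩb : Bornology.IsBounded Ω) :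
    ∃ K : ℝ, ∀ u : EuclideanSpace ℝ (Fin 2) → ℝ,
      ContDiff ℝ (⊤ : ℕ∞) u → HasCompactSupport u → tsupport u ⊆ Ω →
      (∫ x in Ω, ‖gradient u x‖ ^ 2) ≤ 4 * Real.pi →
      (∫ x in Ω, (1 + g (u x)) * Real.exp ((u x) ^ 2)) ≤ K := by
  obtain ⟨G, hG⟩ := MoserTrudinger.exists_bound_of_even_of_tendsto hg1.continuous hgeven hg0
  have hG0 : 0 ≤ 1 + G := by linarith [hgpos 0, hG 0]
  refine ⟨(1 + G) * (33 * volume Ω).toReal, fun u hu hs hΩ hE => ?_⟩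
  have hu1 : ContDiff ℝ 1 u := hu.of_le (by exact_mod_cast le_top)
  have hmt := MoserTrudinger.setLIntegral_exp_sq_le_euclidean hΩo hu1 hs hΩ hE
  have hfin : 33 * volume Ω ≠ ⊤ :=
    ENNReal.mul_ne_top (by norm_num) hΩb.measure_lt_top.ne
  have hgc := hg1.continuous
  have huc := hu.continuous
  have hpt : ∀ x, 0 ≤ (1 + g (u x)) * Real.exp (u x ^ 2) := fun x =>
    mul_nonneg (by linarith [hgpos (u x)]) (Real.exp_pos _).le
  rw [integral_eq_lintegral_of_nonneg_ae (Eventually.of_forall hpt)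
    (by apply Continuous.aestronglyMeasurable; fun_prop)]
  rw [← ENNReal.toReal_ofReal hG0, ← ENNReal.toReal_mul]
  refine ENNReal.toReal_mono (ENNReal.mul_ne_top ENNReal.ofReal_ne_top hfin) ?_
  calc ∫⁻ x in Ω, ENNReal.ofReal ((1 + g (u x)) * Real.exp (u x ^ 2))
      ≤ ∫⁻ x in Ω, ENNReal.ofReal (1 + G) * ENNReal.ofReal (Real.exp (u x ^ 2)) := by
        refine lintegral_mono fun x => ?_
        rw [← ENNReal.ofReal_mul hG0]
        apply ENNReal.ofReal_le_ofReal
        gcongr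
        exact hG _
    _ = ENNReal.ofReal (1 + G) * ∫⁻ x in Ω, ENNReal.ofReal (Real.exp (u x ^ 2)) :=
        lintegral_const_mul' _ _ ENNReal.ofReal_ne_top
    _ ≤ _ := by gcongr
end

section
/- Supercritical blow-up of the perturbed Moser–Trudinger functional: if Ω is a nonempty bounded open subset of ℝ² and α > 4π, then C_{g,α}(Ω) = +∞; that is, for every K ∈ ℝ there exists a smooth compactly supported u : Ω → ℝ with ∫_Ω |∇u(x)|² dx ≤ α and ∫_Ω (1 + g(u(x)))·exp(u(x)²) dx > K. -/
open MeasureTheory Filter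

/-- A smooth version of `max t 0`: it vanishes for `t ≤ 0` and has slope in `[0, 1]`. -/
noncomputable def smoothRamp (t : ℝ) : ℝ :=
  ∫ s in (0 : ℝ)..t, Real.smoothTransition s

theorem hasDerivAt_smoothRamp (t : ℝ) :
    HasDerivAt smoothRamp (Real.smoothTransition t) t :=
  (Real.smoothTransition.continuous.integral_hasStrictDerivAt 0 t).hasDerivAt

theorem contDiff_smoothRamp : ContDiff ℝ (⊤ : ℕ∞) smoothRamp := by
  rw [contDiff_infty_iff_deriv]
  refine ⟨fun t => (hasDerivAt_smoothRamp t).differentiableAt, ?_⟩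
  rw [funext fun t => (hasDerivAt_smoothRamp t).deriv]
  exact Real.smoothTransition.contDiff

theorem smoothRamp_of_nonpos {t : ℝ} (ht : t ≤ 0) : smoothRamp t = 0 := by
  refine intervalIntegral.integral_zero_ae (Eventually.of_forall fun s hs => ?_)
  rw [Set.uIoc_of_ge ht] at hs
  exact Real.smoothTransition.zero_of_nonpos hs.2

theorem sub_one_le_smoothRamp {t : ℝ} (ht : 1 ≤ t) : t - 1 ≤ smoothRamp t := by
  have hint : ∀ a b : ℝ, IntervalIntegrable Real.smoothTransition volume a b := fun a b =>
    Real.smoothTransition.continuous.intervalIntegrable a b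
  have hone : ∫ s in (1 : ℝ)..t, Real.smoothTransition s = t - 1 := by
    rw [intervalIntegral.integral_congr (g := fun _ => (1 : ℝ))]
    · simp
    · intro s hs
      rw [Set.uIcc_of_le ht] at hs
      exact Real.smoothTransition.one_of_one_le hs.1
  have hsplit := intervalIntegral.integral_add_adjacent_intervals (hint 0 1) (hint 1 t)
  have hnonneg : 0 ≤ ∫ s in (0 : ℝ)..1, Real.smoothTransition s :=
    intervalIntegral.integral_nonneg zero_le_one fun s _ => Real.smoothTransition.nonneg s
  unfold smoothRamp
  linarith

/-- A smooth Moser function concentrated at `x₀`, supported in the closed ball of radius `R`;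
`d` is the square of the concentration scale. -/
noncomputable def moserFun {E : Type*} [NormedAddCommGroup E] (c R d : ℝ) (x₀ x : E) : ℝ :=
  c * smoothRamp (Real.log (R ^ 2) - Real.log (‖x - x₀‖ ^ 2 + d))

/-- The squared gradient norm of `moserFun` as a function of the distance to the centre. -/
noncomputable def moserEnergyDensity (c R d r : ℝ) : ℝ :=
  (2 * c * Real.smoothTransition (Real.log (R ^ 2) - Real.log (r ^ 2 + d)) * r / (r ^ 2 + d)) ^ 2

theorem moserFun_of_le {E : Type*} [NormedAddCommGroup E] {c R d : ℝ}
    (hd : 0 < d) (hR : 0 < R) {x₀ x : E} (hx : R ≤ ‖x - x₀‖) :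
    moserFun c R d x₀ x = 0 := by
  have hle : R ^ 2 ≤ ‖x - x₀‖ ^ 2 + d := by nlinarith
  have hlog := Real.log_le_log (by positivity) hle
  rw [moserFun, smoothRamp_of_nonpos (by linarith), mul_zero]

theorem support_moserFun_subset {E : Type*} [NormedAddCommGroup E] {c R d : ℝ}
    (hd : 0 < d) (hR : 0 < R) (x₀ : E) :
    Function.support (moserFun c R d x₀) ⊆ Metric.closedBall x₀ R := by
  intro x hx
  rw [Metric.mem_closedBall, dist_eq_norm]
  by_contra! h
  exact hx (moserFun_of_le hd hR h.le)

section InnerProductSpace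

variable {E : Type*} [NormedAddCommGroup E] [InnerProductSpace ℝ E]

theorem contDiff_moserFun {c R d : ℝ} (hd : 0 < d) (x₀ : E) :
    ContDiff ℝ (⊤ : ℕ∞) (moserFun c R d x₀) := by
  refine contDiff_const.mul (contDiff_smoothRamp.comp (contDiff_const.sub (ContDiff.log ?_ ?_)))
  · exact ((contDiff_id.sub contDiff_const).norm_sq ℝ).add contDiff_const
  · intro x
    positivity

theorem norm_gradient_moserFun_sq [CompleteSpace E] {c R d : ℝ} (hd : 0 < d) (x₀ x : E) :
    ‖gradient (moserFun c R d x₀) x‖ ^ 2 = moserEnergyDensity c R d ‖x - x₀‖ := by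
  have hpos : 0 < ‖x - x₀‖ ^ 2 + d := by positivity
  have hsq := (((hasFDerivAt_id x).sub_const x₀).norm_sq.add_const d)
  have hlog := ((Real.hasDerivAt_log hpos.ne').comp_hasFDerivAt x hsq).const_sub (Real.log (R ^ 2))
  have hu := ((hasDerivAt_smoothRamp _).comp_hasFDerivAt x hlog).const_mul c
  have hu' : HasFDerivAt (moserFun c R d x₀) _ x := hu
  have hdual : ‖gradient (moserFun c R d x₀) x‖ = ‖fderiv ℝ (moserFun c R d x₀) x‖ := by
    simp [gradient]
  rw [hdual, hu'.fderiv, moserEnergyDensity]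
  simp only [ContinuousLinearMap.comp_id, id, Function.comp_apply, norm_smul, norm_neg,
    two_nsmul, ← two_smul ℝ, innerSL_apply_norm, Real.norm_eq_abs]
  rw [← sq_abs (_ / _)]
  simp only [abs_div, abs_mul, abs_inv, abs_norm]
  congr 1
  norm_num
  ring

end InnerProductSpace

theorem continuous_moserEnergyDensity {c R d : ℝ} (hd : 0 < d) :
    Continuous (moserEnergyDensity c R d) := by
  have hpos : ∀ r : ℝ, r ^ 2 + d ≠ 0 := fun r => by positivity
  have hlog : Continuous fun r : ℝ => Real.log (r ^ 2 + d) :=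
    Continuous.log (by fun_prop) hpos
  have := Real.smoothTransition.continuous.comp
    ((continuous_const (y := Real.log (R ^ 2))).sub hlog)
  exact (((continuous_const.mul this).mul continuous_id).div (by fun_prop) hpos).pow 2

theorem moserEnergyDensity_of_le {c R d r : ℝ} (hR : 0 < R)
    (hr : R ^ 2 ≤ r ^ 2 + d) : moserEnergyDensity c R d r = 0 := by
  have hlog := Real.log_le_log (by positivity) hr
  rw [moserEnergyDensity, Real.smoothTransition.zero_of_nonpos (by linarith)]
  simp

theorem mul_moserEnergyDensity_le {c R d r : ℝ} (hd : 0 < d) (hr : 0 ≤ r) :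
    r * moserEnergyDensity c R d r ≤ 4 * c ^ 2 * (r / (r ^ 2 + d)) := by
  rw [moserEnergyDensity]
  set σ := Real.smoothTransition (Real.log (R ^ 2) - Real.log (r ^ 2 + d))
  have h0 : 0 ≤ σ := Real.smoothTransition.nonneg _
  have h1 : σ ≤ 1 := Real.smoothTransition.le_one _
  have hp : 0 < r ^ 2 + d := by positivity
  have hσ : σ ^ 2 ≤ 1 := by nlinarith
  have hq : r ^ 2 / (r ^ 2 + d) ≤ 1 := (div_le_one hp).2 (by linarith)
  have hle : σ ^ 2 * (r ^ 2 / (r ^ 2 + d)) ≤ 1 := mul_le_one₀ hσ (by positivity) hq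
  calc r * (2 * c * σ * r / (r ^ 2 + d)) ^ 2
      = 4 * c ^ 2 * (r / (r ^ 2 + d)) * (σ ^ 2 * (r ^ 2 / (r ^ 2 + d))) := by
        field_simp
        ring
    _ ≤ 4 * c ^ 2 * (r / (r ^ 2 + d)) := mul_le_of_le_one_right (by positivity) hle

theorem integral_div_sq_add {d S : ℝ} (hd : 0 < d) :
    ∫ r in (0 : ℝ)..S, r / (r ^ 2 + d) = (Real.log (S ^ 2 + d) - Real.log d) / 2 := by
  have hpos : ∀ r : ℝ, r ^ 2 + d ≠ 0 := fun r => by positivity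
  have hderiv : ∀ r ∈ Set.uIcc 0 S,
      HasDerivAt (fun r : ℝ => Real.log (r ^ 2 + d) / 2) (r / (r ^ 2 + d)) r := by
    intro r _
    refine ((((hasDerivAt_pow 2 r).add_const d).log (hpos r)).div_const 2).congr_deriv ?_
    norm_num
    ring
  rw [intervalIntegral.integral_eq_sub_of_hasDerivAt hderiv]
  · norm_num
    ring
  · exact (continuous_id.div (by fun_prop) hpos).intervalIntegrable _ _

theorem integral_mul_moserEnergyDensity_le {c R d : ℝ} (hd : 0 < d) (hR : 0 < R)
    (hdR : d ≤ R ^ 2) :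
    ∫ r in Set.Ioi (0 : ℝ), r * moserEnergyDensity c R d r
      ≤ 2 * c ^ 2 * (Real.log (R ^ 2) - Real.log d) := by
  set S := √(R ^ 2 - d)
  have hS : S ^ 2 = R ^ 2 - d := Real.sq_sqrt (by linarith)
  have hS0 : 0 ≤ S := Real.sqrt_nonneg _
  have hpos : ∀ r : ℝ, r ^ 2 + d ≠ 0 := fun r => by positivity
  rw [setIntegral_eq_of_subset_of_forall_sdiff_eq_zero measurableSet_Ioi
    (Set.Ioc_subset_Ioi_self : Set.Ioc 0 S ⊆ Set.Ioi 0), ← intervalIntegral.integral_of_le hS0]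
  · calc ∫ r in (0 : ℝ)..S, r * moserEnergyDensity c R d r
        ≤ ∫ r in (0 : ℝ)..S, 4 * c ^ 2 * (r / (r ^ 2 + d)) :=
          intervalIntegral.integral_mono_on hS0
            ((continuous_id.mul (continuous_moserEnergyDensity hd)).intervalIntegrable _ _)
            ((continuous_const.mul (continuous_id.div (by fun_prop) hpos)).intervalIntegrable _ _)
            fun r hr => mul_moserEnergyDensity_le hd hr.1
      _ = 2 * c ^ 2 * (Real.log (R ^ 2) - Real.log d) := by
          rw [intervalIntegral.integral_const_mul, integral_div_sq_add hd, hS, sub_add_cancel]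
          ring
  · rintro r ⟨hr0, hr⟩
    have hSr : S < r := by
      by_contra! h
      exact hr ⟨hr0, h⟩
    rw [moserEnergyDensity_of_le hR (by nlinarith), mul_zero]

theorem integral_norm_gradient_moserFun_sq_le {c R d : ℝ} (hd : 0 < d) (hR : 0 < R)
    (hdR : d ≤ R ^ 2) (x₀ : EuclideanSpace ℝ (Fin 2)) (Ω : Set (EuclideanSpace ℝ (Fin 2))) :
    ∫ x in Ω, ‖gradient (moserFun c R d x₀) x‖ ^ 2
      ≤ 4 * Real.pi * c ^ 2 * (Real.log (R ^ 2) - Real.log d) := by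
  simp only [norm_gradient_moserFun_sq hd]
  have hcont : Continuous fun x : EuclideanSpace ℝ (Fin 2) =>
      moserEnergyDensity c R d ‖x - x₀‖ :=
    (continuous_moserEnergyDensity hd).comp (by fun_prop)
  have hsupp : HasCompactSupport fun x : EuclideanSpace ℝ (Fin 2) =>
      moserEnergyDensity c R d ‖x - x₀‖ := by
    refine HasCompactSupport.of_support_subset_isCompact (isCompact_closedBall x₀ R) ?_
    intro x hx
    rw [Metric.mem_closedBall, dist_eq_norm]
    by_contra! h
    exact hx (moserEnergyDensity_of_le hR (by nlinarith))
  have hvol : (volume : Measure (EuclideanSpace ℝ (Fin 2))).real (Metric.ball 0 1) = Real.pi := by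
    simp [Measure.real, EuclideanSpace.volume_ball_fin_two, Real.pi_pos.le]
  calc ∫ x in Ω, moserEnergyDensity c R d ‖x - x₀‖
      ≤ ∫ x, moserEnergyDensity c R d ‖x - x₀‖ :=
        setIntegral_le_integral (hcont.integrable_of_hasCompactSupport hsupp)
          (Eventually.of_forall fun x => sq_nonneg _)
    _ = ∫ x : EuclideanSpace ℝ (Fin 2), moserEnergyDensity c R d ‖x‖ :=
        integral_sub_right_eq_self (fun x => moserEnergyDensity c R d ‖x‖) x₀
    _ = 2 * Real.pi * ∫ r in Set.Ioi (0 : ℝ), r * moserEnergyDensity c R d r := by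
        rw [integral_fun_norm_addHaar, hvol, finrank_euclideanSpace_fin]
        simp only [nsmul_eq_mul, smul_eq_mul, Nat.add_one_sub_one, pow_one]
        push_cast
        ring
    _ ≤ 2 * Real.pi * (2 * c ^ 2 * (Real.log (R ^ 2) - Real.log d)) := by
        gcongr
        exact integral_mul_moserEnergyDensity_le hd hR hdR
    _ = 4 * Real.pi * c ^ 2 * (Real.log (R ^ 2) - Real.log d) := by ring

theorem le_moserFun {E : Type*} [NormedAddCommGroup E] {c R d T : ℝ} (hc : 0 ≤ c) (hd : 0 < d)
    (hT : 2 ≤ T) (hlog : Real.log (R ^ 2) - Real.log d = T) {x₀ x : E}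
    (hx : ‖x - x₀‖ ^ 2 ≤ d) : c * (T - 2) ≤ moserFun c R d x₀ x := by
  have hle : Real.log (‖x - x₀‖ ^ 2 + d) ≤ Real.log 2 + Real.log d := by
    rw [← Real.log_mul two_ne_zero hd.ne']
    exact Real.log_le_log (by positivity) (by linarith)
  have hlog2 := Real.log_two_lt_d9
  have hramp := sub_one_le_smoothRamp
    (t := Real.log (R ^ 2) - Real.log (‖x - x₀‖ ^ 2 + d)) (by linarith)
  rw [moserFun]
  gcongr
  linarith

/-- Supercritical blow-up of the perturbed Moser–Trudinger functional:
if `Ω` is a nonempty bounded open subset of `ℝ²` and `α > 4π`, then `C_{g,α}(Ω) = +∞`. -/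
theorem perturbed_moser_trudinger_supercritical_infinite
    (g : ℝ → ℝ) (hg1 : ContDiff ℝ 1 g) (hgeven : ∀ t, g (-t) = g t)
    (hgpos : ∀ t, g t > -1) (hg0 : Tendsto g atTop (nhds 0))
    (Ω : Set (EuclideanSpace ℝ (Fin 2))) (hΩo : IsOpen Ω)
    (hΩb : Bornology.IsBounded Ω) (hΩne : Ω.Nonempty)
    (α : ℝ) (hα : 4 * Real.pi < α) :
    ∀ K : ℝ, ∃ u : EuclideanSpace ℝ (Fin 2) → ℝ,
      ContDiff ℝ (⊤ : ℕ∞) u ∧ HasCompactSupport u ∧ tsupport u ⊆ Ω ∧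
      (∫ x in Ω, ‖gradient u x‖ ^ 2) ≤ α ∧
      K < ∫ x in Ω, (1 + g (u x)) * Real.exp ((u x) ^ 2) := by
  intro K
  obtain ⟨x₀, hx₀⟩ := hΩne
  obtain ⟨R, hR, hball⟩ := Metric.nhds_basis_closedBall.mem_iff.1 (hΩo.mem_nhds hx₀)
  obtain ⟨M, hM⟩ := eventually_atTop.1
    (hg0.eventually_const_lt (show (-1 / 2 : ℝ) < 0 by norm_num))
  have hpi := Real.pi_pos
  set β := α / (4 * Real.pi) with hβ
  have hβ1 : 1 < β := (one_lt_div (by positivity)).2 hα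
  have hexp : Tendsto (fun T : ℝ => 1 / 2 * (Real.pi * R ^ 2) * Real.exp ((β - 1) * T + -4 * β))
      atTop atTop :=
    (Real.tendsto_exp_atTop.comp (tendsto_atTop_add_const_right _ _
      (tendsto_id.const_mul_atTop (sub_pos.2 hβ1)))).const_mul_atTop (by positivity)
  obtain ⟨T, hTK, hT4, hTM⟩ := ((hexp.eventually_gt_atTop K).and
    ((eventually_ge_atTop 4).and (eventually_ge_atTop (4 + M ^ 2)))).exists
  have hT0 : 0 < T := by linarith
  set c := √(β / T)
  have hc : c ^ 2 = β / T := Real.sq_sqrt (by positivity)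
  have hc0 : 0 ≤ c := Real.sqrt_nonneg _
  set d := R ^ 2 * Real.exp (-T) with hd_def
  have hd : 0 < d := by positivity
  have hdR : d ≤ R ^ 2 :=
    mul_le_of_le_one_right (by positivity) (Real.exp_le_one_iff.2 (by linarith))
  have hlog : Real.log (R ^ 2) - Real.log d = T := by
    rw [hd_def, Real.log_mul (by positivity) (Real.exp_ne_zero _), Real.log_exp]
    ring
  set u := moserFun c R d x₀ with hu
  have husmooth : ContDiff ℝ (⊤ : ℕ∞) u := contDiff_moserFun hd x₀
  have husupp := support_moserFun_subset (c := c) hd hR x₀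
  refine ⟨u, husmooth, HasCompactSupport.of_support_subset_isCompact (isCompact_closedBall x₀ R)
    husupp, (closure_minimal husupp Metric.isClosed_closedBall).trans hball, ?_, ?_⟩
  · refine (integral_norm_gradient_moserFun_sq_le hd hR hdR x₀ Ω).trans_eq ?_
    rw [hlog, hc, hβ]
    field_simp
  have hFcont : Continuous fun x => (1 + g (u x)) * Real.exp ((u x) ^ 2) := by
    have := hg1.continuous
    have := husmooth.continuous
    fun_prop
  have hFint : IntegrableOn (fun x => (1 + g (u x)) * Real.exp ((u x) ^ 2)) Ω :=
    (hFcont.continuousOn.integrableOn_compact hΩb.isCompact_closure).mono_set subset_closure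
  have hsubset : Metric.ball x₀ √d ⊆ Ω := by
    refine (Metric.ball_subset_closedBall.trans (Metric.closedBall_subset_closedBall ?_)).trans hball
    exact Real.sqrt_le_left hR.le |>.2 hdR
  have hlower : ∀ x ∈ Metric.ball x₀ √d,
      1 / 2 * Real.exp (β * (T - 4)) ≤ (1 + g (u x)) * Real.exp ((u x) ^ 2) := by
    intro x hx
    rw [Metric.mem_ball, dist_eq_norm, Real.lt_sqrt (norm_nonneg _)] at hx
    have hux : c * (T - 2) ≤ u x := le_moserFun hc0 hd (by linarith) hlog hx.le
    have hcT : 0 ≤ c * (T - 2) := mul_nonneg hc0 (by linarith)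
    have hsq : β * (T - 4) ≤ (c * (T - 2)) ^ 2 := by
      rw [mul_pow, hc, div_mul_eq_mul_div β T, le_div_iff₀ hT0]
      nlinarith
    have husq : β * (T - 4) ≤ u x ^ 2 := hsq.trans (pow_le_pow_left₀ hcT hux 2)
    have hMu : M ≤ u x := by
      refine le_of_abs_le (abs_le_of_sq_le_sq ?_ (hcT.trans hux))
      nlinarith
    have hgu := hM _ hMu
    exact mul_le_mul (by linarith) (Real.exp_le_exp.2 husq) (Real.exp_pos _).le (by linarith)
  have hvol : (volume : Measure (EuclideanSpace ℝ (Fin 2))).real (Metric.ball x₀ √d)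
      = Real.pi * d := by
    rw [Measure.real, EuclideanSpace.volume_ball_fin_two, ← ENNReal.ofReal_pow (Real.sqrt_nonneg _),
      Real.sq_sqrt hd.le, ENNReal.toReal_mul, ENNReal.toReal_ofReal hd.le,
      ENNReal.toReal_ofReal hpi.le, mul_comm]
  calc K < 1 / 2 * (Real.pi * R ^ 2) * Real.exp ((β - 1) * T + -4 * β) := hTK
    _ = Real.pi * d * (1 / 2 * Real.exp (β * (T - 4))) := by
        rw [hd_def, show (β - 1) * T + -4 * β = -T + β * (T - 4) by ring, Real.exp_add]
        ring
    _ = ∫ _ in Metric.ball x₀ √d, 1 / 2 * Real.exp (β * (T - 4)) := by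
        rw [setIntegral_const, hvol, smul_eq_mul]
    _ ≤ ∫ x in Metric.ball x₀ √d, (1 + g (u x)) * Real.exp ((u x) ^ 2) :=
        setIntegral_mono_on (integrableOn_const measure_ball_lt_top.ne) (hFint.mono_set hsubset)
          measurableSet_ball hlower
    _ ≤ ∫ x in Ω, (1 + g (u x)) * Real.exp ((u x) ^ 2) :=
        setIntegral_mono_set hFint
          (Eventually.of_forall fun x =>
            mul_nonneg (by linarith [hgpos (u x)]) (Real.exp_pos _).le)
          hsubset.eventuallyLE
end

section
/- Left-continuity of the perturbed Moser–Trudinger suprema at the critical level: lim_{ε → 0⁺} C_{g,4π(1−ε)}(Ω) = C_{g,4π}(Ω); equivalently, the supremum over all 0 < α < 4π of C_{g,α}(Ω) equals C_{g,4π}(Ω). -/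
open MeasureTheory Filter

/-- The perturbed Moser–Trudinger supremum `C_{g,α}(Ω)`: the supremum of
`∫_Ω (1 + g(u))·exp(u²)` over smooth compactly supported `u` with support in `Ω`
and `∫_Ω |∇u|² ≤ α`. -/
noncomputable def moserTrudingerSup (g : ℝ → ℝ) (Ω : Set (EuclideanSpace ℝ (Fin 2)))
    (α : ℝ) : ℝ :=
  sSup {v : ℝ | ∃ u : EuclideanSpace ℝ (Fin 2) → ℝ,
    ContDiff ℝ (⊤ : ℕ∞) u ∧ HasCompactSupport u ∧ tsupport u ⊆ Ω ∧
    (∫ x in Ω, ‖gradient u x‖ ^ 2) ≤ α ∧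
    v = ∫ x in Ω, (1 + g (u x)) * Real.exp ((u x) ^ 2)}

namespace MoserTrudinger
open Set Real ENNReal

/-- The Euclidean plane. -/
abbrev Plane := EuclideanSpace ℝ (Fin 2)

/-- The unit vector at angle `θ`. -/
noncomputable def direction (θ : ℝ) : Plane := !₂[cos θ, sin θ]

lemma norm_direction (θ : ℝ) : ‖direction θ‖ = 1 := by
  simp [direction, EuclideanSpace.norm_eq]

lemma continuous_direction : Continuous direction := by
  unfold direction
  fun_prop

lemma lintegral_polar {f : Plane → ℝ≥0∞} (hf : Measurable f) :
    ∫⁻ z, f z = ∫⁻ θ in Ioo (-π) π, ∫⁻ r in Ioi (0 : ℝ),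
      ENNReal.ofReal r * f (r • direction θ) := by
  have hmp : MeasurePreserving ((MeasurableEquiv.toLp 2 (Fin 2 → ℝ)).symm.trans
      MeasurableEquiv.finTwoArrow) (volume : Measure Plane) (volume : Measure (ℝ × ℝ)) :=
    (EuclideanSpace.volume_preserving_symm_measurableEquiv_toLp (Fin 2)).trans
      (volume_preserving_finTwoArrow ℝ)
  have hdir : ∀ p : ℝ × ℝ, ((MeasurableEquiv.toLp 2 (Fin 2 → ℝ)).symm.trans
      MeasurableEquiv.finTwoArrow).symm (polarCoord.symm p) = p.1 • direction p.2 := by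
    intro p
    ext i
    fin_cases i <;> simp [direction, polarCoord, MeasurableEquiv.finTwoArrow]
  have hc : Continuous fun p : ℝ × ℝ => p.1 • direction p.2 :=
    continuous_fst.smul (continuous_direction.comp continuous_snd)
  rw [← hmp.symm.lintegral_comp_emb (MeasurableEquiv.measurableEmbedding _),
    ← lintegral_comp_polarCoord_symm]
  simp only [hdir, smul_eq_mul]
  have : polarCoord.target = Ioi (0 : ℝ) ×ˢ Ioo (-π) π := rfl
  rw [this, Measure.volume_eq_prod, setLIntegral_prod_symm]
  exact ((measurable_fst.ennreal_ofReal).mul (hf.comp hc.measurable)).aemeasurable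

lemma lintegral_radial {φ : ℝ → ℝ≥0∞} (hφ : Measurable φ) :
    ∫⁻ z : Plane, φ ‖z‖ = ENNReal.ofReal (2 * π) *
      ∫⁻ r in Ioi (0 : ℝ), ENNReal.ofReal r * φ r := by
  rw [lintegral_polar (f := fun z => φ ‖z‖) (hφ.comp measurable_norm)]
  have : ∀ θ : ℝ, ∫⁻ r in Ioi (0 : ℝ), ENNReal.ofReal r * φ ‖r • direction θ‖ =
      ∫⁻ r in Ioi (0 : ℝ), ENNReal.ofReal r * φ r := fun θ =>
    setLIntegral_congr_fun measurableSet_Ioi fun r hr => by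
      simp only [norm_smul, norm_direction, mul_one, Real.norm_of_nonneg (le_of_lt hr)]
  simp only [this, lintegral_const, Measure.restrict_apply MeasurableSet.univ, univ_inter,
    Real.volume_Ioo]
  rw [mul_comm]
  congr 2
  ring

lemma lintegral_ball_enorm_inv (δ : ℝ) :
    ∫⁻ z in Metric.ball (0 : Plane) δ, ‖z‖ₑ⁻¹ = ENNReal.ofReal (2 * π * δ) := by
  have h := lintegral_radial (φ := (Iio δ).indicator fun r => (ENNReal.ofReal r)⁻¹)
    ((by fun_prop : Measurable fun r : ℝ => (ENNReal.ofReal r)⁻¹).indicator measurableSet_Iio)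
  have h1 : ∀ z : Plane, (Iio δ).indicator (fun r => (ENNReal.ofReal r)⁻¹) ‖z‖ =
      (Metric.ball (0 : Plane) δ).indicator (fun z => ‖z‖ₑ⁻¹) z := fun z => by
    simp only [indicator, mem_Iio, mem_ball_zero_iff, ofReal_norm]
  simp only [h1] at h
  rw [lintegral_indicator Metric.isOpen_ball.measurableSet] at h
  rw [h, ENNReal.ofReal_mul (q := δ) (by positivity)]
  congr 1
  have : ∫⁻ r in Ioi (0 : ℝ), ENNReal.ofReal r *
      (Iio δ).indicator (fun r => (ENNReal.ofReal r)⁻¹) r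
      = ∫⁻ r in Ioi (0 : ℝ), (Iio δ).indicator 1 r := by
    refine setLIntegral_congr_fun measurableSet_Ioi fun r hr => ?_
    by_cases hr' : r ∈ Iio δ
    · simp only [indicator_of_mem hr', Pi.one_apply]
      exact ENNReal.mul_inv_cancel (by simpa using hr) ENNReal.ofReal_ne_top
    · simp [indicator_of_notMem hr']
  rw [this, lintegral_indicator_one measurableSet_Iio,
    Measure.restrict_apply measurableSet_Iio, inter_comm, Ioi_inter_Iio, Real.volume_Ioo, sub_zero]

lemma lintegral_annulus_enorm_inv_sq {δ R : ℝ} (hδ : 0 < δ) (hR : δ ≤ R) :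
    ∫⁻ z in Metric.ball (0 : Plane) R \ Metric.ball 0 δ, ‖z‖ₑ⁻¹ ^ 2 =
      ENNReal.ofReal (2 * π * log (R / δ)) := by
  have h := lintegral_radial (φ := (Ico δ R).indicator fun r => (ENNReal.ofReal r)⁻¹ ^ 2)
    ((by fun_prop : Measurable fun r : ℝ => (ENNReal.ofReal r)⁻¹ ^ 2).indicator measurableSet_Ico)
  have h1 : ∀ z : Plane, (Ico δ R).indicator (fun r => (ENNReal.ofReal r)⁻¹ ^ 2) ‖z‖ =
      (Metric.ball (0 : Plane) R \ Metric.ball 0 δ).indicator (fun z => ‖z‖ₑ⁻¹ ^ 2) z := fun z => by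
    simp only [indicator, mem_Ico, Set.mem_sdiff, mem_ball_zero_iff, ofReal_norm, not_lt, and_comm]
  simp only [h1] at h
  rw [lintegral_indicator (Metric.isOpen_ball.measurableSet.diff
    Metric.isOpen_ball.measurableSet)] at h
  rw [h, ENNReal.ofReal_mul (q := log (R / δ)) (by positivity)]
  congr 1
  have h2 : ∫⁻ r in Ioi (0 : ℝ), ENNReal.ofReal r *
      (Ico δ R).indicator (fun r => (ENNReal.ofReal r)⁻¹ ^ 2) r
      = ∫⁻ r in Ioi (0 : ℝ), (Ico δ R).indicator (fun r => ENNReal.ofReal r⁻¹) r := by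
    refine setLIntegral_congr_fun measurableSet_Ioi fun r hr => ?_
    by_cases hr' : r ∈ Ico δ R
    · simp only [indicator_of_mem hr']
      rw [sq, ← mul_assoc, ENNReal.mul_inv_cancel (by simpa using hr) ENNReal.ofReal_ne_top,
        one_mul, ENNReal.ofReal_inv_of_pos hr]
    · simp [indicator_of_notMem hr']
  have hsub : Ico δ R ∩ Ioi 0 = Ico δ R := inter_eq_left.2 fun r hr => hδ.trans_le hr.1
  have h0 : (0 : ℝ) ∉ uIcc δ R := by
    rw [uIcc_of_le hR]
    exact fun h => absurd h.1 (not_le.2 hδ)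
  rw [h2, lintegral_indicator measurableSet_Ico, Measure.restrict_restrict measurableSet_Ico, hsub,
    ← integral_inv h0, restrict_Ico_eq_restrict_Ioc, intervalIntegral.integral_of_le hR,
    ofReal_integral_eq_lintegral_ofReal]
  · exact (intervalIntegrable_iff_integrableOn_Ioc_of_le hR).1
      (intervalIntegral.intervalIntegrable_inv (fun x hx h => h0 (h ▸ hx)) continuousOn_id)
  · exact (ae_restrict_mem measurableSet_Ioc).mono fun r hr => inv_nonneg.2 (hδ.trans hr.1).le

lemma enorm_le_lintegral_fderiv_ray {u : Plane → ℝ} (hu : ContDiff ℝ 1 u)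
    (hc : HasCompactSupport u) (x : Plane) (θ : ℝ) :
    ‖u x‖ₑ ≤ ∫⁻ r in Ioi (0 : ℝ), ‖fderiv ℝ u (x + r • direction θ)‖ₑ := by
  set v : ℝ → ℝ := fun r => u (x + r • direction θ) with hv
  have hd : direction θ ≠ 0 := by
    rw [← norm_ne_zero_iff, norm_direction]; exact one_ne_zero
  have hemb : Topology.IsClosedEmbedding fun r : ℝ => x + r • direction θ :=
    (Homeomorph.addLeft x).isClosedEmbedding.comp (isClosedEmbedding_smul_left hd)
  have hline : ∀ r : ℝ, HasDerivAt (fun r : ℝ => x + r • direction θ) (direction θ) r := fun r => by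
    simpa using ((hasDerivAt_id r).smul_const (direction θ)).const_add x
  have hvd : ∀ r, deriv v r = fderiv ℝ u (x + r • direction θ) (direction θ) := fun r =>
    (((hu.differentiable one_ne_zero) _).hasFDerivAt.comp_hasDerivAt r (hline r)).deriv
  have hv1 : ContDiff ℝ 1 v := hu.comp (by fun_prop)
  have hint := (hc.comp_isClosedEmbedding hemb).integral_Ioi_deriv_eq hv1 0
  have hv0 : ‖u x‖ₑ = ‖∫ r in Ioi (0 : ℝ), deriv v r‖ₑ := by
    rw [show (∫ r in Ioi (0 : ℝ), deriv v r) = _ from hint]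
    simp [hv]
  rw [hv0]
  refine (enorm_integral_le_lintegral_enorm _).trans (lintegral_mono fun r => ?_)
  rw [hvd]
  refine (ContinuousLinearMap.le_opENorm _ _).trans ?_
  rw [← ofReal_norm (direction θ), norm_direction, ENNReal.ofReal_one, mul_one]

lemma enorm_le_lintegral_fderiv_mul_enorm_inv {u : Plane → ℝ} (hu : ContDiff ℝ 1 u)
    (hc : HasCompactSupport u) (x : Plane) :
    ENNReal.ofReal (2 * π) * ‖u x‖ₑ ≤ ∫⁻ z, ‖fderiv ℝ u (x + z)‖ₑ * ‖z‖ₑ⁻¹ := by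
  have hcont : Continuous (fderiv ℝ u) := hu.continuous_fderiv one_ne_zero
  rw [lintegral_polar (by fun_prop)]
  have h1 : ∀ θ : ℝ, ∫⁻ r in Ioi (0 : ℝ), ENNReal.ofReal r *
      (‖fderiv ℝ u (x + r • direction θ)‖ₑ * ‖r • direction θ‖ₑ⁻¹) =
      ∫⁻ r in Ioi (0 : ℝ), ‖fderiv ℝ u (x + r • direction θ)‖ₑ := fun θ =>
    setLIntegral_congr_fun measurableSet_Ioi fun r hr => by
      have : ‖r • direction θ‖ₑ = ENNReal.ofReal r := by
        rw [← ofReal_norm, norm_smul, norm_direction, mul_one, Real.norm_of_nonneg (le_of_lt hr)]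
      simp only [this]
      rw [mul_left_comm, ENNReal.mul_inv_cancel (by simpa using hr) ENNReal.ofReal_ne_top, mul_one]
  simp only [h1]
  calc ENNReal.ofReal (2 * π) * ‖u x‖ₑ = ∫⁻ _ in Ioo (-π) π, ‖u x‖ₑ := by
        rw [lintegral_const, Measure.restrict_apply MeasurableSet.univ, univ_inter,
          Real.volume_Ioo, mul_comm]
        congr 2
        ring
    _ ≤ _ := lintegral_mono fun θ => enorm_le_lintegral_fderiv_ray hu hc x θ

lemma sq_lintegral_mul_le {β : Type*} [MeasurableSpace β] (μ : Measure β) {f g : β → ℝ≥0∞}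
    (hf : AEMeasurable f μ) (hg : AEMeasurable g μ) :
    (∫⁻ a, f a * g a ∂μ) ^ 2 ≤ (∫⁻ a, f a ^ 2 ∂μ) * ∫⁻ a, g a ^ 2 ∂μ := by
  have hsq : ∀ c : ℝ≥0∞, (c ^ (1 / 2 : ℝ)) ^ 2 = c := fun c => by
    rw [← ENNReal.rpow_natCast, ← ENNReal.rpow_mul]
    norm_num
  have h := ENNReal.lintegral_mul_le_Lp_mul_Lq μ Real.HolderConjugate.two_two hf hg
  simp only [Pi.mul_apply, ENNReal.rpow_two] at h
  calc (∫⁻ a, f a * g a ∂μ) ^ 2 ≤ _ := pow_le_pow_left₀ zero_le h 2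
    _ = _ := by rw [mul_pow, hsq, hsq]

lemma lintegral_sq_lintegral_add_le (μ : Measure Plane) [SFinite μ] {f : Plane → ℝ≥0∞}
    (hf : Measurable f) :
    ∫⁻ x, (∫⁻ z, f (x + z) ∂μ) ^ 2 ≤ μ univ ^ 2 * ∫⁻ y, f y ^ 2 := by
  calc ∫⁻ x, (∫⁻ z, f (x + z) ∂μ) ^ 2
      ≤ ∫⁻ x, (∫⁻ z, f (x + z) ^ 2 ∂μ) * μ univ := lintegral_mono fun x => by
        have := sq_lintegral_mul_le μ (f := fun z => f (x + z)) (g := fun _ => 1)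
          (hf.comp (measurable_const_add x)).aemeasurable aemeasurable_const
        simpa using this
    _ = (∫⁻ z, ∫⁻ x, f (x + z) ^ 2 ∂volume ∂μ) * μ univ := by
        have hm : Measurable (Function.uncurry fun x z : Plane => f (x + z) ^ 2) :=
          (hf.comp measurable_add).pow_const 2
        rw [lintegral_mul_const _ hm.lintegral_prod_right, lintegral_lintegral_swap hm.aemeasurable]
    _ = μ univ ^ 2 * ∫⁻ y, f y ^ 2 := by
        simp only [lintegral_add_right_eq_self (fun y => f y ^ 2), lintegral_const]
        ring

lemma volume_superlevel_le {Ω : Set Plane} {R α η t : ℝ} (hR : ∀ x ∈ Ω, ∀ y ∈ Ω, dist x y < R)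
    (hR0 : 0 < R) (hα : 0 < α) (hη : 0 < η) (hη1 : η < 1) (ht : 0 < t)
    {u : Plane → ℝ} (hu : ContDiff ℝ 1 u) (hc : HasCompactSupport u) (hs : tsupport u ⊆ Ω)
    (hA : ∫⁻ x, ‖fderiv ℝ u x‖ₑ ^ 2 ≤ ENNReal.ofReal α) :
    volume {x | t ≤ |u x|} ≤
      ENNReal.ofReal (R ^ 2 * exp (-(4 * π * (1 - η) ^ 2 / α) * t ^ 2) * α / (η ^ 2 * t ^ 2)) := by
  have hcont : Continuous (fderiv ℝ u) := hu.continuous_fderiv one_ne_zero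
  set f : Plane → ℝ≥0∞ := fun x => ‖fderiv ℝ u x‖ₑ with hf
  have hfm : Measurable f := by fun_prop
  set L : ℝ := 2 * π * (1 - η) ^ 2 / α * t ^ 2 with hL
  have hL0 : 0 ≤ L := by positivity
  set δ : ℝ := R * exp (-L) with hδ
  have hδ0 : 0 < δ := by positivity
  have hδR : δ ≤ R := mul_le_of_le_one_right hR0.le (exp_le_one_iff.2 (by linarith))
  have hlog : log (R / δ) = L := by
    rw [hδ, div_mul_cancel_left₀ hR0.ne', ← exp_neg, neg_neg, log_exp]
  set B : Set Plane := Metric.ball 0 δ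
  have hB : MeasurableSet B := Metric.isOpen_ball.measurableSet
  have hkm : Measurable fun z : Plane => ‖z‖ₑ⁻¹ := by fun_prop
  set μ : Measure Plane := (volume.restrict B).withDensity fun z => ‖z‖ₑ⁻¹ with hμ
  have hμu : μ univ = ENNReal.ofReal (2 * π * δ) := by
    rw [hμ, withDensity_apply _ MeasurableSet.univ, Measure.restrict_univ,
      lintegral_ball_enorm_inv]
  have hN : ∀ x, ∫⁻ z, f (x + z) ∂μ = ∫⁻ z in B, f (x + z) * ‖z‖ₑ⁻¹ := fun x => by
    rw [hμ, lintegral_withDensity_eq_lintegral_mul _ hkm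
      (show Measurable fun z => f (x + z) from hfm.comp (measurable_const_add x))]
    exact lintegral_congr fun z => mul_comm _ _
  have hfar : ∀ x, ∫⁻ z in Metric.ball 0 R \ B, f (x + z) * ‖z‖ₑ⁻¹ ≤
      ENNReal.ofReal (2 * π * (1 - η) * t) := fun x => by
    have hcs := sq_lintegral_mul_le (volume.restrict (Metric.ball 0 R \ B))
      (f := fun z => f (x + z)) (g := fun z => ‖z‖ₑ⁻¹)
      (hfm.comp (measurable_const_add x)).aemeasurable hkm.aemeasurable
    have h1 : ∫⁻ z in Metric.ball 0 R \ B, f (x + z) ^ 2 ≤ ENNReal.ofReal α :=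
      (setLIntegral_le_lintegral _ _).trans
        ((lintegral_add_left_eq_self (fun y => f y ^ 2) x).trans_le hA)
    rw [lintegral_annulus_enorm_inv_sq hδ0 hδR, hlog] at hcs
    refine (ENNReal.pow_le_pow_left_iff two_ne_zero).1 (hcs.trans ?_)
    rw [← ENNReal.ofReal_pow (by have := sub_pos.2 hη1; positivity)]
    refine (mul_le_mul_left h1 _).trans ?_
    rw [← ENNReal.ofReal_mul hα.le]
    refine ENNReal.ofReal_le_ofReal (le_of_eq ?_)
    rw [hL]
    field_simp
  have hsub : {x | t ≤ |u x|} ⊆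
      {x | ENNReal.ofReal ((2 * π * η * t) ^ 2) ≤ (∫⁻ z, f (x + z) ∂μ) ^ 2} := by
    intro x hx
    have hx' : t ≤ |u x| := hx
    have hxΩ : x ∈ Ω := hs (subset_tsupport u (by
      intro h0
      rw [h0, abs_zero] at hx'
      linarith))
    have hrep := enorm_le_lintegral_fderiv_mul_enorm_inv hu hc x
    have hsupp : ∫⁻ z, f (x + z) * ‖z‖ₑ⁻¹ =
        ∫⁻ z in Metric.ball 0 R, f (x + z) * ‖z‖ₑ⁻¹ := by
      refine (setLIntegral_eq_of_support_subset ?_).symm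
      intro z hz
      have hz' : x + z ∈ Ω := by
        refine hs (support_fderiv_subset ℝ fun h0 => hz ?_)
        simp only [hf, h0, ← ofReal_norm, norm_zero, ENNReal.ofReal_zero, zero_mul]
      have := hR _ hz' _ hxΩ
      simpa using this
    have hsplit : ∫⁻ z in Metric.ball 0 R, f (x + z) * ‖z‖ₑ⁻¹ =
        (∫⁻ z in B, f (x + z) * ‖z‖ₑ⁻¹) + ∫⁻ z in Metric.ball 0 R \ B, f (x + z) * ‖z‖ₑ⁻¹ := by
      rw [← lintegral_inter_add_sdiff _ (Metric.ball 0 R) hB,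
        inter_eq_right.2 (Metric.ball_subset_ball hδR)]
    have hlow : ENNReal.ofReal (2 * π * t) ≤ ENNReal.ofReal (2 * π) * ‖u x‖ₑ := by
      rw [← ofReal_norm, ← ENNReal.ofReal_mul (by positivity)]
      refine ENNReal.ofReal_le_ofReal ?_
      rw [Real.norm_eq_abs]
      gcongr
    have hchain : ENNReal.ofReal (2 * π * η * t) + ENNReal.ofReal (2 * π * (1 - η) * t) ≤
        (∫⁻ z, f (x + z) ∂μ) + ENNReal.ofReal (2 * π * (1 - η) * t) := by
      rw [← ENNReal.ofReal_add (by positivity) (by have := sub_pos.2 hη1; positivity)]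
      calc ENNReal.ofReal (2 * π * η * t + 2 * π * (1 - η) * t) = ENNReal.ofReal (2 * π * t) := by
            congr 1; ring
        _ ≤ _ := hlow.trans hrep
        _ = _ := by rw [hsupp, hsplit, ← hN]
        _ ≤ _ := by gcongr; exact hfar x
    have := (ENNReal.add_le_add_iff_right ENNReal.ofReal_ne_top).1 hchain
    change ENNReal.ofReal ((2 * π * η * t) ^ 2) ≤ _
    rw [ENNReal.ofReal_pow (by positivity)]
    gcongr
  have hNm : Measurable fun x => (∫⁻ z, f (x + z) ∂μ) ^ 2 :=
    (Measurable.lintegral_prod_right (f := fun x z : Plane => f (x + z))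
      (hfm.comp measurable_add)).pow_const 2
  have hcheb := (mul_meas_ge_le_lintegral (μ := volume) hNm
    (ENNReal.ofReal ((2 * π * η * t) ^ 2))).trans (lintegral_sq_lintegral_add_le μ hfm)
  have hpos : 0 < (2 * π * η * t) ^ 2 := by positivity
  refine (measure_mono hsub).trans ?_
  have hfin : ENNReal.ofReal ((2 * π * η * t) ^ 2) * volume
      {x | ENNReal.ofReal ((2 * π * η * t) ^ 2) ≤ (∫⁻ z, f (x + z) ∂μ) ^ 2} ≤
      ENNReal.ofReal ((2 * π * δ) ^ 2 * α) := by
    refine hcheb.trans ?_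
    rw [hμu, ENNReal.ofReal_mul (q := α) (by positivity), ENNReal.ofReal_pow (by positivity)]
    gcongr
  rw [mul_comm, ← ENNReal.le_div_iff_mul_le (Or.inl (ENNReal.ofReal_pos.2 hpos).ne')
    (Or.inl ENNReal.ofReal_ne_top), ← ENNReal.ofReal_div_of_pos hpos] at hfin
  refine hfin.trans (ENNReal.ofReal_le_ofReal (le_of_eq ?_))
  have hexp : exp (-(4 * π * (1 - η) ^ 2 / α) * t ^ 2) = exp (-L) ^ 2 := by
    rw [← exp_nat_mul]
    congr 1
    rw [hL]
    push_cast
    ring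
  rw [hexp, hδ]
  field_simp

lemma exists_lintegral_exp_sq_le {Ω : Set Plane} (hΩb : Bornology.IsBounded Ω) {α : ℝ}
    (hα : 0 < α) (hα4 : α < 4 * π) :
    ∃ C : ℝ≥0∞, C ≠ ⊤ ∧ ∀ u : Plane → ℝ, ContDiff ℝ 1 u → HasCompactSupport u → tsupport u ⊆ Ω →
      ∫⁻ x, ‖fderiv ℝ u x‖ₑ ^ 2 ≤ ENNReal.ofReal α →
      ∫⁻ x in Ω, ENNReal.ofReal (exp (u x ^ 2)) ≤ C := by
  obtain ⟨R, hR0, hR⟩ : ∃ R : ℝ, 0 < R ∧ ∀ x ∈ Ω, ∀ y ∈ Ω, dist x y < R := by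
    obtain ⟨R, hR⟩ := Metric.isBounded_iff.1 hΩb
    exact ⟨|R| + 1, by positivity, fun x hx y hy =>
      ((hR hx hy).trans (le_abs_self R)).trans_lt (lt_add_one _)⟩
  obtain ⟨η, hη, hη1, hγ⟩ : ∃ η : ℝ, 0 < η ∧ η < 1 ∧ 1 < 4 * π * (1 - η) ^ 2 / α := by
    have hlim : Tendsto (fun η : ℝ => 4 * π * (1 - η) ^ 2 / α) (nhdsWithin 0 (Ioi 0))
        (nhds (4 * π * (1 - 0) ^ 2 / α)) :=
      ((by fun_prop : Continuous fun η : ℝ => 4 * π * (1 - η) ^ 2 / α).tendsto 0).mono_left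
        nhdsWithin_le_nhds
    have h1 := hlim.eventually (lt_mem_nhds (a := 1) (by
      rw [sub_zero, one_pow, mul_one, one_lt_div hα]; exact hα4))
    obtain ⟨η, h, h'⟩ := (h1.and (Ioo_mem_nhdsGT (zero_lt_one' ℝ))).exists
    exact ⟨η, h'.1, h'.2, h⟩
  set γ : ℝ := 4 * π * (1 - η) ^ 2 / α with hγd
  set V : ℝ := (volume Ω).toReal
  have hV : volume Ω = ENNReal.ofReal V := (ENNReal.ofReal_toReal hΩb.measure_lt_top.ne).symm
  set D : ℝ := V + R ^ 2 * α / η ^ 2 with hD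
  have hV0 : 0 ≤ V := ENNReal.toReal_nonneg
  have hD0 : 0 ≤ R ^ 2 * α / η ^ 2 := by positivity
  refine ⟨∑' n : ℕ, ENNReal.ofReal (exp (n + 1) * (D * exp (-γ * n))), ?_, ?_⟩
  · refine Summable.tsum_ofReal_ne_top ?_
    have hgeo := (summable_geometric_of_lt_one (exp_pos (1 - γ)).le
      (exp_lt_one_iff.2 (by linarith))).mul_left (exp 1 * D)
    refine hgeo.congr fun n => ?_
    rw [← exp_nat_mul, mul_assoc, mul_left_comm (exp (n + 1)), ← exp_add, mul_left_comm,
      ← exp_add]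
    congr 2
    ring
  · intro u hu hc hs hA
    have hmeas : ∀ n : ℕ, MeasurableSet {x | √n ≤ |u x|} := fun n =>
      (isClosed_le continuous_const hu.continuous.abs).measurableSet
    calc ∫⁻ x in Ω, ENNReal.ofReal (exp (u x ^ 2))
        ≤ ∫⁻ x in Ω, ∑' n : ℕ, {x | √n ≤ |u x|}.indicator
            (fun _ => ENNReal.ofReal (exp (n + 1))) x := lintegral_mono fun x => by
          refine le_trans ?_ (ENNReal.le_tsum ⌊u x ^ 2⌋₊)
          rw [indicator_of_mem]
          · exact ENNReal.ofReal_le_ofReal (exp_le_exp.2 (Nat.lt_floor_add_one _).le)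
          · exact Real.sqrt_le_iff.2 ⟨abs_nonneg _, by
              rw [sq_abs]; exact Nat.floor_le (sq_nonneg _)⟩
      _ = ∑' n : ℕ, ENNReal.ofReal (exp (n + 1)) * volume.restrict Ω {x | √n ≤ |u x|} := by
          rw [lintegral_tsum fun n => (measurable_const.indicator (hmeas n)).aemeasurable]
          simp only [lintegral_indicator_const (hmeas _)]
      _ ≤ _ := ENNReal.tsum_le_tsum fun n => by
          rw [ENNReal.ofReal_mul (exp_pos _).le]
          gcongr
          rcases Nat.eq_zero_or_pos n with rfl | hn
          · refine (measure_mono (subset_univ _)).trans ?_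
            rw [Measure.restrict_apply_univ, hV]
            refine ENNReal.ofReal_le_ofReal ?_
            simp only [Nat.cast_zero, mul_zero, exp_zero, mul_one]
            linarith
          · have hn1 : (1 : ℝ) ≤ n := by exact_mod_cast hn
            refine (Measure.restrict_apply_le _ _).trans
              ((volume_superlevel_le hR hR0 hα hη hη1 (Real.sqrt_pos.2 (by linarith)) hu hc hs
                hA).trans (ENNReal.ofReal_le_ofReal ?_))
            rw [← hγd, Real.sq_sqrt (by linarith)]
            calc R ^ 2 * exp (-γ * n) * α / (η ^ 2 * n)
                = R ^ 2 * α / η ^ 2 * exp (-γ * n) / n := by field_simp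
              _ ≤ R ^ 2 * α / η ^ 2 * exp (-γ * n) := div_le_self (by positivity) hn1
              _ ≤ _ := by gcongr; linarith

lemma norm_gradient (u : Plane → ℝ) (x : Plane) : ‖gradient u x‖ = ‖fderiv ℝ u x‖ :=
  LinearIsometryEquiv.norm_map _ _

lemma lintegral_fderiv_sq_le {Ω : Set Plane} {α : ℝ} {u : Plane → ℝ}
    (hu : ContDiff ℝ 1 u) (hc : HasCompactSupport u) (hs : tsupport u ⊆ Ω)
    (hA : ∫ x in Ω, ‖gradient u x‖ ^ 2 ≤ α) :
    ∫⁻ x, ‖fderiv ℝ u x‖ₑ ^ 2 ≤ ENNReal.ofReal α := by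
  have hcont : Continuous (fderiv ℝ u) := hu.continuous_fderiv one_ne_zero
  have hint : Integrable (fun x => ‖fderiv ℝ u x‖ ^ 2) :=
    (by fun_prop : Continuous fun x => ‖fderiv ℝ u x‖ ^ 2).integrable_of_hasCompactSupport
      ((hc.fderiv ℝ).norm.comp_left (g := fun t : ℝ => t ^ 2) (by simp))
  have hsupp : Function.support (fun x => ‖fderiv ℝ u x‖ₑ ^ 2) ⊆ Ω := by
    intro x hx
    refine hs (support_fderiv_subset ℝ fun h0 => hx ?_)
    simp [h0, ← ofReal_norm]
  rw [← setLIntegral_eq_of_support_subset hsupp]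
  simp only [norm_gradient] at hA
  refine le_trans (le_of_eq ?_) (ENNReal.ofReal_le_ofReal hA)
  rw [ofReal_integral_eq_lintegral_ofReal hint.integrableOn (ae_of_all _ fun x => sq_nonneg _)]
  exact lintegral_congr fun x => by rw [ENNReal.ofReal_pow (norm_nonneg _), ofReal_norm]

lemma exists_abs_le_of_even_of_tendsto_zero {g : ℝ → ℝ} (hg : Continuous g)
    (hgeven : ∀ t, g (-t) = g t) (hg0 : Tendsto g atTop (nhds 0)) : ∃ M, ∀ t, |g t| ≤ M := by
  have hg0' : Tendsto (fun t => |g t|) atTop (nhds 0) := by simpa using hg0.abs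
  obtain ⟨T, hT⟩ := eventually_atTop.1 (hg0'.eventually (gt_mem_nhds one_pos))
  obtain ⟨M, hM⟩ := (isCompact_Icc (a := 0) (b := T)).exists_bound_of_continuousOn hg.continuousOn
  refine ⟨max M 1, fun t => ?_⟩
  have hgabs : g t = g |t| := by
    rcases abs_choice t with h | h <;> rw [h]
    exact (hgeven t).symm
  rw [hgabs]
  rcases le_total T |t| with h | h
  · exact (hT _ h).le.trans (le_max_right _ _)
  · exact (hM _ ⟨abs_nonneg t, h⟩).trans (le_max_left _ _)

/-- The values of the functional over admissible functions of energy at most `α`. -/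
def admissibleValues (g : ℝ → ℝ) (Ω : Set Plane) (α : ℝ) : Set ℝ :=
  {v : ℝ | ∃ u : Plane → ℝ,
    ContDiff ℝ (⊤ : ℕ∞) u ∧ HasCompactSupport u ∧ tsupport u ⊆ Ω ∧
    (∫ x in Ω, ‖gradient u x‖ ^ 2) ≤ α ∧
    v = ∫ x in Ω, (1 + g (u x)) * Real.exp ((u x) ^ 2)}

lemma moserTrudingerSup_eq (g : ℝ → ℝ) (Ω : Set Plane) (α : ℝ) :
    moserTrudingerSup g Ω α = sSup (admissibleValues g Ω α) := rfl

lemma admissibleValues_mono (g : ℝ → ℝ) (Ω : Set Plane) : Monotone (admissibleValues g Ω) := by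
  rintro α β hαβ v ⟨u, h1, h2, h3, h4, h5⟩
  exact ⟨u, h1, h2, h3, h4.trans hαβ, h5⟩

lemma admissibleValues_nonempty (g : ℝ → ℝ) (Ω : Set Plane) {α : ℝ} (hα : 0 ≤ α) :
    (admissibleValues g Ω α).Nonempty := by
  refine ⟨_, fun _ => 0, contDiff_const, HasCompactSupport.zero, ?_, ?_, rfl⟩
  · simp [tsupport]
  · simpa [norm_gradient] using hα

lemma bddAbove_admissibleValues {g : ℝ → ℝ} (hg : Continuous g) (hgpos : ∀ t, -1 < g t) {M : ℝ}
    (hM : ∀ t, |g t| ≤ M) {Ω : Set Plane} (hΩb : Bornology.IsBounded Ω) {α : ℝ} (hα : 0 < α)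
    (hα4 : α < 4 * π) : BddAbove (admissibleValues g Ω α) := by
  obtain ⟨C, hC, hle⟩ := exists_lintegral_exp_sq_le hΩb hα hα4
  refine ⟨(ENNReal.ofReal (1 + M) * C).toReal, ?_⟩
  rintro v ⟨u, hu, hc, hs, hA, rfl⟩
  have hu1 : ContDiff ℝ 1 u := hu.of_le (by exact_mod_cast le_top)
  have hcont := hu.continuous
  rw [integral_eq_lintegral_of_nonneg_ae
    (ae_of_all _ fun x => mul_nonneg (by linarith [hgpos (u x)]) (exp_pos _).le)
    (by fun_prop : Continuous fun x => (1 + g (u x)) * exp (u x ^ 2)).aestronglyMeasurable]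
  refine ENNReal.toReal_mono (ENNReal.mul_ne_top ENNReal.ofReal_ne_top hC) ?_
  calc ∫⁻ x in Ω, ENNReal.ofReal ((1 + g (u x)) * exp (u x ^ 2))
      ≤ ∫⁻ x in Ω, ENNReal.ofReal (1 + M) * ENNReal.ofReal (exp (u x ^ 2)) :=
        lintegral_mono fun x => by
          rw [ENNReal.ofReal_mul (by linarith [hgpos (u x)])]
          gcongr
          exact (le_abs_self _).trans (hM _)
    _ = ENNReal.ofReal (1 + M) * ∫⁻ x in Ω, ENNReal.ofReal (exp (u x ^ 2)) :=
        lintegral_const_mul _ (by fun_prop)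
    _ ≤ _ := by
        gcongr
        exact hle u hu1 hc hs (lintegral_fderiv_sq_le hu1 hc hs hA)

lemma tendsto_integral_scaled {g : ℝ → ℝ} (hg : Continuous g) {Ω : Set Plane}
    (hΩb : Bornology.IsBounded Ω) {u : Plane → ℝ} (hu : Continuous u) (hc : HasCompactSupport u) :
    Tendsto (fun s : ℝ => ∫ x in Ω, (1 + g (s * u x)) * exp ((s * u x) ^ 2))
      (nhdsWithin 1 (Ioo 0 1)) (nhds (∫ x in Ω, (1 + g (u x)) * exp (u x ^ 2))) := by
  have : IsFiniteMeasure (volume.restrict Ω) := ⟨by simpa using hΩb.measure_lt_top⟩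
  obtain ⟨K, hK⟩ := hu.bounded_above_of_compact_support hc
  have hF : Continuous fun t : ℝ => (1 + g t) * exp (t ^ 2) := by fun_prop
  obtain ⟨C, hC⟩ := (isCompact_Icc (a := -K) (b := K)).exists_bound_of_continuousOn hF.continuousOn
  refine tendsto_integral_filter_of_dominated_convergence (fun _ => C)
    (Eventually.of_forall fun s => (hF.comp (continuous_const.mul hu)).aestronglyMeasurable)
    ?_ (integrable_const C) (ae_of_all _ fun x => ?_)
  · filter_upwards [self_mem_nhdsWithin] with s hs
    refine ae_of_all _ fun x => hC _ (abs_le.1 ?_)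
    rw [abs_mul, abs_of_pos hs.1]
    exact (mul_le_of_le_one_left (abs_nonneg _) hs.2.le).trans (hK x)
  · have h := ((hF.comp (continuous_mul_const (u x))).tendsto 1).mono_left
      (nhdsWithin_le_nhds (s := Ioo 0 1))
    simpa [Function.comp_def] using h

lemma scaled_mem_admissibleValues {g : ℝ → ℝ} {Ω : Set Plane} {α : ℝ} {u : Plane → ℝ}
    (hu : ContDiff ℝ (⊤ : ℕ∞) u) (hc : HasCompactSupport u) (hs : tsupport u ⊆ Ω)
    (hA : (∫ x in Ω, ‖gradient u x‖ ^ 2) ≤ α) (s : ℝ) :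
    (∫ x in Ω, (1 + g (s * u x)) * exp ((s * u x) ^ 2)) ∈ admissibleValues g Ω (s ^ 2 * α) := by
  refine ⟨fun x => s * u x, contDiff_const.mul hu, hc.mul_left, ?_, ?_, rfl⟩
  · exact (tsupport_mul_subset_right (f := fun _ => s)).trans hs
  · have hgrad : ∀ x, ‖gradient (fun x => s * u x) x‖ ^ 2 = s ^ 2 * ‖gradient u x‖ ^ 2 := fun x => by
      rw [norm_gradient, norm_gradient,
        fderiv_const_mul ((hu.differentiable (by simp)) x), norm_smul, mul_pow,
        Real.norm_eq_abs, sq_abs]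
    simp only [hgrad, integral_const_mul]
    gcongr

end MoserTrudinger

open MoserTrudinger

/-- Left-continuity of the perturbed Moser–Trudinger suprema at the critical level:
the supremum over all `0 < α < 4π` of `C_{g,α}(Ω)` equals `C_{g,4π}(Ω)`. -/
theorem moserTrudingerSup_left_continuous_at_critical
    (g : ℝ → ℝ) (hg1 : ContDiff ℝ 1 g) (hgeven : ∀ t, g (-t) = g t)
    (hgpos : ∀ t, g t > -1) (hg0 : Tendsto g atTop (nhds 0))
    (Ω : Set (EuclideanSpace ℝ (Fin 2))) (hΩo : IsOpen Ω)
    (hΩb : Bornology.IsBounded Ω) (hΩne : Ω.Nonempty) :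
    sSup {v : ℝ | ∃ α ∈ Set.Ioo (0 : ℝ) (4 * Real.pi), v = moserTrudingerSup g Ω α}
      = moserTrudingerSup g Ω (4 * Real.pi) := by
  have hπ : (0 : ℝ) < 4 * Real.pi := by positivity
  obtain ⟨M, hM⟩ := exists_abs_le_of_even_of_tendsto_zero hg1.continuous hgeven hg0
  set T : Set ℝ := {v : ℝ | ∃ α ∈ Set.Ioo (0 : ℝ) (4 * Real.pi), v = moserTrudingerSup g Ω α}
  have hTne : T.Nonempty := ⟨_, 2 * Real.pi, ⟨by positivity, by linarith⟩, rfl⟩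
  have hsub : ∀ α ∈ Set.Ioo (0 : ℝ) (4 * Real.pi), BddAbove (admissibleValues g Ω α) :=
    fun α hα => bddAbove_admissibleValues hg1.continuous hgpos hM hΩb hα.1 hα.2
  have hTle : BddAbove (admissibleValues g Ω (4 * Real.pi)) →
      ∀ v ∈ T, v ≤ sSup (admissibleValues g Ω (4 * Real.pi)) := by
    rintro hb v ⟨α, hα, rfl⟩
    exact csSup_le_csSup hb (admissibleValues_nonempty g Ω hα.1.le)
      (admissibleValues_mono g Ω hα.2.le)
  rw [moserTrudingerSup_eq]
  by_cases hTb : BddAbove T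
  · have hle : ∀ v ∈ admissibleValues g Ω (4 * Real.pi), v ≤ sSup T := by
      rintro v ⟨u, hu, hc, hs, hA, rfl⟩
      have hne : (nhdsWithin (1 : ℝ) (Set.Ioo 0 1)).NeBot := by
        rw [nhdsWithin_Ioo_eq_nhdsLT zero_lt_one]
        infer_instance
      refine le_of_tendsto (tendsto_integral_scaled hg1.continuous hΩb hu.continuous hc) ?_
      filter_upwards [self_mem_nhdsWithin] with s hs1
      have hα : s ^ 2 * (4 * Real.pi) ∈ Set.Ioo (0 : ℝ) (4 * Real.pi) :=
        ⟨mul_pos (pow_pos hs1.1 2) hπ,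
          mul_lt_of_lt_one_left hπ (pow_lt_one₀ hs1.1.le hs1.2 two_ne_zero)⟩
      exact (le_csSup (hsub _ hα) (scaled_mem_admissibleValues hu hc hs hA s)).trans
        (le_csSup hTb ⟨_, hα, rfl⟩)
    exact le_antisymm (csSup_le hTne (hTle ⟨_, hle⟩))
      (csSup_le (admissibleValues_nonempty g Ω hπ.le) hle)
  -- If the subcritical suprema are unbounded, so is the critical set, and both `sSup`s vanish.
  · rw [Real.sSup_of_not_bddAbove hTb, Real.sSup_of_not_bddAbove fun hb => hTb ⟨_, hTle hb⟩]
end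

section
/- Normalization of H at infinity: under hypothesis (H∞), one has lim_{γ → +∞} H(γ) = 1. -/
open Filter

/-- Mean value theorem on `[γ - 1 / γ, γ]`, bounding `deriv g s / (2 * s)` at an intermediate point. -/
lemma exists_abs_deriv_div_two_mul_le {g : ℝ → ℝ} (hg : Differentiable ℝ g) {γ : ℝ} (hγ : 2 ≤ γ) :
    ∃ t ∈ Set.Icc (0 : ℝ) 1, γ / 2 ≤ γ - t / γ ∧
      |deriv g (γ - t / γ) / (2 * (γ - t / γ))| ≤ |g γ - g (γ - 1 / γ)| := by
  have hγ0 : 0 < γ := by linarith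
  have hinv : 1 / γ ≤ γ / 2 := by
    rw [div_le_div_iff₀ hγ0 two_pos]
    nlinarith
  have hlt : γ - 1 / γ < γ := sub_lt_self _ (by positivity)
  obtain ⟨s, ⟨hs1, hs2⟩, hs⟩ :=
    exists_deriv_eq_slope g hlt hg.continuous.continuousOn hg.differentiableOn
  have hs0 : 0 < s := by linarith
  have hst : γ - γ * (γ - s) / γ = s := by field_simp; ring
  have hderiv : deriv g s = (g γ - g (γ - 1 / γ)) * γ := by
    rw [hs]; field_simp; ring
  refine ⟨γ * (γ - s), ⟨mul_nonneg hγ0.le (by linarith), ?_⟩, ?_, ?_⟩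
  · calc γ * (γ - s) ≤ γ * (1 / γ) := by gcongr; linarith
      _ = 1 := by field_simp
  · rw [hst]; linarith
  · rw [hst, hderiv, mul_div_assoc, abs_mul]
    refine mul_le_of_le_one_right (abs_nonneg _) ?_
    rw [abs_of_pos (by positivity), div_le_one (by positivity)]
    linarith

/-- Normalization of `H` at infinity: under hypothesis (H∞), `H(γ) → 1` as `γ → +∞`. -/
theorem H_tendsto_one_of_infty_behavior
    (g : ℝ → ℝ) (hg1 : ContDiff ℝ 1 g) (hgeven : ∀ t, g (-t) = g t)
    (hgpos : ∀ t, g t > -1) (hg0 : Tendsto g atTop (nhds 0))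
    (H : ℝ → ℝ) (hH : ∀ t, H t = 1 + g t + deriv g t / (2 * t))
    (δ₀ : ℝ) (hδ₀ : δ₀ ∈ Set.Ioo (0 : ℝ) 1)
    (A : ℝ → ℝ) (hA : Tendsto A atTop (nhds 0))
    (hHa : ∀ T > (0 : ℝ), Tendsto (fun γ : ℝ =>
      (⨆ t : Set.Icc (0 : ℝ) T, |H (γ - (t : ℝ) / γ) - H γ * (1 + A γ * (t : ℝ))|)
        / (|H γ| * (|A γ| + (γ ^ 4)⁻¹))) atTop (nhds 0))
    (hHb : ∃ C > (0 : ℝ), ∀ᶠ γ : ℝ in atTop, ∀ t ∈ Set.Icc (0 : ℝ) (γ ^ 2),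
      |H (γ - t / γ) - H γ| ≤ C * |H γ| * (|A γ| + (γ ^ 4)⁻¹) * Real.exp (δ₀ * t)) :
    Tendsto H atTop (nhds 1) := by
  obtain ⟨C, hC, hHb⟩ := hHb
  have hsmall : Tendsto (fun γ : ℝ => C * (|A γ| + (γ ^ 4)⁻¹) * Real.exp 1) atTop (nhds 0) := by
    have hpow : Tendsto (fun γ : ℝ => (γ ^ 4)⁻¹) atTop (nhds 0) :=
      tendsto_inv_atTop_zero.comp (tendsto_pow_atTop (by norm_num))
    simpa using ((hA.abs.add hpow).const_mul C).mul_const (Real.exp 1)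
  rw [Metric.tendsto_atTop]
  intro ε hε
  obtain ⟨η, hη0, hη1, hη2⟩ : ∃ η : ℝ, 0 < η ∧ η ≤ 1 / 2 ∧ 4 * η < ε :=
    ⟨min (1 / 2) (ε / 5), by positivity, min_le_left _ _, by linarith [min_le_right (1 / 2) (ε / 5)]⟩
  obtain ⟨N, hN⟩ := Metric.tendsto_atTop.mp hg0 (η / 3) (by positivity)
  simp only [Real.dist_eq, sub_zero] at hN
  rw [← eventually_atTop]
  filter_upwards [hHb, hsmall.eventually (gt_mem_nhds hη0), eventually_ge_atTop 2,
    eventually_ge_atTop (2 * N)] with γ hb hlt hγ hγN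
  obtain ⟨t, ⟨ht0, ht1⟩, hhalf, hdiv⟩ :=
    exists_abs_deriv_div_two_mul_le (hg1.differentiable one_ne_zero) hγ
  have hinv : 1 / γ ≤ γ / 2 := by
    rw [div_le_div_iff₀ (by linarith) two_pos]
    nlinarith
  have hgs := hN (γ - t / γ) (by linarith)
  have hgγ := hN γ (by linarith)
  have hga := hN (γ - 1 / γ) (by linarith)
  have hnear : |H (γ - t / γ) - H γ| ≤ η * |H γ| := by
    have hexp : Real.exp (δ₀ * t) ≤ Real.exp 1 :=
      Real.exp_le_exp.mpr (by nlinarith [hδ₀.1, hδ₀.2])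
    calc |H (γ - t / γ) - H γ|
        ≤ C * |H γ| * (|A γ| + (γ ^ 4)⁻¹) * Real.exp (δ₀ * t) := hb t ⟨ht0, by nlinarith⟩
      _ ≤ C * |H γ| * (|A γ| + (γ ^ 4)⁻¹) * Real.exp 1 := by gcongr
      _ = C * (|A γ| + (γ ^ 4)⁻¹) * Real.exp 1 * |H γ| := by ring
      _ ≤ η * |H γ| := by gcongr
  have hone : |H (γ - t / γ) - 1| ≤ η := by
    rw [hH, show ∀ a b : ℝ, 1 + a + b - 1 = a + b by intros; ring]
    linarith [abs_add_le (g (γ - t / γ)) (deriv g (γ - t / γ) / (2 * (γ - t / γ))),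
      abs_sub (g γ) (g (γ - 1 / γ))]
  have hdist : |H γ - 1| ≤ η * |H γ| + η := by
    rw [abs_sub_comm] at hnear
    linarith [abs_sub_le (H γ) (H (γ - t / γ)) 1]
  have hbound : |H γ| ≤ 3 := by
    have := abs_sub_abs_le_abs_sub (H γ) 1
    rw [abs_one] at this
    nlinarith [abs_nonneg (H γ)]
  rw [Real.dist_eq]
  nlinarith
end

section
/- Locally uniform expansion of 1 + g near infinity: under hypothesis (H∞), for every compact subset K of (0,∞), sup_{t∈K} |(1 + g(γ − t/γ)) − H(γ)(1 + A(γ)(t + 1/2))| / (|H(γ)|(|A(γ)| + γ⁻⁴)) → 0 as γ → +∞. -/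
open Filter

/-- If the derivative of `B` dominates that of `f` on `[a, b)`, then the increment of `f` over
`[a, b]` is at most that of `B`. -/
lemma abs_sub_le_sub_of_abs_deriv_le {f f' B B' : ℝ → ℝ} {a b : ℝ} (hab : a ≤ b)
    (hf : ContinuousOn f (Set.Icc a b)) (hf' : ∀ x ∈ Set.Ico a b, HasDerivAt f (f' x) x)
    (hB : ∀ x, HasDerivAt B (B' x) x) (bound : ∀ x ∈ Set.Ico a b, |f' x| ≤ B' x) :
    |f b - f a| ≤ B b - B a := by
  have key := image_norm_le_of_norm_deriv_right_le_deriv_boundary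
    (f := fun x => f x - f a) (f' := f') (B := fun x => B x - B a) (B' := B') (a := a) (b := b)
    (hf.sub continuousOn_const) (fun x hx => ((hf' x hx).sub_const _).hasDerivWithinAt)
    (by simp) (fun x => (hB x).sub_const _) (fun x hx => bound x hx)
  exact key (Set.right_mem_Icc.2 hab)

/-- Since `H` is `1 + g + deriv g / (2 t)`, the difference between `1 + g` and an affine function satisfies,
after multiplication by the integrating factor `exp (-2 s + s² / γ²)`, a first-order equation driven
by the difference between `H` and that affine function. -/
lemma hasDerivAt_one_add_g_sub_affine_mul_exp {g H : ℝ → ℝ} (hg1 : ContDiff ℝ 1 g)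
    (hH : ∀ t, H t = 1 + g t + deriv g t / (2 * t)) {γ s : ℝ} (hγ : 0 < γ) (hs : s < γ ^ 2)
    (c d : ℝ) :
    HasDerivAt
      (fun s => (1 + g (γ - s / γ) - (c + d * s)) * Real.exp (-2 * s + s ^ 2 / γ ^ 2))
      (-((2 * (1 - s / γ ^ 2) * (H (γ - s / γ) - (c + d * s)) + d)
        * Real.exp (-2 * s + s ^ 2 / γ ^ 2))) s := by
  have hr : 0 < γ - s / γ := by
    rw [sub_pos, div_lt_iff₀ hγ]
    nlinarith
  have hinner : HasDerivAt (fun s : ℝ => γ - s / γ) (-(1 / γ)) s :=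
    ((hasDerivAt_id s).div_const γ).const_sub γ
  have hgd : HasDerivAt (fun s => g (γ - s / γ)) (deriv g (γ - s / γ) * -(1 / γ)) s :=
    ((hg1.differentiable one_ne_zero) _).hasDerivAt.comp s hinner
  have haff : HasDerivAt (fun s : ℝ => c + d * s) d s := by
    simpa using ((hasDerivAt_id s).const_mul d).const_add c
  have hexponent : HasDerivAt (fun s : ℝ => -2 * s + s ^ 2 / γ ^ 2) (-2 + 2 * s / γ ^ 2) s :=
    (((hasDerivAt_id s).const_mul (-2)).add ((hasDerivAt_pow 2 s).div_const (γ ^ 2))).congr_deriv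
      (by simp)
  have hderiv : deriv g (γ - s / γ)
      = 2 * (γ - s / γ) * (H (γ - s / γ) - 1 - g (γ - s / γ)) := by
    rw [hH, add_sub_right_comm, add_sub_right_comm, add_sub_cancel_left, sub_self, zero_add,
      mul_div_cancel₀ _ (by positivity)]
  refine (((hgd.const_add 1).sub haff).mul hexponent.exp).congr_deriv ?_
  rw [hderiv]
  simp only [Pi.sub_apply]
  field_simp
  ring

lemma continuous_one_add_g_sub_affine_mul_exp {g : ℝ → ℝ} (hg : Continuous g) (γ c d : ℝ) :
    Continuous
      (fun s => (1 + g (γ - s / γ) - (c + d * s)) * Real.exp (-2 * s + s ^ 2 / γ ^ 2)) := by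
  fun_prop

lemma neg_two_mul_add_sq_div_sq_le_neg {γ s : ℝ} (hγ : 0 < γ) (h0 : 0 ≤ s) (hs : s ≤ γ ^ 2) :
    -2 * s + s ^ 2 / γ ^ 2 ≤ -s := by
  have : s ^ 2 / γ ^ 2 ≤ s := by
    rw [div_le_iff₀ (by positivity)]
    nlinarith
  linarith

/-- Exponential control of `H` on `[T, γ²]` controls `1 + g - H γ` at `T`. -/
lemma abs_one_add_g_sub_mul_exp_le {g H : ℝ → ℝ} (hg1 : ContDiff ℝ 1 g)
    (hH : ∀ t, H t = 1 + g t + deriv g t / (2 * t)) {γ T N δ : ℝ} (hγ : 0 < γ) (hT : 0 ≤ T)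
    (hTγ : T ≤ γ ^ 2) (hδ : δ < 1)
    (hN : ∀ t ∈ Set.Icc (0 : ℝ) (γ ^ 2), |H (γ - t / γ) - H γ| ≤ N * Real.exp (δ * t)) :
    |1 + g (γ - T / γ) - H γ| * Real.exp (-2 * T + T ^ 2 / γ ^ 2)
      ≤ |1 + g 0 - H γ| * Real.exp (-γ ^ 2) + 2 * N / (1 - δ) * Real.exp (-(1 - δ) * T) := by
  have hδ' : 0 < 1 - δ := by linarith
  have hN0 : 0 ≤ N := by
    have := (abs_nonneg _).trans (hN 0 ⟨le_rfl, by positivity⟩)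
    simpa using this
  have hB : ∀ x, HasDerivAt (fun s => -(2 * N / (1 - δ)) * Real.exp (-(1 - δ) * s))
      (2 * N * Real.exp (-(1 - δ) * x)) x := fun x => by
    refine ((((hasDerivAt_id x).const_mul (-(1 - δ))).exp).const_mul
      (-(2 * N / (1 - δ)))).congr_deriv ?_
    simp only [id]
    field_simp
  have key := abs_sub_le_sub_of_abs_deriv_le hTγ
    (continuous_one_add_g_sub_affine_mul_exp hg1.continuous γ (H γ) 0).continuousOn
    (fun x hx => hasDerivAt_one_add_g_sub_affine_mul_exp hg1 hH hγ hx.2 (H γ) 0) hB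
    (fun x hx => by
      have hx0 : 0 ≤ x := hT.trans hx.1
      have hw0 : 0 ≤ 1 - x / γ ^ 2 := by
        rw [sub_nonneg, div_le_one (by positivity)]
        exact hx.2.le
      have hw1 : 1 - x / γ ^ 2 ≤ 1 := by
        have : 0 ≤ x / γ ^ 2 := by positivity
        linarith
      rw [abs_neg, abs_mul, Real.abs_exp, zero_mul, add_zero, add_zero, abs_mul,
        abs_of_nonneg (mul_nonneg zero_le_two hw0)]
      calc 2 * (1 - x / γ ^ 2) * |H (γ - x / γ) - H γ| * Real.exp (-2 * x + x ^ 2 / γ ^ 2)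
          ≤ 2 * 1 * (N * Real.exp (δ * x)) * Real.exp (-x) := by
            gcongr
            · exact hN x ⟨hx0, hx.2.le⟩
            · exact neg_two_mul_add_sq_div_sq_le_neg hγ hx0 hx.2.le
        _ = 2 * N * Real.exp (-(1 - δ) * x) := by
            rw [show -(1 - δ) * x = δ * x + -x by ring, Real.exp_add]
            ring)
  have hend : γ - γ ^ 2 / γ = 0 := by
    field_simp
    ring
  have hexp : -2 * γ ^ 2 + (γ ^ 2) ^ 2 / γ ^ 2 = -γ ^ 2 := by
    field_simp
    ring
  simp only [zero_mul, add_zero, hend, hexp] at key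
  have hpos : 0 ≤ 2 * N / (1 - δ) * Real.exp (-(1 - δ) * γ ^ 2) := by positivity
  rw [abs_sub_comm] at key
  have htri := abs_sub_abs_le_abs_sub
    ((1 + g (γ - T / γ) - H γ) * Real.exp (-2 * T + T ^ 2 / γ ^ 2))
    ((1 + g 0 - H γ) * Real.exp (-γ ^ 2))
  rw [abs_mul, abs_mul, Real.abs_exp, Real.abs_exp] at htri
  linarith

/-- Control of the affine approximation of `H` on `[0, T]` propagates the error of the affine
approximation of `1 + g` from `T` down to `t`. -/
lemma abs_one_add_g_sub_affine_mul_exp_le {g H : ℝ → ℝ} (hg1 : ContDiff ℝ 1 g)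
    (hH : ∀ t, H t = 1 + g t + deriv g t / (2 * t)) {γ T t q α : ℝ} (hγ : 0 < γ) (ht : 0 ≤ t)
    (htT : t ≤ T) (hTγ : T ≤ γ ^ 2)
    (hq : ∀ s ∈ Set.Icc (0 : ℝ) T, |H (γ - s / γ) - H γ * (1 + α * s)| ≤ q) :
    |1 + g (γ - t / γ) - H γ * (1 + α * (t + 1 / 2))| * Real.exp (-2 * t + t ^ 2 / γ ^ 2)
      ≤ |1 + g (γ - T / γ) - H γ * (1 + α * (T + 1 / 2))| * Real.exp (-2 * T + T ^ 2 / γ ^ 2)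
        + (2 * q + T / γ ^ 2 * (|H γ| * |α|)) * T := by
  have hT : 0 ≤ T := ht.trans htT
  have hq0 : 0 ≤ q := (abs_nonneg _).trans (hq 0 ⟨le_rfl, hT⟩)
  set L := 2 * q + T / γ ^ 2 * (|H γ| * |α|) with hL
  have hL0 : 0 ≤ L := by positivity
  have key := abs_sub_le_sub_of_abs_deriv_le (B := fun s => L * s) (B' := fun _ => L) htT
    (continuous_one_add_g_sub_affine_mul_exp hg1.continuous γ
      (H γ * (1 + α / 2)) (H γ * α)).continuousOn
    (fun x hx => hasDerivAt_one_add_g_sub_affine_mul_exp hg1 hH hγ (hx.2.trans_le hTγ)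
      (H γ * (1 + α / 2)) (H γ * α))
    (fun x => by simpa using (hasDerivAt_id x).const_mul L)
    (fun x hx => by
      have hx0 : 0 ≤ x := ht.trans hx.1
      have hxγ : x ≤ γ ^ 2 := hx.2.le.trans hTγ
      have hw0 : 0 ≤ 1 - x / γ ^ 2 := by
        rw [sub_nonneg, div_le_one (by positivity)]
        exact hxγ
      have hw1 : 1 - x / γ ^ 2 ≤ 1 := by
        have : 0 ≤ x / γ ^ 2 := by positivity
        linarith
      have hexp : Real.exp (-2 * x + x ^ 2 / γ ^ 2) ≤ 1 := by
        rw [Real.exp_le_one_iff]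
        linarith [neg_two_mul_add_sq_div_sq_le_neg hγ hx0 hxγ]
      rw [abs_neg, abs_mul, Real.abs_exp]
      refine (mul_le_of_le_one_right (abs_nonneg _) hexp).trans ?_
      calc |2 * (1 - x / γ ^ 2) * (H (γ - x / γ) - (H γ * (1 + α / 2) + H γ * α * x)) + H γ * α|
          = |2 * (1 - x / γ ^ 2) * (H (γ - x / γ) - H γ * (1 + α * x))
              + x / γ ^ 2 * (H γ * α)| := by
            congr 1
            ring
        _ ≤ 2 * (1 - x / γ ^ 2) * |H (γ - x / γ) - H γ * (1 + α * x)|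
              + x / γ ^ 2 * (|H γ| * |α|) := by
            refine (abs_add_le _ _).trans_eq ?_
            rw [abs_mul, abs_of_nonneg (mul_nonneg zero_le_two hw0), abs_mul (x / γ ^ 2),
              abs_mul (H γ), abs_of_nonneg (show 0 ≤ x / γ ^ 2 by positivity)]
        _ ≤ 2 * 1 * q + T / γ ^ 2 * (|H γ| * |α|) := by
            gcongr
            · exact hq x ⟨hx0, hx.2.le⟩
            · exact hx.2.le
        _ = L := by rw [hL, mul_one])
  have haff : ∀ s, H γ * (1 + α / 2) + H γ * α * s = H γ * (1 + α * (s + 1 / 2)) :=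
    fun s => by ring
  simp only [haff] at key
  rw [abs_sub_comm] at key
  have htri := abs_sub_abs_le_abs_sub
    ((1 + g (γ - t / γ) - H γ * (1 + α * (t + 1 / 2))) * Real.exp (-2 * t + t ^ 2 / γ ^ 2))
    ((1 + g (γ - T / γ) - H γ * (1 + α * (T + 1 / 2))) * Real.exp (-2 * T + T ^ 2 / γ ^ 2))
  rw [abs_mul, abs_mul, Real.abs_exp, Real.abs_exp] at htri
  have := mul_nonneg hL0 ht
  linarith

lemma tendsto_pow_four_mul_exp_neg_sq :
    Tendsto (fun γ : ℝ => γ ^ 4 * Real.exp (-γ ^ 2)) atTop (nhds 0) := by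
  have h := (Real.tendsto_pow_mul_exp_neg_atTop_nhds_zero 2).comp
    (tendsto_pow_atTop (α := ℝ) (two_ne_zero))
  refine h.congr fun γ => ?_
  simp only [Function.comp]
  ring

/-- The decay of `g` and the exponential control of `H` keep `|H γ|` away from `0`. -/
lemma eventually_half_le_abs_of_exp_bound {g H A : ℝ → ℝ} (hg1 : ContDiff ℝ 1 g)
    (hg0 : Tendsto g atTop (nhds 0)) (hH : ∀ t, H t = 1 + g t + deriv g t / (2 * t)) {δ C : ℝ}
    (hδ : δ < 1) (hA : Tendsto A atTop (nhds 0))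
    (hb : ∀ᶠ γ : ℝ in atTop, ∀ t ∈ Set.Icc (0 : ℝ) (γ ^ 2),
      |H (γ - t / γ) - H γ| ≤ C * |H γ| * (|A γ| + (γ ^ 4)⁻¹) * Real.exp (δ * t)) :
    ∀ᶠ γ : ℝ in atTop, 1 / 2 ≤ |H γ| := by
  have hexp : Tendsto (fun γ : ℝ => Real.exp (-γ ^ 2)) atTop (nhds 0) :=
    Real.tendsto_exp_atBot.comp
      (tendsto_neg_atTop_atBot.comp (tendsto_pow_atTop (two_ne_zero)))
  have hrate : Tendsto (fun γ : ℝ => |A γ| + (γ ^ 4)⁻¹) atTop (nhds 0) := by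
    simpa using hA.abs.add (tendsto_pow_atTop (α := ℝ) (four_ne_zero)).inv_tendsto_atTop
  have hconst : Tendsto (fun γ : ℝ => |1 + g 0| * Real.exp (-γ ^ 2)) atTop (nhds 0) := by
    simpa using hexp.const_mul |1 + g 0|
  have hcoef : Tendsto (fun γ : ℝ => Real.exp (-γ ^ 2) + 2 * C / (1 - δ) * (|A γ| + (γ ^ 4)⁻¹))
      atTop (nhds 0) := by
    simpa using hexp.add (hrate.const_mul (2 * C / (1 - δ)))
  filter_upwards [hb, eventually_gt_atTop 0,
    hg0.eventually_const_lt (show (-1 / 8 : ℝ) < 0 by norm_num),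
    hconst.eventually_lt_const (show (0 : ℝ) < 1 / 8 by norm_num),
    hcoef.eventually_lt_const (show (0 : ℝ) < 1 / 4 by norm_num)] with γ hb hγ hg hc hk
  have key := abs_one_add_g_sub_mul_exp_le hg1 hH hγ le_rfl (sq_nonneg γ) hδ hb
  simp only [zero_div, sub_zero, mul_zero, add_zero, ne_eq, OfNat.ofNat_ne_zero, not_false_eq_true,
    zero_pow, Real.exp_zero, mul_one] at key
  have h1 : |1 + g 0 - H γ| * Real.exp (-γ ^ 2)
      ≤ |1 + g 0| * Real.exp (-γ ^ 2) + |H γ| * Real.exp (-γ ^ 2) := by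
    rw [← add_mul]
    gcongr
    exact abs_sub _ _
  have h2 : |H γ| * (Real.exp (-γ ^ 2) + 2 * C / (1 - δ) * (|A γ| + (γ ^ 4)⁻¹))
      ≤ |H γ| * (1 / 4) := by gcongr
  have h3 : 2 * (C * |H γ| * (|A γ| + (γ ^ 4)⁻¹)) / (1 - δ)
      = |H γ| * (2 * C / (1 - δ) * (|A γ| + (γ ^ 4)⁻¹)) := by ring
  have h4 := le_abs_self (1 + g γ - H γ)
  have h5 := le_abs_self (H γ)
  rw [mul_add] at h2
  linarith

/-- Locally uniform expansion of `1 + g` near infinity: under hypothesis (H∞), for every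
compact `K ⊆ (0,∞)`,
`sup_{t∈K} |(1 + g(γ − t/γ)) − H(γ)(1 + A(γ)(t + 1/2))| / (|H(γ)|(|A(γ)| + γ⁻⁴)) → 0`
as `γ → +∞`. -/
theorem one_add_g_expansion_at_infty
    (g : ℝ → ℝ) (hg1 : ContDiff ℝ 1 g) (hgeven : ∀ t, g (-t) = g t)
    (hgpos : ∀ t, g t > -1) (hg0 : Tendsto g atTop (nhds 0))
    (H : ℝ → ℝ) (hH : ∀ t, H t = 1 + g t + deriv g t / (2 * t))
    (δ₀ : ℝ) (hδ₀ : δ₀ ∈ Set.Ioo (0 : ℝ) 1)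
    (A : ℝ → ℝ) (hA : Tendsto A atTop (nhds 0))
    (hHa : ∀ T > (0 : ℝ), Tendsto (fun γ : ℝ =>
      (⨆ t : Set.Icc (0 : ℝ) T, |H (γ - (t : ℝ) / γ) - H γ * (1 + A γ * (t : ℝ))|)
        / (|H γ| * (|A γ| + (γ ^ 4)⁻¹))) atTop (nhds 0))
    (hHb : ∃ C > (0 : ℝ), ∀ᶠ γ : ℝ in atTop, ∀ t ∈ Set.Icc (0 : ℝ) (γ ^ 2),
      |H (γ - t / γ) - H γ| ≤ C * |H γ| * (|A γ| + (γ ^ 4)⁻¹) * Real.exp (δ₀ * t)) :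
    ∀ K : Set ℝ, IsCompact K → K ⊆ Set.Ioi 0 →
      Tendsto (fun γ : ℝ =>
        (⨆ t : K, |(1 + g (γ - (t : ℝ) / γ)) - H γ * (1 + A γ * ((t : ℝ) + 1 / 2))|)
          / (|H γ| * (|A γ| + (γ ^ 4)⁻¹))) atTop (nhds 0) := by
  intro K hK hKpos
  obtain ⟨C, hC, hb⟩ := hHb
  have hδ : 0 < 1 - δ₀ := by linarith [hδ₀.2]
  obtain ⟨a, ha⟩ := hK.bddAbove
  have hhalf := eventually_half_le_abs_of_exp_bound hg1 hg0 hH hδ₀.2 hA hb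
  have htail : Tendsto (fun T : ℝ => Real.exp (2 * a) *
      (2 * C / (1 - δ₀) * Real.exp (-(1 - δ₀) * T) + (T + 1 / 2) * Real.exp (-T)))
      atTop (nhds 0) := by
    have h1 : Tendsto (fun T : ℝ => Real.exp (-(1 - δ₀) * T)) atTop (nhds 0) :=
      Real.tendsto_exp_atBot.comp (tendsto_id.const_mul_atTop_of_neg (by linarith))
    have h2 : Tendsto (fun T : ℝ => T * Real.exp (-T)) atTop (nhds 0) := by
      simpa using Real.tendsto_pow_mul_exp_neg_atTop_nhds_zero 1
    have h3 := ((h1.const_mul (2 * C / (1 - δ₀))).add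
      (h2.add (Real.tendsto_exp_neg_atTop_nhds_zero.const_mul (1 / 2)))).const_mul
      (Real.exp (2 * a))
    simp only [mul_zero, add_zero] at h3
    exact h3.congr fun T => by ring
  refine tendsto_order.2 ⟨fun ε hε => ?_, fun ε hε => ?_⟩
  · filter_upwards with γ
    exact hε.trans_le (div_nonneg (Real.iSup_nonneg fun _ => abs_nonneg _) (by positivity))
  obtain ⟨T, hTε, hTa, hT0⟩ := ((htail.eventually_lt_const (half_pos hε)).and
    ((eventually_ge_atTop a).and (eventually_gt_atTop 0))).exists
  set q : ℝ → ℝ := fun γ =>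
    (⨆ t : Set.Icc (0 : ℝ) T, |H (γ - (t : ℝ) / γ) - H γ * (1 + A γ * (t : ℝ))|)
      / (|H γ| * (|A γ| + (γ ^ 4)⁻¹)) with hqdef
  have hq : Tendsto q atTop (nhds 0) := hHa T hT0
  have hrem : Tendsto (fun γ : ℝ => Real.exp (2 * a) *
      ((2 * |1 + g 0| + 1) * (γ ^ 4 * Real.exp (-γ ^ 2)) + (2 * q γ + T * (γ ^ 2)⁻¹) * T))
      atTop (nhds 0) := by
    have h := ((tendsto_pow_four_mul_exp_neg_sq.const_mul (2 * |1 + g 0| + 1)).add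
      (((hq.const_mul 2).add (((tendsto_pow_atTop (α := ℝ)
        (two_ne_zero)).inv_tendsto_atTop).const_mul T)).mul_const T)).const_mul (Real.exp (2 * a))
    simpa using h
  filter_upwards [hb, hhalf, eventually_gt_atTop 0, hrem.eventually_lt_const (half_pos hε),
    (tendsto_pow_atTop (α := ℝ) (two_ne_zero)).eventually_ge_atTop T] with γ hb hhalf hγ hrem hTγ
  set M := |H γ| * (|A γ| + (γ ^ 4)⁻¹) with hM
  have hM0 : 0 < M := by positivity
  have hAM : |H γ| * |A γ| ≤ M := by
    rw [hM]
    gcongr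
    exact le_add_of_nonneg_right (by positivity)
  have hbM : ∀ t ∈ Set.Icc (0 : ℝ) (γ ^ 2),
      |H (γ - t / γ) - H γ| ≤ C * M * Real.exp (δ₀ * t) := fun t ht =>
    (hb t ht).trans_eq (by rw [hM]; ring)
  have hqM : ∀ s ∈ Set.Icc (0 : ℝ) T,
      |H (γ - s / γ) - H γ * (1 + A γ * s)| ≤ q γ * M := by
    intro s hs
    have hbdd : BddAbove (Set.range fun t : Set.Icc (0 : ℝ) T =>
        |H (γ - (t : ℝ) / γ) - H γ * (1 + A γ * (t : ℝ))|) := by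
      refine ⟨C * M * Real.exp (δ₀ * T) + |H γ| * |A γ| * T, ?_⟩
      rintro _ ⟨⟨t, ht⟩, rfl⟩
      calc |H (γ - t / γ) - H γ * (1 + A γ * t)|
          = |(H (γ - t / γ) - H γ) - H γ * A γ * t| := by
            congr 1
            ring
        _ ≤ |H (γ - t / γ) - H γ| + |H γ| * |A γ| * t := by
            refine (abs_sub _ _).trans_eq ?_
            rw [abs_mul (H γ * A γ), abs_mul (H γ), abs_of_nonneg ht.1]
        _ ≤ C * M * Real.exp (δ₀ * t) + |H γ| * |A γ| * t := by
            gcongr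
            exact hbM t ⟨ht.1, ht.2.trans hTγ⟩
        _ ≤ C * M * Real.exp (δ₀ * T) + |H γ| * |A γ| * T := by
            have := hδ₀.1
            have := ht.2
            gcongr
    have h := le_ciSup hbdd ⟨s, hs⟩
    rwa [hqdef, div_mul_cancel₀ _ hM0.ne']
  have hboundary : |1 + g 0 - H γ| * Real.exp (-γ ^ 2)
      ≤ (2 * |1 + g 0| + 1) * (γ ^ 4 * Real.exp (-γ ^ 2)) * M := by
    have h1 : |1 + g 0 - H γ| ≤ (2 * |1 + g 0| + 1) * |H γ| := by
      have := abs_sub (1 + g 0) (H γ)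
      nlinarith [abs_nonneg (1 + g 0)]
    have h2 : |H γ| ≤ γ ^ 4 * M := by
      have : γ ^ 4 * (|H γ| * (γ ^ 4)⁻¹) ≤ γ ^ 4 * M := by
        rw [hM]
        gcongr
        exact le_add_of_nonneg_left (abs_nonneg _)
      refine le_trans (le_of_eq ?_) this
      field_simp
    calc |1 + g 0 - H γ| * Real.exp (-γ ^ 2)
        ≤ (2 * |1 + g 0| + 1) * (γ ^ 4 * M) * Real.exp (-γ ^ 2) := by
          gcongr
          exact h1.trans (by gcongr)
      _ = (2 * |1 + g 0| + 1) * (γ ^ 4 * Real.exp (-γ ^ 2)) * M := by ring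
  have hfar := abs_one_add_g_sub_mul_exp_le hg1 hH hγ hT0.le hTγ hδ₀.2 hbM
  have hfarAffine : |1 + g (γ - T / γ) - H γ * (1 + A γ * (T + 1 / 2))|
        * Real.exp (-2 * T + T ^ 2 / γ ^ 2)
      ≤ |1 + g (γ - T / γ) - H γ| * Real.exp (-2 * T + T ^ 2 / γ ^ 2)
        + M * ((T + 1 / 2) * Real.exp (-T)) := by
    calc |1 + g (γ - T / γ) - H γ * (1 + A γ * (T + 1 / 2))|
          * Real.exp (-2 * T + T ^ 2 / γ ^ 2)
        ≤ (|1 + g (γ - T / γ) - H γ| + |H γ| * |A γ| * (T + 1 / 2))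
          * Real.exp (-2 * T + T ^ 2 / γ ^ 2) := by
          gcongr
          rw [show 1 + g (γ - T / γ) - H γ * (1 + A γ * (T + 1 / 2))
            = (1 + g (γ - T / γ) - H γ) - H γ * A γ * (T + 1 / 2) by ring]
          refine (abs_sub _ _).trans_eq ?_
          rw [abs_mul (H γ * A γ), abs_mul (H γ), abs_of_nonneg (show 0 ≤ T + 1 / 2 by positivity)]
      _ = |1 + g (γ - T / γ) - H γ| * Real.exp (-2 * T + T ^ 2 / γ ^ 2)
          + |H γ| * |A γ| * ((T + 1 / 2) * Real.exp (-2 * T + T ^ 2 / γ ^ 2)) := by ring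
      _ ≤ _ := by
          gcongr
          exact neg_two_mul_add_sq_div_sq_le_neg hγ hT0.le hTγ
  set S := 2 * C / (1 - δ₀) * Real.exp (-(1 - δ₀) * T) + (T + 1 / 2) * Real.exp (-T) with hS
  set R := (2 * |1 + g 0| + 1) * (γ ^ 4 * Real.exp (-γ ^ 2))
    + (2 * q γ + T * (γ ^ 2)⁻¹) * T with hR
  have hpoint : ∀ t ∈ K, |1 + g (γ - t / γ) - H γ * (1 + A γ * (t + 1 / 2))|
      ≤ Real.exp (2 * a) * (S + R) * M := by
    intro t htK
    have ht0 : 0 < t := hKpos htK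
    have hta : t ≤ a := ha htK
    have hnear := abs_one_add_g_sub_affine_mul_exp_le hg1 hH hγ ht0.le (hta.trans hTa) hTγ hqM
    have hdrift : T / γ ^ 2 * (|H γ| * |A γ|) * T ≤ T * (γ ^ 2)⁻¹ * M * T := by
      rw [div_eq_mul_inv]
      gcongr
    have hsum : |1 + g (γ - t / γ) - H γ * (1 + A γ * (t + 1 / 2))|
        * Real.exp (-2 * t + t ^ 2 / γ ^ 2) ≤ (S + R) * M := by
      have h1 : 2 * (C * M) / (1 - δ₀) * Real.exp (-(1 - δ₀) * T)
          = 2 * C / (1 - δ₀) * Real.exp (-(1 - δ₀) * T) * M := by ring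
      rw [hS, hR]
      linarith
    have hexp : 1 ≤ Real.exp (2 * a) * Real.exp (-2 * t + t ^ 2 / γ ^ 2) := by
      rw [← Real.exp_add, Real.one_le_exp_iff]
      have : 0 ≤ t ^ 2 / γ ^ 2 := by positivity
      linarith
    calc |1 + g (γ - t / γ) - H γ * (1 + A γ * (t + 1 / 2))|
        ≤ |1 + g (γ - t / γ) - H γ * (1 + A γ * (t + 1 / 2))|
          * (Real.exp (2 * a) * Real.exp (-2 * t + t ^ 2 / γ ^ 2)) :=
          le_mul_of_one_le_right (abs_nonneg _) hexp
      _ = Real.exp (2 * a) * (|1 + g (γ - t / γ) - H γ * (1 + A γ * (t + 1 / 2))|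
          * Real.exp (-2 * t + t ^ 2 / γ ^ 2)) := by ring
      _ ≤ Real.exp (2 * a) * ((S + R) * M) := by gcongr
      _ = Real.exp (2 * a) * (S + R) * M := by ring
  have hq0 : 0 ≤ q γ := div_nonneg (Real.iSup_nonneg fun _ => abs_nonneg _) hM0.le
  have hSR : 0 ≤ Real.exp (2 * a) * (S + R) := by positivity
  have hsup := Real.iSup_le (fun t : K => hpoint t t.2) (mul_nonneg hSR hM0.le)
  calc _ ≤ Real.exp (2 * a) * (S + R) := (div_le_iff₀ hM0).2 hsup
    _ < ε := by
      rw [mul_add]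
      linarith
end

section
/- Global exponential bound for 1 + g near infinity: under hypothesis (H∞), there exists a constant C′ > 0 such that for all sufficiently large γ and all t ∈ [0,γ], |(1 + g(γ − t/γ)) − H(γ)| ≤ C′·|H(γ)|·(|A(γ)| + γ⁻⁴)·exp(δ₀ t). -/
open Filter

/-- Gronwall-type estimate: `(1 + g - h) e^{s²}` has derivative `2 s (H - h) e^{s²}`, so an
exponential bound on `H - h` over `[0, γ]` yields one on `1 + g - h`. -/
lemma abs_one_add_sub_le_of_abs_sub_le_exp {g H : ℝ → ℝ} (hg : Differentiable ℝ g)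
    (hgeven : ∀ t, g (-t) = g t) (hH : ∀ t, H t = 1 + g t + deriv g t / (2 * t))
    {δ γ c K h r : ℝ} (hγ : 0 < γ) (hc : 0 < c) (hK : 0 ≤ K) (hr0 : 0 ≤ r) (hrγ : r ≤ γ)
    (hcr : c * γ ≤ r - δ * γ)
    (hb : ∀ t ∈ Set.Icc (0 : ℝ) (γ ^ 2), |H (γ - t / γ) - h| ≤ K * Real.exp (δ * t)) :
    |1 + g r - h| ≤
      |1 + g 0 - h| * Real.exp (-r ^ 2) + 2 * K / c * Real.exp (δ * (γ * (γ - r))) := by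
  have hderiv0 : deriv g 0 = 0 := by
    have h1 := deriv_comp_neg g 0
    simp only [hgeven, neg_zero] at h1
    linarith
  have hD : ∀ s, HasDerivAt (fun s => (1 + g s - h) * Real.exp (s ^ 2))
      (2 * s * (H s - h) * Real.exp (s ^ 2)) s := by
    intro s
    have h1 : HasDerivAt (fun s => 1 + g s - h) (deriv g s) s :=
      ((hg s).hasDerivAt.const_add 1).sub_const h
    have h2 : HasDerivAt (fun s : ℝ => Real.exp (s ^ 2)) (Real.exp (s ^ 2) * (2 * s)) s := by
      simpa using (hasDerivAt_pow 2 s).exp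
    refine (h1.mul h2).congr_deriv ?_
    rw [hH]
    rcases eq_or_ne s 0 with rfl | hs
    · simp [hderiv0]
    · field_simp
      ring
  set E : ℝ := r ^ 2 + δ * (γ * (γ - r)) with hE
  have hB : ∀ s, HasDerivAt
      (fun s => |1 + g 0 - h| + 2 * K / c * Real.exp (E - (r - s) * (c * γ)))
      (2 * K * γ * Real.exp (E - (r - s) * (c * γ))) s := by
    intro s
    have h1 : HasDerivAt (fun s => E - (r - s) * (c * γ)) (c * γ) s := by
      simpa using (((hasDerivAt_id s).const_sub r).mul_const (c * γ)).const_sub E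
    refine ((h1.exp.const_mul (2 * K / c)).const_add |1 + g 0 - h|).congr_deriv ?_
    field_simp
  have key := image_norm_le_of_norm_deriv_right_le_deriv_boundary
    (a := 0) (b := r) (fun s _ => (hD s).continuousAt.continuousWithinAt)
    (fun s _ => (hD s).hasDerivWithinAt)
    (by
      simp only [Real.norm_eq_abs, abs_mul, Real.abs_exp]
      have : 0 ≤ 2 * K / c * Real.exp (E - (r - 0) * (c * γ)) := by positivity
      simpa using this)
    hB
    (by
      rintro s ⟨hs0, hsr⟩
      have hu : γ * (γ - s) ∈ Set.Icc (0 : ℝ) (γ ^ 2) :=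
        ⟨by nlinarith, by nlinarith⟩
      have h1 := hb _ hu
      rw [mul_div_cancel_left₀ _ hγ.ne', sub_sub_cancel] at h1
      rw [Real.norm_eq_abs, abs_mul, abs_mul, Real.abs_exp, abs_of_nonneg (by positivity)]
      have h2 : δ * (γ * (γ - s)) + s ^ 2 ≤ E - (r - s) * (c * γ) := by
        have : 0 ≤ (r - s) * (r + s - δ * γ - c * γ) :=
          mul_nonneg (by linarith) (by linarith)
        rw [hE]
        linarith
      calc 2 * s * |H s - h| * Real.exp (s ^ 2)
          ≤ 2 * γ * (K * Real.exp (δ * (γ * (γ - s)))) * Real.exp (s ^ 2) := by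
            gcongr
            linarith
        _ = 2 * K * γ * Real.exp (δ * (γ * (γ - s)) + s ^ 2) := by
            rw [Real.exp_add]; ring
        _ ≤ _ := by gcongr)
    (Set.right_mem_Icc.2 hr0)
  simp only [Real.norm_eq_abs, abs_mul, Real.abs_exp, sub_self, zero_mul, sub_zero] at key
  rw [hE, Real.exp_add] at key
  have hexp : Real.exp (r ^ 2) * Real.exp (-r ^ 2) = 1 := by
    rw [← Real.exp_add]; simp
  calc |1 + g r - h| = |1 + g r - h| * Real.exp (r ^ 2) * Real.exp (-r ^ 2) := by
        rw [mul_assoc, hexp, mul_one]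
    _ ≤ (|1 + g 0 - h| + 2 * K / c * (Real.exp (r ^ 2) * Real.exp (δ * (γ * (γ - r)))))
          * Real.exp (-r ^ 2) := by gcongr
    _ = _ := by linear_combination (2 * K / c * Real.exp (δ * (γ * (γ - r)))) * hexp

/-- Global exponential bound for `1 + g` near infinity: under hypothesis (H∞), there is
`C′ > 0` such that for all sufficiently large `γ` and all `t ∈ [0,γ]`,
`|(1 + g(γ − t/γ)) − H(γ)| ≤ C′·|H(γ)|·(|A(γ)| + γ⁻⁴)·exp(δ₀ t)`. -/
theorem one_add_g_global_bound_at_infty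
    (g : ℝ → ℝ) (hg1 : ContDiff ℝ 1 g) (hgeven : ∀ t, g (-t) = g t)
    (hgpos : ∀ t, g t > -1) (hg0 : Tendsto g atTop (nhds 0))
    (H : ℝ → ℝ) (hH : ∀ t, H t = 1 + g t + deriv g t / (2 * t))
    (δ₀ : ℝ) (hδ₀ : δ₀ ∈ Set.Ioo (0 : ℝ) 1)
    (A : ℝ → ℝ) (hA : Tendsto A atTop (nhds 0))
    (hHa : ∀ T > (0 : ℝ), Tendsto (fun γ : ℝ =>
      (⨆ t : Set.Icc (0 : ℝ) T, |H (γ - (t : ℝ) / γ) - H γ * (1 + A γ * (t : ℝ))|)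
        / (|H γ| * (|A γ| + (γ ^ 4)⁻¹))) atTop (nhds 0))
    (hHb : ∃ C > (0 : ℝ), ∀ᶠ γ : ℝ in atTop, ∀ t ∈ Set.Icc (0 : ℝ) (γ ^ 2),
      |H (γ - t / γ) - H γ| ≤ C * |H γ| * (|A γ| + (γ ^ 4)⁻¹) * Real.exp (δ₀ * t)) :
    ∃ C' > (0 : ℝ), ∀ᶠ γ : ℝ in atTop, ∀ t ∈ Set.Icc (0 : ℝ) γ,
      |(1 + g (γ - t / γ)) - H γ| ≤ C' * |H γ| * (|A γ| + (γ ^ 4)⁻¹) * Real.exp (δ₀ * t) := by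
  obtain ⟨C, hC, hCb⟩ := hHb
  obtain ⟨hδ0, hδ1⟩ := hδ₀
  obtain ⟨c, hcdef⟩ : ∃ c, c = (1 - δ₀) / 2 := ⟨_, rfl⟩
  have hc : 0 < c := by linarith
  obtain ⟨M, hM⟩ : ∃ M, M = 1 + g 0 := ⟨_, rfl⟩
  have hMpos : 0 < M := by linarith [hgpos 0]
  obtain ⟨Q, hQ⟩ : ∃ Q, Q = 2 + 4 * C / c := ⟨_, rfl⟩
  have hQpos : 0 < Q := by rw [hQ]; positivity
  have hpow := Real.tendsto_pow_mul_exp_neg_atTop_nhds_zero 4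
  refine ⟨4 * M * Q + 1 + 2 * C / c, by positivity, ?_⟩
  filter_upwards [hCb, eventually_ge_atTop (1 / c), eventually_ge_atTop 3,
    hA.abs.eventually (ge_mem_nhds (show |(0 : ℝ)| < 1 by simp)),
    hg0.eventually (le_mem_nhds (show (-(1 / 2) : ℝ) < 0 by norm_num)),
    hpow.eventually (ge_mem_nhds (show (0 : ℝ) < 1 by norm_num)),
    hpow.eventually (ge_mem_nhds (show (0 : ℝ) < 1 / (4 * M) by positivity))]
    with γ hb hγc hγ3 hA1 hg2 hp1 hpM t ht
  have hγ : 0 < γ := by linarith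
  have hcγ : 1 ≤ c * γ := by rwa [div_le_iff₀' hc] at hγc
  have hδγ : δ₀ * γ = γ - 2 * (c * γ) := by rw [hcdef]; ring
  have hγ4 : 1 ≤ γ ^ 4 := one_le_pow₀ (by linarith)
  set ε : ℝ := |A γ| + (γ ^ 4)⁻¹ with hε
  have hε0 : 0 ≤ ε := by positivity
  have hε2 : ε ≤ 2 := by linarith [inv_le_one_of_one_le₀ hγ4]
  have hK : 0 ≤ C * |H γ| * ε := by positivity
  have hM0 : |1 + g 0 - H γ| ≤ M + |H γ| := by
    rw [← hM]
    exact (abs_sub _ _).trans_eq (by rw [abs_of_pos hMpos])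
  have hexpM : M * Real.exp (-γ) ≤ 1 / 4 := by
    have h1 : Real.exp (-γ) ≤ 1 / (4 * M) :=
      (le_mul_of_one_le_left (Real.exp_pos _).le hγ4).trans hpM
    calc M * Real.exp (-γ) ≤ M * (1 / (4 * M)) := by gcongr
      _ = 1 / 4 := by field_simp
  have hexp4 : Real.exp (-γ) ≤ (γ ^ 4)⁻¹ := by
    rwa [← one_div, le_div_iff₀' (by positivity)]
  have hlow : 1 ≤ 4 * Q * |H γ| := by
    have h1 := abs_one_add_sub_le_of_abs_sub_le_exp (hg1.differentiable one_ne_zero) hgeven hH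
      hγ hc hK hγ.le le_rfl (by linarith) hb
    simp only [sub_self, mul_zero, Real.exp_zero, mul_one] at h1
    have h2 : Real.exp (-γ ^ 2) ≤ Real.exp (-γ) := Real.exp_le_exp.2 (by nlinarith)
    have h3 : Real.exp (-γ) ≤ 1 := Real.exp_le_one_iff.2 (by linarith)
    have h4 : |1 + g 0 - H γ| * Real.exp (-γ ^ 2) ≤ 1 / 4 + |H γ| :=
      calc _ ≤ (M + |H γ|) * Real.exp (-γ) := by gcongr
        _ = M * Real.exp (-γ) + |H γ| * Real.exp (-γ) := by ring
        _ ≤ 1 / 4 + |H γ| * 1 := by gcongr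
        _ = _ := by ring
    have h5 : 2 * (C * |H γ| * ε) / c ≤ 2 * (C * |H γ| * 2) / c := by gcongr
    have h6 : 2 * (C * |H γ| * 2) / c = 4 * C / c * |H γ| := by ring
    have h7 : 1 + g γ ≤ |1 + g γ - H γ| + |H γ| := by
      linarith [le_abs_self (1 + g γ - H γ), le_abs_self (H γ)]
    rw [hQ]
    linarith
  obtain ⟨ht0, htγ⟩ := ht
  have htγ' : t / γ ≤ 1 := (div_le_one hγ).2 htγ
  have htγ0 : 0 ≤ t / γ := by positivity
  have h1 := abs_one_add_sub_le_of_abs_sub_le_exp (r := γ - t / γ)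
    (hg1.differentiable one_ne_zero) hgeven hH hγ hc hK (by linarith) (by linarith)
    (by linarith) hb
  rw [sub_sub_cancel, mul_div_cancel₀ _ hγ.ne'] at h1
  have h2 : Real.exp (-(γ - t / γ) ^ 2) ≤ (γ ^ 4)⁻¹ :=
    (Real.exp_le_exp.2 (by nlinarith)).trans hexp4
  have h3 : 1 ≤ Real.exp (δ₀ * t) := Real.one_le_exp (by positivity)
  have h4 : |1 + g 0 - H γ| ≤ (4 * M * Q + 1) * |H γ| := by
    have := mul_le_mul_of_nonneg_left hlow hMpos.le
    linarith
  have h5 : |1 + g 0 - H γ| * Real.exp (-(γ - t / γ) ^ 2)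
      ≤ (4 * M * Q + 1) * |H γ| * ε * Real.exp (δ₀ * t) := by
    refine (mul_le_mul h4 (h2.trans ?_) (by positivity)
      (by positivity)).trans (le_mul_of_one_le_right (by positivity) h3)
    simp [hε]
  calc |1 + g (γ - t / γ) - H γ| ≤ _ := h1
    _ ≤ (4 * M * Q + 1) * |H γ| * ε * Real.exp (δ₀ * t)
        + 2 * (C * |H γ| * ε) / c * Real.exp (δ₀ * t) := by
      gcongr ?_ + _
    _ = _ := by ring
end

section
/- Locally uniform expansion of the perturbed exponential near zero: under hypotheses (H∞) and (H₀), for every compact subset K of (0,∞), sup_{t∈K} |(1 + g(t/γ))·exp(t²/γ²) − (1 + g(0)) − 2B(γ)F(t)t/(γ(κ+1))| / (B(γ)/γ + γ⁻²) → 0 as γ → +∞. -/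
open Filter

/-- A supremum divided by an eventually positive gauge tends to zero as soon as the family is
uniformly negligible with respect to that gauge. -/
theorem tendsto_iSup_abs_div_zero {ι : Type*} {l : Filter ℝ} {f : ℝ → ι → ℝ} {d : ℝ → ℝ}
    (hd : ∀ᶠ γ in l, 0 < d γ) (h : ∀ ε > 0, ∀ᶠ γ in l, ∀ i, |f γ i| ≤ ε * d γ) :
    Tendsto (fun γ => (⨆ i, |f γ i|) / d γ) l (nhds 0) := by
  rw [Metric.tendsto_nhds]
  intro ε hε
  filter_upwards [hd, h (ε / 2) (half_pos hε)] with γ hdγ hγ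
  have hnonneg : 0 ≤ ⨆ i, |f γ i| := Real.iSup_nonneg fun i => abs_nonneg _
  have hle : (⨆ i, |f γ i|) ≤ ε / 2 * d γ := Real.iSup_le hγ (by positivity)
  rw [Real.dist_eq, sub_zero, abs_of_nonneg (by positivity), div_lt_iff₀ hdγ]
  nlinarith

/-- If the supremum of a bounded family divided by a positive gauge tends to zero, the family is
uniformly negligible with respect to that gauge. -/
theorem eventually_abs_le_of_tendsto_iSup_abs_div_zero {ι : Type*} {l : Filter ℝ}
    {f : ℝ → ι → ℝ} {d : ℝ → ℝ} (hd : ∀ᶠ γ in l, 0 < d γ)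
    (hb : ∀ᶠ γ in l, BddAbove (Set.range fun i => |f γ i|))
    (h : Tendsto (fun γ => (⨆ i, |f γ i|) / d γ) l (nhds 0)) {ε : ℝ} (hε : 0 < ε) :
    ∀ᶠ γ in l, ∀ i, |f γ i| ≤ ε * d γ := by
  filter_upwards [hd, hb, h.eventually_lt_const hε] with γ hdγ hbγ hγ i
  rw [div_lt_iff₀ hdγ] at hγ
  exact (le_ciSup hbγ i).trans hγ.le

/-- A mean value estimate on `[0, M]`, with a rough bound on the derivative on `[0, η]` and a
finer one on `[η, M]`. -/
theorem abs_le_of_abs_deriv_le_of_abs_deriv_le {R R' : ℝ → ℝ} {η M c e : ℝ}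
    (hη : 0 ≤ η) (hηM : η ≤ M) (he : 0 ≤ e) (hR0 : R 0 = 0) (hR : ∀ s, HasDerivAt R (R' s) s)
    (hc : ∀ s ∈ Set.Icc 0 M, |R' s| ≤ c) (hfine : ∀ s ∈ Set.Icc η M, |R' s| ≤ e)
    {t : ℝ} (ht : t ∈ Set.Icc 0 M) : |R t| ≤ c * η + e * M := by
  have hc0 : 0 ≤ c := (abs_nonneg _).trans (hc t ht)
  have hleft : ∀ x ∈ Set.Icc 0 η, |R x| ≤ c * η := fun x hx => by
    have := norm_image_sub_le_of_norm_deriv_le_segment' (f := R) (f' := R') (a := 0) (b := η)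
      (C := c) (fun s _ => (hR s).hasDerivWithinAt)
      (fun s hs => hc s ⟨hs.1, hs.2.le.trans hηM⟩) x hx
    rw [hR0, sub_zero, sub_zero, Real.norm_eq_abs] at this
    exact this.trans (mul_le_mul_of_nonneg_left hx.2 hc0)
  have hM : 0 ≤ M := hη.trans hηM
  rcases le_total t η with h | h
  · exact (hleft t ⟨ht.1, h⟩).trans (le_add_of_nonneg_right (by positivity))
  · have hright := norm_image_sub_le_of_norm_deriv_le_segment' (f := R) (f' := R') (a := η)
      (b := M) (C := e) (fun s _ => (hR s).hasDerivWithinAt)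
      (fun s hs => hfine s ⟨hs.1, hs.2.le⟩) t ⟨h, ht.2⟩
    rw [Real.norm_eq_abs] at hright
    have hsplit : |R t| ≤ |R η| + |R t - R η| := by
      simpa using abs_add_le (R η) (R t - R η)
    have htM : e * (t - η) ≤ e * M := mul_le_mul_of_nonneg_left (by linarith [ht.2]) he
    linarith [hleft η ⟨hη, le_rfl⟩]

/-- The derivative of the remainder in the expansion of the perturbed exponential, where `H` is
such that `2 s H(s) exp(s²)` is the derivative of `(1 + g(s)) exp(s²)`. -/
theorem hasDerivAt_perturbed_exponential_remainder {g H : ℝ → ℝ} (hg : Differentiable ℝ g)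
    (hgeven : ∀ t, g (-t) = g t) (hH : ∀ t, H t = 1 + g t + deriv g t / (2 * t))
    {κ : ℝ} (hκ : 0 ≤ κ) (b : ℝ) {γ : ℝ} (hγ : γ ≠ 0) (s : ℝ) :
    HasDerivAt (fun t => (1 + g (t / γ)) * Real.exp (t ^ 2 / γ ^ 2) - (1 + g 0)
        - 2 * b * t ^ (κ + 1) / (γ * (κ + 1)))
      (2 / γ * (s / γ * H (s / γ) * Real.exp (s ^ 2 / γ ^ 2) - b * s ^ κ)) s := by
  have hderiv0 : deriv g 0 = 0 := by
    have hneg := deriv_comp_neg g 0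
    rw [funext hgeven, neg_zero] at hneg
    linarith
  have hxH : ∀ x, x * H x = x * (1 + g x) + deriv g x / 2 := fun x => by
    rcases eq_or_ne x 0 with rfl | hx
    · simp [hderiv0]
    · rw [hH]; field_simp
  have hgs : HasDerivAt (fun t => 1 + g (t / γ)) (deriv g (s / γ) * (1 / γ)) s :=
    ((hg (s / γ)).hasDerivAt.comp s ((hasDerivAt_id s).div_const γ)).const_add 1
  have hexp : HasDerivAt (fun t => Real.exp (t ^ 2 / γ ^ 2))
      (Real.exp (s ^ 2 / γ ^ 2) * (2 * s / γ ^ 2)) s := by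
    simpa using ((hasDerivAt_pow 2 s).div_const (γ ^ 2)).exp
  have hpow : HasDerivAt (fun t : ℝ => 2 * b * t ^ (κ + 1) / (γ * (κ + 1)))
      (2 * b * ((κ + 1) * s ^ κ) / (γ * (κ + 1))) s := by
    have := Real.hasDerivAt_rpow_const (x := s) (p := κ + 1) (Or.inr (by linarith))
    rw [add_sub_cancel_right] at this
    exact (this.const_mul (2 * b)).div_const _
  refine (((hgs.mul hexp).sub_const (1 + g 0)).sub hpow).congr_deriv ?_
  have hκ1 : κ + 1 ≠ 0 := by positivity
  rw [hxH]
  field_simp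
  ring

/-- Locally uniform expansion of the perturbed exponential near zero: under hypotheses
(H∞) and (H₀), for every compact `K ⊆ (0,∞)`,
`sup_{t∈K} |(1 + g(t/γ))·exp(t²/γ²) − (1 + g(0)) − 2B(γ)F(t)t/(γ(κ+1))| / (B(γ)/γ + γ⁻²) → 0`
as `γ → +∞`. -/
theorem perturbed_exponential_expansion_at_zero
    (g : ℝ → ℝ) (hg1 : ContDiff ℝ 1 g) (hgeven : ∀ t, g (-t) = g t)
    (hgpos : ∀ t, g t > -1) (hg0 : Tendsto g atTop (nhds 0))
    (H : ℝ → ℝ) (hH : ∀ t, H t = 1 + g t + deriv g t / (2 * t))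
    -- hypothesis (H∞)
    (δ₀ : ℝ) (hδ₀ : δ₀ ∈ Set.Ioo (0 : ℝ) 1)
    (A : ℝ → ℝ) (hA : Tendsto A atTop (nhds 0))
    (hHa : ∀ T > (0 : ℝ), Tendsto (fun γ : ℝ =>
      (⨆ t : Set.Icc (0 : ℝ) T, |H (γ - (t : ℝ) / γ) - H γ * (1 + A γ * (t : ℝ))|)
        / (|H γ| * (|A γ| + (γ ^ 4)⁻¹))) atTop (nhds 0))
    (hHb : ∃ C > (0 : ℝ), ∀ᶠ γ : ℝ in atTop, ∀ t ∈ Set.Icc (0 : ℝ) (γ ^ 2),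
      |H (γ - t / γ) - H γ| ≤ C * |H γ| * (|A γ| + (γ ^ 4)⁻¹) * Real.exp (δ₀ * t))
    -- hypothesis (H₀)
    (δ₀' : ℝ) (hδ₀' : δ₀' ∈ Set.Ioo (0 : ℝ) 1)
    (κ : ℝ) (hκ : 0 ≤ κ) (ε₀ : ℝ) (hε₀ : ε₀ = -1 ∨ ε₀ = 1)
    (F : ℝ → ℝ) (hF : ∀ t, F t = ε₀ * t ^ κ)
    (B : ℝ → ℝ) (hBpos : ∀ γ > (0 : ℝ), 0 < B γ)
    (hZa : ∀ K : Set ℝ, IsCompact K → K ⊆ Set.Ioi 0 →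
      Tendsto (fun γ : ℝ =>
        (⨆ t : K, |((t : ℝ) / γ) * H ((t : ℝ) / γ) - B γ * F (t : ℝ)|)
          / (B γ + γ⁻¹)) atTop (nhds 0))
    (hZb : ∃ C > (0 : ℝ), ∀ᶠ γ : ℝ in atTop, ∀ t ∈ Set.Icc (0 : ℝ) (γ ^ 2),
      |(t / γ) * H (t / γ)| ≤ C * (B γ + γ⁻¹) * Real.exp (δ₀' * t)) :
    ∀ K : Set ℝ, IsCompact K → K ⊆ Set.Ioi 0 →
      Tendsto (fun γ : ℝ =>
        (⨆ t : K, |(1 + g ((t : ℝ) / γ)) * Real.exp ((t : ℝ) ^ 2 / γ ^ 2) - (1 + g 0)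
          - 2 * B γ * F (t : ℝ) * (t : ℝ) / (γ * (κ + 1))|)
          / (B γ / γ + (γ ^ 2)⁻¹)) atTop (nhds 0) := by
  intro K hK hKpos
  obtain ⟨C, hC, hZb⟩ := hZb
  obtain ⟨M₀, hM₀⟩ := hK.bddAbove
  set M := max M₀ 1
  have hM : 0 < M := lt_max_of_lt_right one_pos
  have hKM : ∀ t ∈ K, t ∈ Set.Icc 0 M := fun t ht =>
    ⟨(hKpos ht).le, (hM₀ ht).trans (le_max_left _ _)⟩
  have hgauge : ∀ᶠ γ : ℝ in atTop, 0 < B γ + γ⁻¹ := by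
    filter_upwards [eventually_gt_atTop 0] with γ hγ
    have := hBpos γ hγ
    positivity
  have hfactor : ∀ γ : ℝ, B γ / γ + (γ ^ 2)⁻¹ = (B γ + γ⁻¹) / γ := fun γ => by
    rw [add_div, pow_two, mul_inv, div_eq_mul_inv γ⁻¹]
  set C₁ := C * Real.exp M
  have hC₁ : 0 < C₁ := by positivity
  have hbound : ∀ᶠ γ : ℝ in atTop, ∀ s ∈ Set.Icc 0 M,
      |s / γ * H (s / γ)| ≤ C₁ * (B γ + γ⁻¹) := by
    filter_upwards [hZb, hgauge, eventually_ge_atTop M, eventually_ge_atTop 1] with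
      γ hγ hd hMγ h1γ s hs
    have hexp : Real.exp (δ₀' * s) ≤ Real.exp M :=
      Real.exp_le_exp.2 (by nlinarith [hs.1, hs.2, hδ₀'.1, hδ₀'.2])
    calc _ ≤ C * (B γ + γ⁻¹) * Real.exp (δ₀' * s) := hγ s ⟨hs.1, by nlinarith [hs.2]⟩
      _ ≤ C * (B γ + γ⁻¹) * Real.exp M := by gcongr
      _ = C₁ * (B γ + γ⁻¹) := by ring
  have hFbound : ∀ γ > (0 : ℝ), ∀ s ∈ Set.Icc 0 M,
      |B γ * F s| ≤ M ^ κ * (B γ + γ⁻¹) := fun γ hγ s hs => by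
    have hε₀abs : |ε₀| = 1 := by rcases hε₀ with h | h <;> simp [h]
    have hB := hBpos γ hγ
    rw [hF, abs_mul, abs_mul, hε₀abs, one_mul, abs_of_pos hB,
      abs_of_nonneg (Real.rpow_nonneg hs.1 κ), mul_comm]
    have : s ^ κ ≤ M ^ κ := Real.rpow_le_rpow hs.1 hs.2 hκ
    have : 0 < γ⁻¹ := inv_pos.2 hγ
    gcongr
    linarith
  have hexp : ∀ ε > 0, ∀ᶠ γ : ℝ in atTop, ∀ s ∈ Set.Icc 0 M,
      |Real.exp (s ^ 2 / γ ^ 2) - 1| ≤ ε := fun ε hε => by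
    have hlim : Tendsto (fun γ : ℝ => Real.exp (M ^ 2 / γ ^ 2)) atTop (nhds 1) := by
      have := (tendsto_const_nhds (x := M ^ 2)).div_atTop
        (tendsto_pow_atTop (α := ℝ) two_ne_zero)
      simpa using this.rexp
    filter_upwards [hlim.eventually_lt_const (show (1 : ℝ) < 1 + ε by linarith)] with γ hγ s hs
    have hle : Real.exp (s ^ 2 / γ ^ 2) ≤ Real.exp (M ^ 2 / γ ^ 2) := by
      have := hs.1
      have := hs.2
      gcongr
    rw [abs_of_nonneg (sub_nonneg.2 (Real.one_le_exp (by positivity)))]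
    linarith
  have hperturb : ∀ γ s : ℝ, |s / γ * H (s / γ) * Real.exp (s ^ 2 / γ ^ 2) - B γ * F s| ≤
      |s / γ * H (s / γ) - B γ * F s|
        + |s / γ * H (s / γ)| * |Real.exp (s ^ 2 / γ ^ 2) - 1| := fun γ s => by
    rw [← abs_mul]
    refine le_trans (le_of_eq ?_) (abs_add_le _ _)
    congr 1
    ring
  set C₂ := 2 * C₁ + M ^ κ
  have hC₂ : 0 < C₂ := by positivity
  refine tendsto_iSup_abs_div_zero ?_ fun ε hε => ?_
  · filter_upwards [hgauge, eventually_gt_atTop 0] with γ hd hγ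
    rw [hfactor]
    positivity
  set η := min M (ε / (4 * C₂))
  have hη : 0 < η := lt_min hM (by positivity)
  have hηM : η ≤ M := min_le_left _ _
  have hC₂η : C₂ * η ≤ ε / 4 := by
    calc C₂ * η ≤ C₂ * (ε / (4 * C₂)) := by gcongr; exact min_le_right _ _
      _ = ε / 4 := by field_simp
  have hbdd : ∀ᶠ γ : ℝ in atTop, BddAbove (Set.range fun t : Set.Icc η M =>
      |((t : ℝ) / γ) * H ((t : ℝ) / γ) - B γ * F (t : ℝ)|) := by
    filter_upwards [hbound, eventually_gt_atTop 0] with γ hγ hγ0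
    refine ⟨C₁ * (B γ + γ⁻¹) + M ^ κ * (B γ + γ⁻¹), ?_⟩
    rintro _ ⟨⟨t, ht⟩, rfl⟩
    have ht' : t ∈ Set.Icc 0 M := ⟨hη.le.trans ht.1, ht.2⟩
    exact (abs_sub _ _).trans (add_le_add (hγ t ht') (hFbound γ hγ0 t ht'))
  have hfine := eventually_abs_le_of_tendsto_iSup_abs_div_zero hgauge hbdd
    (hZa (Set.Icc η M) isCompact_Icc fun t ht => hη.trans_le ht.1)
    (show 0 < ε / (8 * M) by positivity)
  filter_upwards [hgauge, hbound, hfine, hexp 1 one_pos,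
    hexp (ε / (8 * M * C₁)) (by positivity), eventually_gt_atTop 0] with
    γ hd hγ hγfine hγexp hγexp' hγ0
  rintro ⟨t, ht⟩
  have hderiv := hasDerivAt_perturbed_exponential_remainder (hg1.differentiable one_ne_zero)
    hgeven hH hκ (B γ * ε₀) hγ0.ne'
  have hderiv_abs : ∀ s e : ℝ,
      |s / γ * H (s / γ) * Real.exp (s ^ 2 / γ ^ 2) - B γ * F s| ≤ e →
      |2 / γ * (s / γ * H (s / γ) * Real.exp (s ^ 2 / γ ^ 2) - B γ * ε₀ * s ^ κ)|
        ≤ 2 / γ * e := fun s e h => by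
    rw [hF, ← mul_assoc] at h
    rw [abs_mul, abs_of_pos (show 0 < 2 / γ by positivity)]
    gcongr
  have hestimate := abs_le_of_abs_deriv_le_of_abs_deriv_le (t := t)
    (c := 2 / γ * (C₂ * (B γ + γ⁻¹))) (e := 2 / γ * (ε / (4 * M) * (B γ + γ⁻¹)))
    hη.le hηM (by positivity) ?_ hderiv ?_ ?_ (hKM t ht)
  · have hFt : 2 * B γ * F t * t / (γ * (κ + 1))
        = 2 * (B γ * ε₀) * t ^ (κ + 1) / (γ * (κ + 1)) := by
      rw [hF, Real.rpow_add_one (ne_of_gt (hKpos ht))]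
      ring
    simp only [hFt, hfactor]
    refine hestimate.trans ?_
    calc _ = 2 * (C₂ * η + ε / 4) * ((B γ + γ⁻¹) / γ) := by field_simp
      _ ≤ ε * ((B γ + γ⁻¹) / γ) := by gcongr; linarith
  · have hκ1 : κ + 1 ≠ 0 := by positivity
    simp [Real.zero_rpow hκ1]
  · intro s hs
    refine hderiv_abs s _ ((hperturb γ s).trans ?_)
    have hdiff := (abs_sub (s / γ * H (s / γ)) (B γ * F s)).trans
      (add_le_add (hγ s hs) (hFbound γ hγ0 s hs))
    have hprod := mul_le_mul (hγ s hs) (hγexp s hs) (abs_nonneg _) (by positivity)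
    calc _ ≤ (C₁ * (B γ + γ⁻¹) + M ^ κ * (B γ + γ⁻¹)) + C₁ * (B γ + γ⁻¹) * 1 :=
          add_le_add hdiff hprod
      _ = C₂ * (B γ + γ⁻¹) := by ring
  · intro s hs
    refine hderiv_abs s _ ((hperturb γ s).trans ?_)
    have hs' : s ∈ Set.Icc 0 M := ⟨hη.le.trans hs.1, hs.2⟩
    have hprod := mul_le_mul (hγ s hs') (hγexp' s hs') (abs_nonneg _) (by positivity)
    calc _ ≤ ε / (8 * M) * (B γ + γ⁻¹) + C₁ * (B γ + γ⁻¹) * (ε / (8 * M * C₁)) :=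
          add_le_add (hγfine ⟨s, hs⟩) hprod
      _ = ε / (4 * M) * (B γ + γ⁻¹) := by field_simp; ring
end

section
/- Global bound for the perturbed exponential near zero: under hypotheses (H∞) and (H₀), there exists a constant C′ > 0 such that for all sufficiently large γ and all t ∈ [0,γ], |(1 + g(t/γ))·exp(t²/γ²) − (1 + g(0))| ≤ C′·(B(γ)/γ + γ⁻²)·t·exp(δ₀′ t). -/
open Filter

/-- Global bound for the perturbed exponential near zero: under hypotheses (H∞) and (H₀),
there is `C′ > 0` such that for all sufficiently large `γ` and all `t ∈ [0,γ]`,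
`|(1 + g(t/γ))·exp(t²/γ²) − (1 + g(0))| ≤ C′·(B(γ)/γ + γ⁻²)·t·exp(δ₀′ t)`. -/
theorem perturbed_exponential_global_bound_at_zero
    (g : ℝ → ℝ) (hg1 : ContDiff ℝ 1 g) (hgeven : ∀ t, g (-t) = g t)
    (hgpos : ∀ t, g t > -1) (hg0 : Tendsto g atTop (nhds 0))
    (H : ℝ → ℝ) (hH : ∀ t, H t = 1 + g t + deriv g t / (2 * t))
    -- hypothesis (H∞)
    (δ₀ : ℝ) (hδ₀ : δ₀ ∈ Set.Ioo (0 : ℝ) 1)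
    (A : ℝ → ℝ) (hA : Tendsto A atTop (nhds 0))
    (hHa : ∀ T > (0 : ℝ), Tendsto (fun γ : ℝ =>
      (⨆ t : Set.Icc (0 : ℝ) T, |H (γ - (t : ℝ) / γ) - H γ * (1 + A γ * (t : ℝ))|)
        / (|H γ| * (|A γ| + (γ ^ 4)⁻¹))) atTop (nhds 0))
    (hHb : ∃ C > (0 : ℝ), ∀ᶠ γ : ℝ in atTop, ∀ t ∈ Set.Icc (0 : ℝ) (γ ^ 2),
      |H (γ - t / γ) - H γ| ≤ C * |H γ| * (|A γ| + (γ ^ 4)⁻¹) * Real.exp (δ₀ * t))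
    -- hypothesis (H₀)
    (δ₀' : ℝ) (hδ₀' : δ₀' ∈ Set.Ioo (0 : ℝ) 1)
    (κ : ℝ) (hκ : 0 ≤ κ) (ε₀ : ℝ) (hε₀ : ε₀ = -1 ∨ ε₀ = 1)
    (F : ℝ → ℝ) (hF : ∀ t, F t = ε₀ * t ^ κ)
    (B : ℝ → ℝ) (hBpos : ∀ γ > (0 : ℝ), 0 < B γ)
    (hZa : ∀ K : Set ℝ, IsCompact K → K ⊆ Set.Ioi 0 →
      Tendsto (fun γ : ℝ =>
        (⨆ t : K, |((t : ℝ) / γ) * H ((t : ℝ) / γ) - B γ * F (t : ℝ)|)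
          / (B γ + γ⁻¹)) atTop (nhds 0))
    (hZb : ∃ C > (0 : ℝ), ∀ᶠ γ : ℝ in atTop, ∀ t ∈ Set.Icc (0 : ℝ) (γ ^ 2),
      |(t / γ) * H (t / γ)| ≤ C * (B γ + γ⁻¹) * Real.exp (δ₀' * t)) :
    ∃ C' > (0 : ℝ), ∀ᶠ γ : ℝ in atTop, ∀ t ∈ Set.Icc (0 : ℝ) γ,
      |(1 + g (t / γ)) * Real.exp (t ^ 2 / γ ^ 2) - (1 + g 0)|
        ≤ C' * (B γ / γ + (γ ^ 2)⁻¹) * t * Real.exp (δ₀' * t) := by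
  obtain ⟨C, hC, hZ⟩ := hZb
  refine ⟨2 * Real.exp 1 * C, by positivity, ?_⟩
  filter_upwards [hZ, eventually_ge_atTop 1] with γ hγ hγ1 t ht
  have hγ0 : 0 < γ := by linarith
  rcases ht.1.eq_or_lt with rfl | ht0
  · simp
  have hderiv (s : ℝ) : HasDerivAt (fun s => (1 + g (s / γ)) * Real.exp (s ^ 2 / γ ^ 2))
      (deriv g (s / γ) * (1 / γ) * Real.exp (s ^ 2 / γ ^ 2) +
        (1 + g (s / γ)) * (Real.exp (s ^ 2 / γ ^ 2) * (2 * s / γ ^ 2))) s := by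
    have hg : HasDerivAt g (deriv g (s / γ)) (s / γ) :=
      (hg1.differentiable one_ne_zero _).hasDerivAt
    have hgs := (hg.comp s ((hasDerivAt_id s).div_const γ)).const_add 1
    have hexp := ((hasDerivAt_pow 2 s).div_const (γ ^ 2)).exp
    simpa [Pi.mul_def] using hgs.mul hexp
  obtain ⟨c, ⟨hc0, hct⟩, hc⟩ := exists_hasDerivAt_eq_slope _ _ ht0
    (fun s _ => (hderiv s).continuousAt.continuousWithinAt) (fun s _ => hderiv s)
  have hslope : deriv g (c / γ) * (1 / γ) * Real.exp (c ^ 2 / γ ^ 2) +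
      (1 + g (c / γ)) * (Real.exp (c ^ 2 / γ ^ 2) * (2 * c / γ ^ 2)) =
      2 / γ * Real.exp (c ^ 2 / γ ^ 2) * (c / γ * H (c / γ)) := by
    rw [hH]
    field_simp
    ring
  rw [hslope, eq_div_iff (by linarith)] at hc
  have hBγ := hBpos γ hγ0
  have hHc := hγ c ⟨hc0.le, by nlinarith [ht.2]⟩
  have hexp_le : Real.exp (c ^ 2 / γ ^ 2) ≤ Real.exp 1 := by
    rw [Real.exp_le_exp, div_le_one (by positivity)]
    exact pow_le_pow_left₀ hc0.le (hct.le.trans ht.2) 2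
  have hexp_mono : Real.exp (δ₀' * c) ≤ Real.exp (δ₀' * t) :=
    Real.exp_le_exp.2 (mul_le_mul_of_nonneg_left hct.le hδ₀'.1.le)
  calc |(1 + g (t / γ)) * Real.exp (t ^ 2 / γ ^ 2) - (1 + g 0)|
      = |2 / γ * Real.exp (c ^ 2 / γ ^ 2) * (c / γ * H (c / γ)) * (t - 0)| := by
        rw [hc]; simp
    _ = 2 / γ * Real.exp (c ^ 2 / γ ^ 2) * |c / γ * H (c / γ)| * t := by
        rw [abs_mul, abs_mul, sub_zero, abs_of_pos ht0,
          abs_of_pos (show 0 < 2 / γ * Real.exp (c ^ 2 / γ ^ 2) by positivity)]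
    _ ≤ 2 / γ * Real.exp 1 * (C * (B γ + γ⁻¹) * Real.exp (δ₀' * t)) * t := by
        gcongr
        exact hHc.trans (by gcongr)
    _ = 2 * Real.exp 1 * C * (B γ / γ + (γ ^ 2)⁻¹) * t * Real.exp (δ₀' * t) := by
        field_simp
end

section
/- Lower bound on the growth of Γ from a nondegenerate exponential tail: let (N_j) be a sequence of positive integers with N_j → ∞ and (Γ_j) a sequence of positive reals. If liminf_{j→∞} φ_{N_j}(Γ_j)/exp(Γ_j) > 0, then liminf_{j→∞} (Γ_j − N_j)/√(N_j) > −∞. -/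
open Filter

/-- `φ_N(t) = Σ_{k=N+1}^∞ t^k/k!`, the tail of the exponential series beyond order `N`. -/
noncomputable def expTail (N : ℕ) (t : ℝ) : ℝ :=
  ∑' k : ℕ, t ^ (N + 1 + k) / (Nat.factorial (N + 1 + k) : ℝ)

/-- Chernoff bound for the tail of the exponential series. -/
lemma expTail_le_exp (N : ℕ) {t s : ℝ} (ht : 0 ≤ t) (hs : 0 ≤ s) :
    expTail N t ≤ Real.exp (t * Real.exp s - s * N) := by
  have hsum := (Real.summable_pow_div_factorial (t * Real.exp s)).mul_left (Real.exp (-(s * N)))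
  have hinj : Function.Injective (fun k : ℕ => N + 1 + k) := add_right_injective _
  have hterm : ∀ k : ℕ, t ^ (N + 1 + k) / (Nat.factorial (N + 1 + k) : ℝ) ≤
      Real.exp (-(s * N)) *
        ((t * Real.exp s) ^ (N + 1 + k) / (Nat.factorial (N + 1 + k) : ℝ)) := by
    intro k
    have hone : 1 ≤ Real.exp (-(s * N)) * Real.exp s ^ (N + 1 + k) := by
      rw [← Real.exp_nat_mul, ← Real.exp_add]
      apply Real.one_le_exp
      push_cast
      nlinarith [mul_nonneg hs (Nat.cast_nonneg (α := ℝ) k)]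
    calc t ^ (N + 1 + k) / (Nat.factorial (N + 1 + k) : ℝ)
        ≤ (t ^ (N + 1 + k) / (Nat.factorial (N + 1 + k) : ℝ)) *
          (Real.exp (-(s * N)) * Real.exp s ^ (N + 1 + k)) :=
          le_mul_of_one_le_right (by positivity) hone
      _ = _ := by rw [mul_pow]; ring
  calc expTail N t
      ≤ ∑' k : ℕ, Real.exp (-(s * N)) *
        ((t * Real.exp s) ^ (N + 1 + k) / (Nat.factorial (N + 1 + k) : ℝ)) :=
        ((Real.summable_pow_div_factorial t).comp_injective hinj).tsum_le_tsum hterm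
          (hsum.comp_injective hinj)
    _ ≤ ∑' m : ℕ, Real.exp (-(s * N)) * ((t * Real.exp s) ^ m / (Nat.factorial m : ℝ)) :=
        tsum_comp_le_tsum_of_inj hsum (fun m => by positivity) hinj
    _ = Real.exp (t * Real.exp s - s * N) := by
        rw [tsum_mul_left, sub_eq_neg_add, Real.exp_add,
          Real.exp_eq_exp_ℝ, NormedSpace.exp_eq_tsum_div]

/-- Below the mean, the normalized tail decays exponentially in the normalized deviation. -/
lemma expTail_div_exp_le {N : ℕ} (hN : 0 < N) {t : ℝ} (ht : 0 ≤ t) (htN : t ≤ N) :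
    expTail N t / Real.exp t ≤ Real.exp ((t - N) / Real.sqrt N + 1) := by
  have hN' : (1 : ℝ) ≤ N := by exact_mod_cast hN
  set s : ℝ := (Real.sqrt N)⁻¹ with hs
  have hs0 : 0 ≤ s := by positivity
  have hs1 : s ≤ 1 := inv_le_one_of_one_le₀ (Real.one_le_sqrt.mpr hN')
  have hsq : N * s ^ 2 = 1 := by
    rw [hs, inv_pow, Real.sq_sqrt (by positivity)]
    exact mul_inv_cancel₀ (by positivity)
  have hexp : Real.exp s - 1 - s ≤ s ^ 2 :=
    (le_abs_self _).trans (Real.abs_exp_sub_one_sub_id_le (by rwa [abs_of_nonneg hs0]))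
  rw [div_le_iff₀ (Real.exp_pos t), ← Real.exp_add]
  refine (expTail_le_exp N ht hs0).trans (Real.exp_le_exp.mpr ?_)
  rw [div_eq_mul_inv, ← hs]
  nlinarith [mul_le_mul_of_nonneg_left hexp ht, mul_le_mul_of_nonneg_right htN (sq_nonneg s)]

/-- Lower bound on the growth of `Γ` from a nondegenerate exponential tail: if `N_j → ∞`,
`Γ_j > 0` and `liminf_j φ_{N_j}(Γ_j)/exp(Γ_j) > 0`, then
`liminf_j (Γ_j − N_j)/√(N_j) > −∞`. -/
theorem liminf_growth_of_expTail_nondegenerate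
    (N : ℕ → ℕ) (Γ : ℕ → ℝ)
    (hN : Tendsto N atTop atTop) (hNpos : ∀ j, 0 < N j) (hΓpos : ∀ j, 0 < Γ j)
    (h : 0 < Filter.liminf
      (fun j => ((expTail (N j) (Γ j) / Real.exp (Γ j) : ℝ) : EReal)) atTop) :
    ⊥ < Filter.liminf
      (fun j => (((Γ j - (N j : ℝ)) / Real.sqrt (N j) : ℝ) : EReal)) atTop := by
  obtain ⟨c, hc0, hc⟩ := EReal.lt_iff_exists_real_btwn.mp h
  have hcpos : 0 < c := by exact_mod_cast hc0
  refine (EReal.bot_lt_coe (min 0 (Real.log c - 1))).trans_le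
    (le_liminf_of_le (by isBoundedDefault) ?_)
  filter_upwards [eventually_lt_of_lt_liminf hc] with j hj
  rw [EReal.coe_lt_coe_iff] at hj
  rw [EReal.coe_le_coe_iff]
  rcases le_total (Γ j) (N j) with hle | hle
  · have hlog := (Real.log_lt_iff_lt_exp hcpos).mpr
      (hj.trans_le (expTail_div_exp_le (hNpos j) (hΓpos j).le hle))
    exact (min_le_right _ _).trans (by linarith)
  · exact (min_le_left _ _).trans (div_nonneg (sub_nonneg.mpr hle) (Real.sqrt_nonneg _))
end
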